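/- arXiv:math/0206218 — 2 statements merged into one kernel-verified Lean document; each statement's English description precedes it below -/
import Mathlib

section
/- Let 0 < s < 1, ε > 0 and B > 0. There exists a constant C > 0, depending only on s, ε and B, such that for every smooth Schwartz solution u of the focusing cubic NLS with ‖u(·,0)‖_{H^s} ≤ B, one has ‖u(·,t)‖_{H^s} ≤ C (1+|t|)^{2s+ε} for all t ∈ ℝ. -/
open MeasureTheory Real

noncomputable section

/-- The Fourier transform on `ℝ`: `f̂(ξ) = ∫ e^{-ixξ} f(x) dx`. -/
def ft (f : ℝ → ℂ) (ξ : ℝ) : ℂ := ∫ x : ℝ, Complex.exp (-Complex.I * x * ξ) * f x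

/-- The Japanese bracket `⟨ξ⟩ = 1 + |ξ|`. -/
def jap (ξ : ℝ) : ℝ := 1 + |ξ|

/-- The Sobolev norm `‖f‖_{H^s} = (∫ ⟨ξ⟩^{2s} |f̂(ξ)|² dξ)^{1/2}`. -/
def HsNorm (s : ℝ) (f : ℝ → ℂ) : ℝ :=
  (∫ ξ : ℝ, jap ξ ^ (2 * s) * ‖ft f ξ‖ ^ 2) ^ ((1 : ℝ) / 2)

/-- The squared `L²` norm. -/
def L2sq (f : ℝ → ℂ) : ℝ := ∫ x : ℝ, ‖f x‖ ^ 2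

/-- The spacetime Fourier transform (x first variable, t second). -/
def stft (u : ℝ → ℝ → ℂ) (ξ τ : ℝ) : ℂ :=
  ∫ t : ℝ, ∫ x : ℝ, Complex.exp (-Complex.I * (x * ξ + t * τ)) * u x t

/-- The `X^{s,b}` norm. -/
def XsbNorm (s b : ℝ) (u : ℝ → ℝ → ℂ) : ℝ :=
  (∫ ξ : ℝ, ∫ τ : ℝ,
    jap ξ ^ (2 * s) * jap (τ - ξ ^ 2) ^ (2 * b) * ‖stft u ξ τ‖ ^ 2) ^ ((1 : ℝ) / 2)

/-- The Fourier multiplier with symbol `θ`: `(mult θ f)̂(ξ) = θ(ξ) f̂(ξ)`. -/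
def mult (θ : ℝ → ℝ) (f : ℝ → ℂ) (x : ℝ) : ℂ :=
  (2 * π)⁻¹ • ∫ ξ : ℝ, Complex.exp (Complex.I * x * ξ) * (θ ξ : ℂ) * ft f ξ

/-- The multiplier applied in the `x`-variable of a spacetime function. -/
def multX (θ : ℝ → ℝ) (u : ℝ → ℝ → ℂ) (x t : ℝ) : ℂ := mult θ (fun y => u y t) x

/-- The cubic nonlinearity `F(z) = |z|² z`. -/
def Fnl (z : ℂ) : ℂ := (‖z‖ : ℂ) ^ 2 * z

/-- The real inner product `⟨f,g⟩ = Re ∫ f ḡ`. -/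
def rip (f g : ℝ → ℂ) : ℝ := (∫ x : ℝ, f x * (starRingEnd ℂ) (g x)).re

/-- The Lyapunov functional `L(u) = ∫ |∂ₓu|² + |u|² - ½|u|⁴`. -/
def Lfun (f : ℝ → ℂ) : ℝ :=
  ∫ x : ℝ, (‖deriv f x‖ ^ 2 + ‖f x‖ ^ 2
    - (1 / 2) * ‖f x‖ ^ 4)

/-- The Lyapunov functional with the `H¹`-part expressed on the Fourier side
(Plancherel form), suitable for `H¹` functions. -/
def LfunH1 (f : ℝ → ℂ) : ℝ :=
  (2 * π)⁻¹ * (∫ ξ : ℝ, (ξ ^ 2 + 1) * ‖ft f ξ‖ ^ 2)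
    - (1 / 2) * ∫ x : ℝ, ‖f x‖ ^ 4

/-- Membership in `H¹(ℝ)`. -/
def MemH1 (f : ℝ → ℂ) : Prop :=
  MemLp f 2 (volume : Measure ℝ) ∧
    Integrable (fun ξ : ℝ => jap ξ ^ (2 : ℝ) * ‖ft f ξ‖ ^ 2)

/-- The ground state `Q(x) = 2^{-1/2} / cosh x`. -/
def Qgs (x : ℝ) : ℝ := (Real.sqrt 2)⁻¹ / Real.cosh x

/-- A point `e^{iα} Q(· - x₀)` of the ground state cylinder. -/
def Qcyl (α x₀ : ℝ) (x : ℝ) : ℂ := Complex.exp (Complex.I * α) * (Qgs (x - x₀) : ℂ)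

/-- The ground state cylinder `Σ`. -/
def groundCyl : Set (ℝ → ℂ) := { f | ∃ α x₀ : ℝ, f = Qcyl α x₀ }

/-- `dist_{H^s}(f, Σ)`. -/
def distHs (s : ℝ) (f : ℝ → ℂ) : ℝ :=
  ⨅ v ∈ groundCyl, HsNorm s (fun x => f x - v x)

/-- A smooth function `u(x,t)` all of whose `x`-derivatives are rapidly decreasing
in `x`, locally uniformly in `t`. -/
structure IsSchwartzInX (u : ℝ → ℝ → ℂ) : Prop where
  smooth : ContDiff ℝ (⊤ : ℕ∞) (fun p : ℝ × ℝ => u p.1 p.2)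
  decay : ∀ (k n : ℕ) (T : ℝ), 0 < T → ∃ C : ℝ, ∀ x t : ℝ, |t| ≤ T →
    |x| ^ k * ‖iteratedDeriv n (fun y => u y t) x‖ ≤ C

/-- A smooth Schwartz solution of the focusing cubic NLS `iu_t + u_xx = -|u|²u`. -/
structure IsSchwartzSolution (u : ℝ → ℝ → ℂ) extends IsSchwartzInX u : Prop where
  eqn : ∀ x t : ℝ, Complex.I * deriv (fun τ => u x τ) t
      + iteratedDeriv 2 (fun y => u y t) x
      = -((‖u x t‖ : ℂ) ^ 2 * u x t)

/-- A Schwartz function on spacetime. -/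
def IsSchwartz2 (u : ℝ → ℝ → ℂ) : Prop :=
  ∃ g : SchwartzMap (ℝ × ℝ) ℂ, ∀ x t : ℝ, u x t = g (x, t)

/-- An admissible high symbol `θ` with parameters `N`, `s`. -/
structure AdmissibleHigh (N s : ℝ) (θ : ℝ → ℝ) : Prop where
  smooth : ContDiff ℝ (⊤ : ℕ∞) θ
  even : ∀ ξ : ℝ, θ (-ξ) = θ ξ
  eq_one : ∀ ξ : ℝ, |ξ| ≤ N → θ ξ = 1
  eq_high : ∀ ξ : ℝ, 2 * N ≤ |ξ| → θ ξ = |ξ| ^ s * N ^ (-s)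
  mono : ∀ ξ η : ℝ, |ξ| ≤ |η| → θ ξ ≤ θ η
  deriv1 : ∀ ξ : ℝ, |deriv (fun ζ => θ ζ ^ 2) ξ| ≤ 10 * θ ξ ^ 2 / jap ξ
  deriv2 : ∀ ξ : ℝ, |iteratedDeriv 2 (fun ζ => θ ζ ^ 2) ξ| ≤ 10 * θ ξ ^ 2 / jap ξ ^ 2

/-- An admissible low symbol `m` with parameters `N`, `s`. -/
structure AdmissibleLow (N s : ℝ) (m : ℝ → ℝ) : Prop where
  smooth : ContDiff ℝ (⊤ : ℕ∞) m
  even : ∀ ξ : ℝ, m (-ξ) = m ξ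
  eq_one : ∀ ξ : ℝ, |ξ| ≤ N → m ξ = 1
  eq_high : ∀ ξ : ℝ, 2 * N ≤ |ξ| → m ξ = |ξ| ^ (s - 1) * N ^ (1 - s)
  anti : ∀ ξ η : ℝ, |ξ| ≤ |η| → m η ≤ m ξ
  mono : ∀ ξ η : ℝ, |ξ| ≤ |η| → m ξ * jap ξ ≤ m η * jap η
  deriv1 : ∀ ξ : ℝ, |deriv m ξ| ≤ 10 * m ξ / jap ξ
  deriv2 : ∀ ξ : ℝ, |iteratedDeriv 2 m ξ| ≤ 10 * m ξ / jap ξ ^ 2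

/-- The multilinear form `Λ₄` on the hyperplane `ξ₁+ξ₂+ξ₃+ξ₄ = 0`. -/
def Lam4 (M : ℝ → ℝ → ℝ → ℝ → ℝ) (f₁ f₂ f₃ f₄ : ℝ → ℂ) : ℂ :=
  ∫ ξ₁ : ℝ, ∫ ξ₂ : ℝ, ∫ ξ₃ : ℝ,
    (M ξ₁ ξ₂ ξ₃ (-(ξ₁ + ξ₂ + ξ₃)) : ℂ) * ft f₁ ξ₁ * ft f₂ ξ₂ * ft f₃ ξ₃
      * ft f₄ (-(ξ₁ + ξ₂ + ξ₃))

/-- The multilinear form `Λ₆` on the hyperplane `ξ₁+⋯+ξ₆ = 0`. -/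
def Lam6 (M : ℝ → ℝ → ℝ → ℝ → ℝ → ℝ → ℝ) (f₁ f₂ f₃ f₄ f₅ f₆ : ℝ → ℂ) : ℂ :=
  ∫ ξ₁ : ℝ, ∫ ξ₂ : ℝ, ∫ ξ₃ : ℝ, ∫ ξ₄ : ℝ, ∫ ξ₅ : ℝ,
    (M ξ₁ ξ₂ ξ₃ ξ₄ ξ₅ (-(ξ₁ + ξ₂ + ξ₃ + ξ₄ + ξ₅)) : ℂ) * ft f₁ ξ₁ * ft f₂ ξ₂
      * ft f₃ ξ₃ * ft f₄ ξ₄ * ft f₅ ξ₅ * ft f₆ (-(ξ₁ + ξ₂ + ξ₃ + ξ₄ + ξ₅))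

/-- The complex conjugate of a function. -/
def cj (f : ℝ → ℂ) : ℝ → ℂ := fun x => (starRingEnd ℂ) (f x)

namespace NLS

open Filter Topology Set

/-- The solution `x ↦ ∫_{-∞}^x e^{2κ(y-x)} h(y) dy` of the damped equation `dv/dx = h - 2κ v`. -/
def damp (κ : ℝ) (h : ℝ → ℂ) (x : ℝ) : ℂ :=
  ∫ y in Iic x, (Real.exp (2 * κ * (y - x)) : ℂ) * h y

variable {κ : ℝ}

lemma integrableOn_exp_damp (hκ : 0 < κ) (x z : ℝ) :
    IntegrableOn (fun y : ℝ => Real.exp (2 * κ * (y - x))) (Iic z) := by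
  have h : IntegrableOn (fun y => Real.exp (2 * κ * y) * Real.exp (-(2 * κ * x))) (Iic z) :=
    (integrableOn_exp_mul_Iic (a := 2 * κ) (by positivity) z).mul_const _
  refine h.congr_fun (fun y _ => ?_) measurableSet_Iic
  simp only
  rw [← Real.exp_add]; ring_nf

lemma integral_exp_damp (hκ : 0 < κ) (x : ℝ) :
    ∫ y in Iic x, Real.exp (2 * κ * (y - x)) = (2 * κ)⁻¹ := by
  have h : ∀ y : ℝ, Real.exp (2 * κ * (y - x))
      = Real.exp (2 * κ * y) * Real.exp (-(2 * κ * x)) := by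
    intro y; rw [← Real.exp_add]; ring_nf
  simp_rw [h]
  rw [integral_mul_const, integral_exp_mul_Iic (by positivity), div_mul_eq_mul_div,
    ← Real.exp_add]
  simp

lemma integrableOn_damp (hκ : 0 < κ) {h : ℝ → ℂ} (hc : Continuous h) {N : ℝ}
    (hN : ∀ x, ‖h x‖ ≤ N) (x z : ℝ) :
    IntegrableOn (fun y : ℝ => (Real.exp (2 * κ * (y - x)) : ℂ) * h y) (Iic z) := by
  refine Integrable.mono' ((integrableOn_exp_damp hκ x z).mul_const N)
    (Continuous.aestronglyMeasurable (by fun_prop)) (ae_of_all _ fun y => ?_)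
  rw [norm_mul, Complex.norm_real, Real.norm_of_nonneg (Real.exp_pos _).le]
  exact mul_le_mul_of_nonneg_left (hN y) (Real.exp_pos _).le

lemma exp_mul_damp (x z : ℝ) (h : ℝ → ℂ) :
    damp κ h x = (Real.exp (2 * κ * (z - x)) : ℂ) *
      ∫ y in Iic x, (Real.exp (2 * κ * (y - z)) : ℂ) * h y := by
  rw [damp, ← integral_const_mul]
  congr 1; ext y
  rw [← mul_assoc, ← Complex.ofReal_mul, ← Real.exp_add]
  ring_nf

lemma hasDerivAt_damp (hκ : 0 < κ) {h : ℝ → ℂ} (hc : Continuous h) {N : ℝ}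
    (hN : ∀ x, ‖h x‖ ≤ N) (x : ℝ) :
    HasDerivAt (damp κ h) (h x - 2 * κ * damp κ h x) x := by
  have hg : Continuous fun y : ℝ => (Real.exp (2 * κ * (y - x)) : ℂ) * h y := by fun_prop
  have e1 : damp κ h = fun z => (Real.exp (2 * κ * (x - z)) : ℂ) *
      ((∫ y in Iic x, (Real.exp (2 * κ * (y - x)) : ℂ) * h y)
        + ∫ y in x..z, (Real.exp (2 * κ * (y - x)) : ℂ) * h y) := by
    ext z
    rw [exp_mul_damp z x, ← intervalIntegral.integral_Iic_sub_Iic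
      (integrableOn_damp hκ hc hN x x) (integrableOn_damp hκ hc hN x z)]
    ring
  have d1 : HasDerivAt (fun z : ℝ => Real.exp (2 * κ * (x - z)))
      (Real.exp (2 * κ * (x - x)) * (2 * κ * (-1))) x := by
    have := ((((hasDerivAt_id x).const_sub x).const_mul (2 * κ))).exp
    simpa using this
  have d2 := (intervalIntegral.integral_hasDerivAt_right (hg.intervalIntegrable x x)
    (hg.stronglyMeasurableAtFilter _ _) hg.continuousAt)
  have d3 := d1.ofReal_comp.mul (d2.const_add
    (∫ y in Iic x, (Real.exp (2 * κ * (y - x)) : ℂ) * h y))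
  rw [e1]
  convert! d3 using 1
  simp
  ring

lemma eq_damp (hκ : 0 < κ) {h v : ℝ → ℂ} (hc : Continuous h) {N V : ℝ}
    (hN : ∀ x, ‖h x‖ ≤ N) (hV : ∀ x, ‖v x‖ ≤ V)
    (hv : ∀ x, HasDerivAt v (h x - 2 * κ * v x) x) (x : ℝ) : v x = damp κ h x := by
  have hd : ∀ y : ℝ, HasDerivAt (fun y : ℝ => (Real.exp (2 * κ * (y - x)) : ℂ) * v y)
      ((Real.exp (2 * κ * (y - x)) : ℂ) * h y) y := by
    intro y
    have d1 : HasDerivAt (fun z : ℝ => Real.exp (2 * κ * (z - x)))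
        (Real.exp (2 * κ * (y - x)) * (2 * κ * 1)) y := by
      have := ((((hasDerivAt_id y).sub_const x).const_mul (2 * κ))).exp
      simpa using this
    convert! d1.ofReal_comp.mul (hv y) using 1
    push_cast; ring
  have ht : Tendsto (fun y : ℝ => (Real.exp (2 * κ * (y - x)) : ℂ) * v y) atBot (𝓝 0) := by
    have h0 : Tendsto (fun y : ℝ => Real.exp (2 * κ * (y - x)) * V) atBot (𝓝 (0 * V)) := by
      refine Tendsto.mul_const V (Real.tendsto_exp_atBot.comp ?_)
      exact (tendsto_atBot_add_const_right _ (-x) tendsto_id).const_mul_atBot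
        (by positivity : 0 < 2 * κ)
    rw [zero_mul] at h0
    refine squeeze_zero_norm (fun y => ?_) h0
    rw [norm_mul, Complex.norm_real, Real.norm_of_nonneg (Real.exp_pos _).le]
    exact mul_le_mul_of_nonneg_left (hV y) (Real.exp_pos _).le
  have := integral_Iic_of_hasDerivAt_of_tendsto' (a := x) (fun y _ => hd y)
    (integrableOn_damp hκ hc hN x x) ht
  rw [damp, this]; simp

lemma norm_damp_le (hκ : 0 < κ) {f h : ℝ → ℂ} {b δ N : ℝ} (hb : 0 ≤ b) (hδ : 0 < δ)
    (hf : Integrable fun x => ‖f x‖ ^ 2) (hL : L2sq f ≤ 4 * κ * δ ^ 2)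
    (hh : ∀ x, ‖h x‖ ≤ b * ‖f x‖ + N) (x : ℝ) :
    ‖damp κ h x‖ ≤ b * δ + N / (2 * κ) := by
  set e : ℝ → ℝ := fun y => Real.exp (2 * κ * (y - x)) with he
  have he0 : ∀ y, 0 < e y := fun y => Real.exp_pos _
  have ie : IntegrableOn e (Iic x) := integrableOn_exp_damp hκ x x
  have e2 : ∀ y, e y ^ 2 = Real.exp (2 * (2 * κ) * (y - x)) := by
    intro y; rw [he, ← Real.exp_nat_mul]; push_cast; ring_nf
  have ie2 : IntegrableOn (fun y => e y ^ 2) (Iic x) := by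
    simp_rw [e2]; exact integrableOn_exp_damp (by positivity) x x
  have se2 : ∫ y in Iic x, e y ^ 2 = (4 * κ)⁻¹ := by
    simp_rw [e2]; rw [integral_exp_damp (by positivity)]; ring_nf
  have pt : ∀ y, e y * ‖f y‖ ≤ 2 * κ * δ * e y ^ 2 + (8 * κ * δ)⁻¹ * ‖f y‖ ^ 2 := by
    intro y
    have h1 : 2 * κ * δ * e y ^ 2 + (8 * κ * δ)⁻¹ * ‖f y‖ ^ 2 - e y * ‖f y‖
        = (8 * κ * δ)⁻¹ * (4 * κ * δ * e y - ‖f y‖) ^ 2 := by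
      field_simp; ring
    have h2 : 0 ≤ (8 * κ * δ)⁻¹ * (4 * κ * δ * e y - ‖f y‖) ^ 2 := by positivity
    linarith
  have hLx : ∫ y in Iic x, ‖f y‖ ^ 2 ≤ L2sq f :=
    setIntegral_le_integral hf (ae_of_all _ fun y => by positivity)
  have i12 : IntegrableOn (fun y => 2 * κ * δ * e y ^ 2 + (8 * κ * δ)⁻¹ * ‖f y‖ ^ 2) (Iic x) :=
    (ie2.const_mul _).add (hf.integrableOn.const_mul _)
  have ib : IntegrableOn (fun y => b * (2 * κ * δ * e y ^ 2 + (8 * κ * δ)⁻¹ * ‖f y‖ ^ 2)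
      + N * e y) (Iic x) :=
    (i12.const_mul b).add (ie.const_mul N)
  calc ‖damp κ h x‖ ≤ ∫ y in Iic x, (b * (2 * κ * δ * e y ^ 2 + (8 * κ * δ)⁻¹ * ‖f y‖ ^ 2)
      + N * e y) := by
        refine norm_integral_le_of_norm_le ib (ae_of_all _ fun y => ?_)
        rw [norm_mul, Complex.norm_real, Real.norm_of_nonneg (he0 y).le]
        calc e y * ‖h y‖ ≤ e y * (b * ‖f y‖ + N) :=
              mul_le_mul_of_nonneg_left (hh y) (he0 y).le
          _ = b * (e y * ‖f y‖) + N * e y := by ring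
          _ ≤ _ := by gcongr; exact pt y
    _ = b * (2 * κ * δ * (4 * κ)⁻¹ + (8 * κ * δ)⁻¹ * ∫ y in Iic x, ‖f y‖ ^ 2)
        + N * (2 * κ)⁻¹ := by
        rw [integral_add (i12.const_mul b) (ie.const_mul N), integral_const_mul, integral_const_mul,
          integral_add (ie2.const_mul _) (hf.integrableOn.const_mul _), integral_const_mul,
          integral_const_mul, se2, integral_exp_damp hκ]
    _ ≤ b * (2 * κ * δ * (4 * κ)⁻¹ + (8 * κ * δ)⁻¹ * (4 * κ * δ ^ 2)) + N * (2 * κ)⁻¹ := by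
        gcongr; exact hLx.trans hL
    _ = b * δ + N / (2 * κ) := by field_simp; ring

/-- A priori bound for bounded solutions of `dv/dx = h - 2κ v`. -/
lemma norm_le_of_damped (hκ : 0 < κ) {f h v : ℝ → ℂ} {b δ N V : ℝ} (hb : 0 ≤ b) (hδ : 0 < δ)
    (hf : Integrable fun x => ‖f x‖ ^ 2) (hL : L2sq f ≤ 4 * κ * δ ^ 2)
    {F : ℝ} (hF : ∀ x, ‖f x‖ ≤ F)
    (hc : Continuous h) (hh : ∀ x, ‖h x‖ ≤ b * ‖f x‖ + N) (hV : ∀ x, ‖v x‖ ≤ V)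
    (hv : ∀ x, HasDerivAt v (h x - 2 * κ * v x) x) (x : ℝ) :
    ‖v x‖ ≤ b * δ + N / (2 * κ) := by
  rw [eq_damp hκ hc (N := b * F + N) (fun x => (hh x).trans (by gcongr; exact hF x)) hV hv x]
  exact norm_damp_le hκ hb hδ hf hL hh x

/-- A priori bound for bounded solutions of the perturbed equation `dv/dx = h + c v - 2κ v`. -/
lemma norm_le_of_perturbed (hκ : 0 < κ) {f h c v : ℝ → ℂ} {N V F : ℝ}
    (hf : Integrable fun x => ‖f x‖ ^ 2) (hL : L2sq f ≤ κ)
    (hF : ∀ x, ‖f x‖ ≤ F)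
    (hc : Continuous h) (hcc : Continuous c) (hh : ∀ x, ‖h x‖ ≤ N)
    (hcf : ∀ x, ‖c x‖ ≤ ‖f x‖) (hV : ∀ x, ‖v x‖ ≤ V)
    (hv : ∀ x, HasDerivAt v (h x + c x * v x - 2 * κ * v x) x) (x : ℝ) :
    ‖v x‖ ≤ N / κ := by
  have hvc : Continuous v := continuous_iff_continuousAt.2 fun x => (hv x).continuousAt
  have bdd : BddAbove (range fun x => ‖v x‖) := ⟨V, by rintro _ ⟨y, rfl⟩; exact hV y⟩
  set S := ⨆ x, ‖v x‖ with hS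
  have hS0 : ∀ x, ‖v x‖ ≤ S := fun x => le_ciSup bdd x
  have hSn : 0 ≤ S := (norm_nonneg _).trans (hS0 0)
  have key : ∀ x, ‖v x‖ ≤ S * (1 / 2) + N / (2 * κ) := by
    refine norm_le_of_damped hκ hSn (by norm_num) hf (by linarith) hF
      (h := fun x => h x + c x * v x) (by fun_prop) (fun y => ?_) hV hv
    calc ‖h y + c y * v y‖ ≤ ‖h y‖ + ‖c y‖ * ‖v y‖ := by
          rw [← norm_mul]; exact norm_add_le _ _
      _ ≤ N + ‖f y‖ * S := by
          gcongr
          · exact hh y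
          · exact hcf y
          · exact hS0 y
      _ = _ := by ring
  have : S ≤ S * (1 / 2) + N / (2 * κ) := ciSup_le key
  have h2 : N / (2 * κ) = N / κ / 2 := by field_simp
  linarith [hS0 x]

end NLS

namespace NLS

open Filter Topology Set

variable {κ : ℝ}

/-- `r` is the solution, bounded by one, of the Riccati equation attached to the scattering problem
with potential `f` and spectral parameter `iκ`. -/
structure IsRiccati (κ : ℝ) (f r : ℝ → ℂ) : Prop where
  norm_le_one : ∀ x, ‖r x‖ ≤ 1
  hasDerivAt : ∀ x, HasDerivAt r
    (-(starRingEnd ℂ) (f x) - 1 / 2 * f x * r x ^ 2 - 2 * κ * r x) x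

lemma IsRiccati.continuous {f r : ℝ → ℂ} (h : IsRiccati κ f r) : Continuous r :=
  continuous_iff_continuousAt.2 fun x => (h.hasDerivAt x).continuousAt

open BoundedContinuousFunction in
lemma exists_isRiccati (hκ : 0 < κ) {f : ℝ → ℂ} {F : ℝ}
    (hf : Integrable fun x => ‖f x‖ ^ 2) (hfc : Continuous f) (hL : L2sq f ≤ κ)
    (hF : ∀ x, ‖f x‖ ≤ F) : ∃ r, IsRiccati κ f r := by
  have hF0 : 0 ≤ F := (norm_nonneg _).trans (hF 0)
  have hL' : L2sq f ≤ 4 * κ * (1 / 2) ^ 2 := by linarith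
  let G : (ℝ → ℂ) → ℝ → ℂ := fun r y => -(starRingEnd ℂ) (f y) - 1 / 2 * f y * r y ^ 2
  have Gc : ∀ r : ℝ →ᵇ ℂ, Continuous (G r) := fun r => by
    have := r.continuous
    simp only [G]
    fun_prop
  have Gb : ∀ (r : ℝ →ᵇ ℂ) (y : ℝ), ‖G r y‖ ≤ (1 + 1 / 2 * ‖r‖ ^ 2) * ‖f y‖ + 0 := by
    intro r y
    calc ‖G r y‖ ≤ ‖-(starRingEnd ℂ) (f y)‖ + ‖1 / 2 * f y * r y ^ 2‖ := norm_sub_le _ _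
      _ = ‖f y‖ + 1 / 2 * ‖f y‖ * ‖r y‖ ^ 2 := by simp
      _ ≤ ‖f y‖ + 1 / 2 * ‖f y‖ * ‖r‖ ^ 2 := by gcongr; exact r.norm_coe_le_norm y
      _ = _ := by ring
  have GF : ∀ (r : ℝ →ᵇ ℂ) (y : ℝ), ‖G r y‖ ≤ (1 + 1 / 2 * ‖r‖ ^ 2) * F := fun r y => by
    have := Gb r y
    have h2 : (1 + 1 / 2 * ‖r‖ ^ 2) * ‖f y‖ ≤ (1 + 1 / 2 * ‖r‖ ^ 2) * F := by
      gcongr; exact hF y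
    linarith
  have Td : ∀ (r : ℝ →ᵇ ℂ) (x : ℝ),
      HasDerivAt (damp κ (G r)) (G r x - 2 * κ * damp κ (G r) x) x :=
    fun r x => hasDerivAt_damp hκ (Gc r) (GF r) x
  have Tb : ∀ (r : ℝ →ᵇ ℂ) (x : ℝ), ‖damp κ (G r) x‖ ≤ (1 + 1 / 2 * ‖r‖ ^ 2) * (1 / 2) := by
    intro r x
    simpa using norm_damp_le hκ (by positivity) (by norm_num) hf hL' (Gb r) x
  let T : (ℝ →ᵇ ℂ) → (ℝ →ᵇ ℂ) := fun r =>
    BoundedContinuousFunction.ofNormedAddCommGroup (damp κ (G r))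
      (continuous_iff_continuousAt.2 fun x => (Td r x).continuousAt) _ (Tb r)
  have Tx : ∀ r x, T r x = damp κ (G r) x := fun r x => rfl
  let s : Set (ℝ →ᵇ ℂ) := Metric.closedBall 0 1
  have hs : ∀ r ∈ s, ‖r‖ ≤ 1 := fun r hr => by simpa [s] using hr
  have maps : MapsTo T s s := by
    intro r hr
    have h1 := hs r hr
    simp only [s, mem_closedBall_zero_iff]
    refine (BoundedContinuousFunction.norm_le zero_le_one).2 fun x => (Tb r x).trans ?_
    nlinarith [norm_nonneg r]
  have contr : ContractingWith (1 / 2) (maps.restrict T s s) := by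
    refine ⟨by simpa using! one_half_lt_one (α := NNReal), LipschitzWith.of_dist_le_mul ?_⟩
    rintro ⟨r₁, hr₁⟩ ⟨r₂, hr₂⟩
    have h1 := hs r₁ hr₁
    have h2 := hs r₂ hr₂
    change dist (T r₁) (T r₂) ≤ _ * dist r₁ r₂
    rw [dist_eq_norm, dist_eq_norm]
    refine (BoundedContinuousFunction.norm_le (by positivity)).2 fun x => ?_
    have := norm_le_of_damped (v := fun x => T r₁ x - T r₂ x)
      (h := fun x => G r₁ x - G r₂ x) (b := ‖r₁ - r₂‖) (N := 0) (V := ‖T r₁ - T r₂‖)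
      hκ (norm_nonneg _) (by norm_num) hf hL' hF
      ((Gc r₁).sub (Gc r₂)) (fun y => ?_) (fun y => (T r₁ - T r₂).norm_coe_le_norm y)
      (fun y => ?_) x
    · simp only [zero_div, add_zero] at this
      simp only [BoundedContinuousFunction.coe_sub, Pi.sub_apply]
      refine this.trans (le_of_eq ?_)
      push_cast; ring
    · have e : G r₁ y - G r₂ y = -(1 / 2 * f y * ((r₁ y + r₂ y) * (r₁ - r₂) y)) := by
        simp only [G, BoundedContinuousFunction.coe_sub, Pi.sub_apply]; ring
      rw [e, norm_neg, norm_mul, norm_mul, norm_mul]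
      have h3 : ‖r₁ y + r₂ y‖ ≤ 2 := by
        have a1 := r₁.norm_coe_le_norm y
        have a2 := r₂.norm_coe_le_norm y
        have a3 := norm_add_le (r₁ y) (r₂ y)
        linarith
      have h4 := (r₁ - r₂).norm_coe_le_norm y
      calc ‖(1 / 2 : ℂ)‖ * ‖f y‖ * (‖r₁ y + r₂ y‖ * ‖(r₁ - r₂) y‖)
          ≤ ‖(1 / 2 : ℂ)‖ * ‖f y‖ * (2 * ‖r₁ - r₂‖) := by gcongr
        _ = _ := by simp; ring
    · simp only [Tx]
      convert! (Td r₁ y).sub (Td r₂ y) using 1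
      ring
  obtain ⟨r, hrs, hfix, -⟩ := contr.exists_fixedPoint' (x := 0)
    Metric.isClosed_closedBall.isComplete maps (by simp [s]) (edist_ne_top _ _)
  have hfx : ∀ x, r x = damp κ (G r) x := fun x => by rw [← Tx, hfix]
  refine ⟨r, fun x => (r.norm_coe_le_norm x).trans (hs r hrs), fun x => ?_⟩
  have h := Td r x
  rw [← hfx x] at h
  have e : damp κ (G r) = r := funext fun y => (hfx y).symm
  rw [e] at h
  exact h

lemma integrable_damp (hκ : 0 < κ) {h : ℝ → ℂ} (hi : Integrable h) :
    Integrable (damp κ h) := by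
  let g : ℝ → ℂ := indicator (Ici 0) fun t => (Real.exp (-(2 * κ) * t) : ℂ)
  have hg : Integrable g := by
    refine IntegrableOn.integrable_indicator ?_ measurableSet_Ici
    rw [integrableOn_Ici_iff_integrableOn_Ioi]
    exact (integrableOn_exp_mul_Ioi (by linarith) 0).ofReal
  have hc := hg.integrable_convolution (ContinuousLinearMap.mul ℝ ℂ) hi
  refine hc.congr (ae_of_all _ fun x => ?_)
  rw [convolution_eq_swap, damp, ← integral_indicator measurableSet_Iic]
  congr 1; ext t
  by_cases ht : t ≤ x
  · have : (0 : ℝ) ≤ x - t := by linarith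
    simp only [g, ContinuousLinearMap.mul_apply', mem_Ici, this, indicator_of_mem, mem_Iic, ht]
    congr 3; ring
  · have : ¬ (0 : ℝ) ≤ x - t := by linarith
    simp [g, ht]

/-- Quadratic form bound for the damped solution operator. -/
lemma norm_integral_mul_damp_le (hκ : 0 < κ) {f h : ℝ → ℂ} {F b : ℝ}
    (hf : Integrable fun x => ‖f x‖ ^ 2) (hfi : Integrable f) (hfc : Continuous f)
    (hF : ∀ x, ‖f x‖ ≤ F) (hb : 0 ≤ b)
    (hh : ∀ x, ‖h x‖ ≤ b * ‖f x‖) :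
    ‖∫ x, f x * damp κ h x‖ ≤ b * L2sq f / (2 * κ) := by
  let p : ℝ → ℝ := fun x => ∫ y in Iic x, Real.exp (2 * κ * (y - x)) * ‖f y‖
  have pe : ∀ x, damp κ (fun y => (‖f y‖ : ℂ)) x = (p x : ℂ) := by
    intro x
    simp only [damp, p]
    rw [← integral_complex_ofReal]
    simp
  have hnc : Continuous fun y => (‖f y‖ : ℂ) := by fun_prop
  have pd : ∀ x, HasDerivAt p (‖f x‖ - 2 * κ * p x) x := by
    intro x
    have h1 := hasDerivAt_damp hκ hnc (N := F) (fun y => by simpa using hF y) x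
    have h2 := Complex.reCLM.hasFDerivAt.comp_hasDerivAt x h1
    convert! h2 using 1
    · ext y; simp [pe]
    · simp [pe, ← Complex.ofReal_ofNat, ← Complex.ofReal_mul]
  have p0 : ∀ x, 0 ≤ p x := fun x => integral_nonneg fun y => by positivity
  have pb : ∀ x, p x ≤ F / (2 * κ) := by
    intro x
    have h1 := norm_damp_le (f := fun _ => 0) (b := 0) (δ := 1) (N := F)
      (h := fun y => (‖f y‖ : ℂ)) hκ le_rfl one_pos (by simp)
      (by simp [L2sq]; positivity) (fun y => by simpa using hF y) x
    rw [pe, Complex.norm_real, Real.norm_of_nonneg (p0 x)] at h1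
    linarith
  have pi : Integrable p := by
    have h1 := (integrable_damp hκ (h := fun y => (‖f y‖ : ℂ)) hfi.norm.ofReal).re
    refine h1.congr (ae_of_all _ fun x => ?_)
    simp [pe]
  have pc : Continuous p := continuous_iff_continuousAt.2 fun x => (pd x).continuousAt
  have pp : Integrable fun x => p x ^ 2 := by
    refine (pi.const_mul (F / (2 * κ))).mono' (by fun_prop) (ae_of_all _ fun x => ?_)
    rw [Real.norm_of_nonneg (by positivity), sq]
    exact mul_le_mul_of_nonneg_right (pb x) (p0 x)
  have fp : Integrable fun x => ‖f x‖ * p x := by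
    refine (pi.const_mul F).mono' (by fun_prop) (ae_of_all _ fun x => ?_)
    rw [Real.norm_of_nonneg (mul_nonneg (norm_nonneg _) (p0 x))]
    exact mul_le_mul_of_nonneg_right (hF x) (p0 x)
  have e1 : ∫ x, (2 * (‖f x‖ * p x) - 4 * κ * p x ^ 2) = 0 := by
    refine integral_eq_zero_of_hasDerivAt_of_integrable (f := fun x => p x ^ 2) (fun x => ?_)
      ((fp.const_mul 2).sub (pp.const_mul (4 * κ))) pp
    convert! (pd x).pow 2 using 1
    push_cast; ring
  rw [integral_sub (fp.const_mul 2) (pp.const_mul (4 * κ)), integral_const_mul,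
    integral_const_mul] at e1
  have e2 : ∫ x, ‖f x‖ * p x ≤ (4 * κ)⁻¹ * L2sq f + κ * ∫ x, p x ^ 2 := by
    rw [L2sq, ← integral_const_mul, ← integral_const_mul, ← integral_add (hf.const_mul _)
      (pp.const_mul _)]
    refine integral_mono fp ((hf.const_mul _).add (pp.const_mul _)) fun x => ?_
    have h1 : (4 * κ)⁻¹ * ‖f x‖ ^ 2 + κ * p x ^ 2 - ‖f x‖ * p x
        = (4 * κ)⁻¹ * (‖f x‖ - 2 * κ * p x) ^ 2 := by field_simp; ring
    have h2 : 0 ≤ (4 * κ)⁻¹ * (‖f x‖ - 2 * κ * p x) ^ 2 := by positivity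
    change ‖f x‖ * p x ≤ (4 * κ)⁻¹ * ‖f x‖ ^ 2 + κ * p x ^ 2
    linarith
  have e3 : ∫ x, ‖f x‖ * p x ≤ L2sq f / (2 * κ) := by
    have : L2sq f / (2 * κ) = 2 * ((4 * κ)⁻¹ * L2sq f) := by field_simp; ring
    linarith
  have e4 : ∀ x, ‖damp κ h x‖ ≤ b * p x := by
    intro x
    have hi : IntegrableOn (fun y => Real.exp (2 * κ * (y - x)) * ‖f y‖) (Iic x) := by
      have := (integrableOn_damp hκ hnc (N := F) (fun y => by simpa using hF y) x x).norm
      refine this.congr (ae_of_all _ fun y => ?_)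
      simp [abs_of_pos (Real.exp_pos _), -Complex.ofReal_exp]
    rw [← integral_const_mul]
    refine norm_integral_le_of_norm_le (hi.const_mul b) (ae_of_all _ fun y => ?_)
    rw [norm_mul, Complex.norm_real, Real.norm_of_nonneg (Real.exp_pos _).le]
    calc _ ≤ Real.exp (2 * κ * (y - x)) * (b * ‖f y‖) :=
          mul_le_mul_of_nonneg_left (hh y) (Real.exp_pos _).le
      _ = _ := by ring
  calc ‖∫ x, f x * damp κ h x‖ ≤ ∫ x, b * (‖f x‖ * p x) := by
        refine norm_integral_le_of_norm_le (fp.const_mul b) (ae_of_all _ fun x => ?_)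
        rw [norm_mul]
        calc ‖f x‖ * ‖damp κ h x‖ ≤ ‖f x‖ * (b * p x) :=
              mul_le_mul_of_nonneg_left (e4 x) (norm_nonneg _)
          _ = _ := by ring
    _ ≤ b * (L2sq f / (2 * κ)) := by
        rw [integral_const_mul]; gcongr
    _ = _ := by ring

end NLS

namespace NLS

open Filter Topology Set FourierTransform SchwartzMap

variable {κ : ℝ}

lemma ft_eq_fourier (f : ℝ → ℂ) (ξ : ℝ) : ft f ξ = 𝓕 f (ξ / (2 * π)) := by
  rw [ft, Real.fourier_real_eq_integral_exp_smul]
  congr 1; ext x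
  rw [smul_eq_mul]
  congr 2
  have : (π : ℂ) ≠ 0 := by exact_mod_cast Real.pi_ne_zero
  push_cast
  field_simp

lemma fourier_conj_fourier (g : 𝓢(ℝ, ℂ)) (x : ℝ) :
    𝓕 (fun v => (starRingEnd ℂ) (𝓕 (g : ℝ → ℂ) v)) x = (starRingEnd ℂ) (g x) := by
  have hinv : 𝓕⁻ (𝓕 (g : ℝ → ℂ)) = g :=
    g.continuous.fourierInv_fourier_eq g.integrable (by
      rw [← SchwartzMap.fourier_coe]; exact (𝓕 g).integrable)
  conv_rhs => rw [← hinv]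
  rw [Real.fourierInv_eq', ← integral_conj, Real.fourier_real_eq_integral_exp_smul]
  congr 1; ext v
  simp only [smul_eq_mul, map_mul, ← Complex.exp_conj, Complex.conj_I, Complex.conj_ofReal,
    RCLike.inner_apply, conj_trivial]
  congr 2
  push_cast; ring

lemma integral_fourier_mul_eq_flip {f φ : ℝ → ℂ} (hf : Integrable f) (hφ : Integrable φ) :
    ∫ x, f x * 𝓕 φ x = ∫ v, 𝓕 f v * φ v := by
  have := VectorFourier.integral_fourierIntegral_smul_eq_flip (L := innerₗ ℝ) (μ := volume)
    (ν := volume) Real.continuous_fourierChar continuous_inner hf hφ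
  have e : (innerₗ ℝ).flip = innerₗ ℝ := by
    ext; simp
  rw [e] at this
  exact this.symm

/-- The denominator of the resolvent symbol. -/
def den (κ v : ℝ) : ℂ := 2 * κ - 2 * π * Complex.I * v

lemma den_re (κ v : ℝ) : (den κ v).re = 2 * κ := by simp [den]

lemma den_im (κ v : ℝ) : (den κ v).im = -(2 * π * v) := by simp [den]

lemma den_ne (hκ : 0 < κ) (v : ℝ) : den κ v ≠ 0 := fun h => by
  have := den_re κ v
  rw [h, Complex.zero_re] at this
  linarith

lemma normSq_den (κ v : ℝ) : Complex.normSq (den κ v) = 4 * κ ^ 2 + (2 * π * v) ^ 2 := by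
  rw [Complex.normSq_apply, den_re, den_im]; ring

lemma norm_den (κ v : ℝ) : ‖den κ v‖ = √(4 * κ ^ 2 + (2 * π * v) ^ 2) := by
  rw [← normSq_den, Complex.norm_def]

lemma le_norm_den (κ v : ℝ) : 2 * κ ≤ ‖den κ v‖ := by
  rw [← den_re κ v]; exact Complex.re_le_norm _

lemma continuous_den (κ : ℝ) : Continuous (den κ) := by unfold den; fun_prop

/-- The symbol whose Fourier transform solves the damped linear equation with source `conj g`. -/
def linSymbol (κ : ℝ) (g : ℝ → ℂ) (v : ℝ) : ℂ := (starRingEnd ℂ) (𝓕 g v) / den κ v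

lemma continuous_linSymbol (hκ : 0 < κ) (g : 𝓢(ℝ, ℂ)) : Continuous (linSymbol κ g) := by
  have h1 : Continuous (𝓕 (g : ℝ → ℂ)) := by
    rw [← SchwartzMap.fourier_coe]; exact (𝓕 g).continuous
  exact (Complex.continuous_conj.comp h1).div (continuous_den κ) (den_ne hκ)

lemma norm_linSymbol_le (hκ : 0 < κ) (g : ℝ → ℂ) (v : ℝ) :
    ‖linSymbol κ g v‖ ≤ (2 * κ)⁻¹ * ‖𝓕 g v‖ := by
  rw [linSymbol, norm_div, RCLike.norm_conj, div_eq_inv_mul]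
  gcongr
  exact le_norm_den κ v

lemma integrable_linSymbol (hκ : 0 < κ) (g : 𝓢(ℝ, ℂ)) : Integrable (linSymbol κ g) := by
  refine ((𝓕 g).integrable.norm.const_mul (2 * κ)⁻¹).mono'
    (continuous_linSymbol hκ g).aestronglyMeasurable (ae_of_all _ fun v => ?_)
  rw [SchwartzMap.fourier_coe]
  exact norm_linSymbol_le hκ g v

lemma integrable_smul_linSymbol (hκ : 0 < κ) (g : 𝓢(ℝ, ℂ)) :
    Integrable fun v : ℝ => v • linSymbol κ g v := by
  have h1 := ((𝓕 g).integrable_pow_mul volume 1).const_mul (2 * κ)⁻¹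
  refine h1.mono' (continuous_id.smul (continuous_linSymbol hκ g)).aestronglyMeasurable
    (ae_of_all _ fun v => ?_)
  rw [SchwartzMap.fourier_coe, norm_smul, pow_one]
  calc ‖v‖ * ‖linSymbol κ g v‖ ≤ ‖v‖ * ((2 * κ)⁻¹ * ‖𝓕 (g : ℝ → ℂ) v‖) := by
        gcongr; exact norm_linSymbol_le hκ g v
    _ = _ := by ring

lemma hasDerivAt_fourier_linSymbol (hκ : 0 < κ) (g : 𝓢(ℝ, ℂ)) (x : ℝ) :
    HasDerivAt (𝓕 (linSymbol κ g))
      ((starRingEnd ℂ) (g x) - 2 * κ * 𝓕 (linSymbol κ g) x) x := by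
  convert! Real.hasDerivAt_fourier (integrable_linSymbol hκ g) (integrable_smul_linSymbol hκ g) x
    using 1
  rw [← fourier_conj_fourier g x]
  rw [Real.fourier_real_eq_integral_exp_smul (fun v => (starRingEnd ℂ) (𝓕 (g : ℝ → ℂ) v)),
    Real.fourier_real_eq_integral_exp_smul (linSymbol κ g),
    Real.fourier_real_eq_integral_exp_smul (fun v => (-2 * π * Complex.I * v) • linSymbol κ g v)]
  simp only [smul_eq_mul]
  have i0 := integrable_linSymbol hκ g
  have i1 := integrable_smul_linSymbol hκ g
  have i2 : Integrable fun v : ℝ => (starRingEnd ℂ) (𝓕 (g : ℝ → ℂ) v) := by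
    have := (𝓕 g).integrable (μ := volume)
    rw [SchwartzMap.fourier_coe] at this
    exact (Complex.conjLIE.integrable_comp_iff).2 this
  have key : ∀ {h : ℝ → ℂ}, Integrable h →
      Integrable fun v : ℝ => Complex.exp (((-2 * π * v * x : ℝ) : ℂ) * Complex.I) * h v := by
    intro h hh
    refine hh.norm.mono' ((Continuous.aestronglyMeasurable (by fun_prop)).mul hh.1)
      (ae_of_all _ fun v => ?_)
    rw [norm_mul, Complex.norm_exp_ofReal_mul_I, one_mul]
  rw [← integral_const_mul, ← integral_sub (key i2) ((key i0).const_mul _)]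
  congr 1; ext v
  have hd := den_ne hκ v
  have e : (starRingEnd ℂ) (𝓕 (g : ℝ → ℂ) v) = den κ v * linSymbol κ g v := by
    rw [linSymbol]; field_simp
  rw [e, den]
  ring

lemma norm_fourier_linSymbol_le (κ : ℝ) (g : ℝ → ℂ) (x : ℝ) :
    ‖𝓕 (linSymbol κ g) x‖ ≤ (2 * π)⁻¹ * ∫ ξ, ‖ft g ξ‖ / √(4 * κ ^ 2 + ξ ^ 2) := by
  have h1 : ‖𝓕 (linSymbol κ g) x‖ ≤ ∫ v, ‖linSymbol κ g v‖ :=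
    VectorFourier.norm_fourierIntegral_le_integral_norm _ _ _ _ _
  refine h1.trans (le_of_eq ?_)
  have h2 := Measure.integral_comp_div (fun v => ‖linSymbol κ g v‖) (2 * π)
  rw [abs_of_pos (by positivity), smul_eq_mul] at h2
  have h3 : ∀ ξ, ‖linSymbol κ g (ξ / (2 * π))‖ = ‖ft g ξ‖ / √(4 * κ ^ 2 + ξ ^ 2) := by
    intro ξ
    rw [linSymbol, norm_div, norm_den, RCLike.norm_conj, ft_eq_fourier]
    congr 4
    field_simp
  simp_rw [h3] at h2
  rw [h2]
  field_simp

lemma integral_norm_sq_ft (g : 𝓢(ℝ, ℂ)) : ∫ ξ, ‖ft g ξ‖ ^ 2 = 2 * π * L2sq g := by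
  have h2 := Measure.integral_comp_div (fun v => ‖𝓕 (g : ℝ → ℂ) v‖ ^ 2) (2 * π)
  rw [abs_of_pos (by positivity), smul_eq_mul] at h2
  simp_rw [ft_eq_fourier]
  rw [h2, L2sq, ← SchwartzMap.integral_norm_sq_fourier, SchwartzMap.fourier_coe]

lemma continuous_ft (g : 𝓢(ℝ, ℂ)) : Continuous (ft g) := by
  have : ft g = fun ξ => (𝓕 g) (ξ / (2 * π)) := by
    ext ξ; rw [ft_eq_fourier, SchwartzMap.fourier_coe]
  rw [this]
  have := (𝓕 g).continuous
  fun_prop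

lemma integrable_pow_mul_ft (g : 𝓢(ℝ, ℂ)) (k : ℕ) :
    Integrable fun ξ => |ξ| ^ k * ‖ft g ξ‖ := by
  have h := (((𝓕 g).integrable_pow_mul volume k).const_mul ((2 * π) ^ k)).comp_div
    (by positivity : (2 * π) ≠ 0)
  refine h.congr (ae_of_all _ fun ξ => ?_)
  simp only
  rw [ft_eq_fourier, SchwartzMap.fourier_coe, ← mul_assoc, ← mul_pow, norm_div,
    Real.norm_eq_abs, Real.norm_of_nonneg (by positivity : (0:ℝ) ≤ 2 * π)]
  congr 2
  field_simp

lemma integrable_jap_rpow_mul_ft (g : 𝓢(ℝ, ℂ)) {p : ℝ} (hp : p ≤ 2) :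
    Integrable fun ξ => jap ξ ^ p * ‖ft g ξ‖ ^ 2 := by
  obtain ⟨C, hC⟩ : ∃ C, ∀ ξ, ‖ft g ξ‖ ≤ C := by
    refine ⟨∫ x, ‖g x‖, fun ξ => ?_⟩
    rw [ft_eq_fourier]
    exact VectorFourier.norm_fourierIntegral_le_integral_norm _ _ _ _ _
  have hc := continuous_ft g
  have hj : Continuous jap := by unfold jap; fun_prop
  have hj1 : ∀ ξ, 1 ≤ jap ξ := fun ξ => by unfold jap; linarith [abs_nonneg ξ]
  have h := (((integrable_pow_mul_ft g 0).const_mul 2).add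
    ((integrable_pow_mul_ft g 2).const_mul 2)).const_mul C
  refine h.mono' (Continuous.aestronglyMeasurable ?_) (ae_of_all _ fun ξ => ?_)
  · refine (hj.rpow_const fun ξ => Or.inl ?_).mul (by fun_prop)
    linarith [hj1 ξ]
  · have h1 : jap ξ ^ p ≤ 2 * |ξ| ^ 0 + 2 * |ξ| ^ 2 := by
      calc jap ξ ^ p ≤ jap ξ ^ (2 : ℝ) := Real.rpow_le_rpow_of_exponent_le (hj1 ξ) hp
        _ = (1 + |ξ|) ^ 2 := by rw [jap]; norm_cast
        _ ≤ _ := by nlinarith [sq_nonneg (1 - |ξ|)]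
    have h0 : 0 ≤ jap ξ ^ p := Real.rpow_nonneg (by linarith [hj1 ξ]) _
    rw [Real.norm_of_nonneg (by positivity), sq]
    calc jap ξ ^ p * (‖ft g ξ‖ * ‖ft g ξ‖)
        ≤ (2 * |ξ| ^ 0 + 2 * |ξ| ^ 2) * (C * ‖ft g ξ‖) := by gcongr; exact hC ξ
      _ = _ := by simp only [Pi.add_apply]; ring

lemma integrable_norm_sq_ft (g : 𝓢(ℝ, ℂ)) : Integrable fun ξ => ‖ft g ξ‖ ^ 2 := by
  simpa using integrable_jap_rpow_mul_ft g (p := 0) (by norm_num)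

lemma integrable_norm_sq (g : 𝓢(ℝ, ℂ)) : Integrable fun x => ‖g x‖ ^ 2 := by
  have := (memLp_two_iff_integrable_sq_norm g.continuous.aestronglyMeasurable).1
    (g.memLp 2 volume)
  exact this

lemma integrable_weight_mul_ft (hκ : 0 < κ) (g : 𝓢(ℝ, ℂ)) :
    Integrable fun ξ => ξ ^ 2 / (4 * κ ^ 2 + ξ ^ 2) * ‖ft g ξ‖ ^ 2 := by
  have hc := continuous_ft g
  have hp : ∀ ξ : ℝ, 0 < 4 * κ ^ 2 + ξ ^ 2 := fun ξ => by positivity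
  refine (integrable_norm_sq_ft g).mono' (Continuous.aestronglyMeasurable ?_)
    (ae_of_all _ fun ξ => ?_)
  · exact ((by fun_prop : Continuous fun ξ : ℝ => ξ ^ 2).div (by fun_prop)
      fun ξ => (hp ξ).ne').mul (by fun_prop)
  · rw [Real.norm_of_nonneg (by positivity)]
    refine mul_le_of_le_one_left (by positivity) ((div_le_one (hp ξ)).2 ?_)
    nlinarith

lemma re_integral_mul_fourier_linSymbol (hκ : 0 < κ) (g : 𝓢(ℝ, ℂ)) :
    4 * π * κ * (∫ x, g x * 𝓕 (linSymbol κ g) x).re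
      = 2 * π * L2sq g - ∫ ξ, ξ ^ 2 / (4 * κ ^ 2 + ξ ^ 2) * ‖ft g ξ‖ ^ 2 := by
  rw [integral_fourier_mul_eq_flip g.integrable (integrable_linSymbol hκ g)]
  have i1 : Integrable fun v => 𝓕 (g : ℝ → ℂ) v * linSymbol κ g v := by
    refine (integrable_linSymbol hκ g).bdd_mul (c := ∫ x, ‖g x‖) ?_ (ae_of_all _ fun v => ?_)
    · rw [← SchwartzMap.fourier_coe]; exact (𝓕 g).continuous.aestronglyMeasurable
    · exact VectorFourier.norm_fourierIntegral_le_integral_norm _ _ _ _ _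
  have h1 : (∫ v, 𝓕 (g : ℝ → ℂ) v * linSymbol κ g v).re
      = ∫ v, (𝓕 (g : ℝ → ℂ) v * linSymbol κ g v).re := (integral_re i1).symm
  have h2 := Measure.integral_comp_div
    (fun v => (𝓕 (g : ℝ → ℂ) v * linSymbol κ g v).re) (2 * π)
  rw [abs_of_pos (by positivity), smul_eq_mul] at h2
  have h3 : ∀ ξ, (𝓕 (g : ℝ → ℂ) (ξ / (2 * π)) * linSymbol κ g (ξ / (2 * π))).re
      = ‖ft g ξ‖ ^ 2 * (2 * κ / (4 * κ ^ 2 + ξ ^ 2)) := by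
    intro ξ
    have e1 : 2 * π * (ξ / (2 * π)) = ξ := by field_simp
    rw [linSymbol, ← mul_div_assoc, Complex.mul_conj, Complex.normSq_eq_norm_sq,
      ft_eq_fourier, Complex.div_re, den_re, den_im, normSq_den, e1,
      Complex.ofReal_re, Complex.ofReal_im]
    ring
  simp_rw [h3] at h2
  have h4 : 4 * π * κ * ∫ v, (𝓕 (g : ℝ → ℂ) v * linSymbol κ g v).re
      = ∫ ξ, (‖ft g ξ‖ ^ 2 - ξ ^ 2 / (4 * κ ^ 2 + ξ ^ 2) * ‖ft g ξ‖ ^ 2) := by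
    calc _ = 2 * κ * (2 * π * ∫ v, (𝓕 (g : ℝ → ℂ) v * linSymbol κ g v).re) := by ring
      _ = _ := by
        rw [← h2, ← integral_const_mul]
        congr 1; ext ξ
        have : 4 * κ ^ 2 + ξ ^ 2 ≠ 0 := by positivity
        field_simp; ring
  rw [h1, h4, integral_sub (integrable_norm_sq_ft g) (integrable_weight_mul_ft hκ g),
    integral_norm_sq_ft]

/-- The conserved quantity `∫ g r` determines the high-frequency part of the mass of `g`, up to
an error of fourth order. -/
lemma abs_weighted_mass_sub_le (hκ : 0 < κ) (g : 𝓢(ℝ, ℂ)) {r : ℝ → ℂ} (hr : IsRiccati κ g r)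
    (hL : L2sq g ≤ κ) {W : ℝ} (hW : (2 * π)⁻¹ * ∫ ξ, ‖ft g ξ‖ / √(4 * κ ^ 2 + ξ ^ 2) ≤ W) :
    |(∫ ξ, ξ ^ 2 / (4 * κ ^ 2 + ξ ^ 2) * ‖ft g ξ‖ ^ 2)
      - (2 * π * L2sq g + 4 * π * κ * (∫ x, g x * r x).re)| ≤ 4 * π * L2sq g * W ^ 2 := by
  set w := 𝓕 (linSymbol κ g) with hw
  have hwd := hasDerivAt_fourier_linSymbol hκ g
  rw [← hw] at hwd
  have hwb : ∀ x, ‖w x‖ ≤ W := fun x => (norm_fourier_linSymbol_le κ g x).trans hW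
  have hwc : Continuous w := continuous_iff_continuousAt.2 fun x => (hwd x).continuousAt
  have hrc := hr.continuous
  have hgc := g.continuous
  have hW0 : 0 ≤ W := (norm_nonneg _).trans (hwb 0)
  obtain ⟨F, hF⟩ : ∃ F, ∀ x, ‖g x‖ ≤ F := ⟨_, fun x => g.norm_le_seminorm ℝ x⟩
  set h : ℝ → ℂ := fun x => -(1 / 2 * g x * r x ^ 2) with hh
  have hhc : Continuous h := by fun_prop
  have hhn : ∀ x, ‖h x‖ = 1 / 2 * ‖r x‖ ^ 2 * ‖g x‖ := fun x => by
    simp only [hh]; simp; ring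
  have zd : ∀ x, HasDerivAt (fun x => r x + w x) (h x - 2 * κ * (r x + w x)) x := by
    intro x
    convert! (hr.hasDerivAt x).add (hwd x) using 1
    simp only [hh]; ring
  have zb : ∀ x, ‖r x + w x‖ ≤ 1 + W := fun x =>
    (norm_add_le _ _).trans (add_le_add (hr.norm_le_one x) (hwb x))
  have bdd : BddAbove (range fun x => ‖r x‖) :=
    ⟨1, by rintro _ ⟨y, rfl⟩; exact hr.norm_le_one y⟩
  set S := ⨆ x, ‖r x‖ with hS
  have hS0 : ∀ x, ‖r x‖ ≤ S := fun x => le_ciSup bdd x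
  have hSn : 0 ≤ S := (norm_nonneg _).trans (hS0 0)
  have hS1 : S ≤ 1 := ciSup_le hr.norm_le_one
  have hhS : ∀ x, ‖h x‖ ≤ 1 / 2 * S ^ 2 * ‖g x‖ := fun x => by
    rw [hhn]; gcongr; exact hS0 x
  have hS2 : S ≤ 2 * W := by
    have h1 : ∀ x, ‖r x‖ ≤ W + 1 / 2 * S ^ 2 * (1 / 2) := by
      intro x
      have h2 := norm_le_of_damped (b := 1 / 2 * S ^ 2) (δ := 1 / 2) (N := 0) hκ (by positivity)
        (by norm_num) (integrable_norm_sq g) (by linarith) hF hhc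
        (fun x => by simpa using hhS x) zb zd x
      have h3 : ‖r x‖ ≤ ‖r x + w x‖ + ‖w x‖ := by
        simpa using norm_sub_le (r x + w x) (w x)
      simp only [zero_div, add_zero] at h2
      linarith [hwb x]
    have h4 : S ≤ W + 1 / 2 * S ^ 2 * (1 / 2) := ciSup_le h1
    nlinarith
  have ze : ∀ x, r x + w x = damp κ h x :=
    eq_damp hκ hhc (N := 1 / 2 * F) (fun x => (hhn x).trans_le (by
      have h1 := hr.norm_le_one x
      have h2 : ‖r x‖ ^ 2 ≤ 1 := pow_le_one₀ (norm_nonneg _) h1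
      calc 1 / 2 * ‖r x‖ ^ 2 * ‖g x‖ ≤ 1 / 2 * 1 * F := by gcongr; exact hF x
        _ = _ := by ring)) zb zd
  have hq := norm_integral_mul_damp_le hκ (integrable_norm_sq g) g.integrable hgc hF
    (b := 2 * W ^ 2) (by positivity) (h := h) (fun x => (hhS x).trans
      (mul_le_mul_of_nonneg_right (by nlinarith) (norm_nonneg _)))
  simp_rw [← ze] at hq
  have ir : Integrable fun x => g x * r x := by
    refine g.integrable.mul_bdd (c := 1) hrc.aestronglyMeasurable
      (ae_of_all _ hr.norm_le_one)
  have iw : Integrable fun x => g x * w x := by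
    refine g.integrable.mul_bdd (c := W) hwc.aestronglyMeasurable
      (ae_of_all _ hwb)
  simp_rw [mul_add] at hq
  rw [integral_add ir iw] at hq
  have hre := (Complex.abs_re_le_norm _).trans hq
  rw [Complex.add_re] at hre
  have e := re_integral_mul_fourier_linSymbol hκ g
  rw [← hw] at e
  set X := (∫ x, g x * r x).re
  set Y := (∫ x, g x * w x).re
  have e2 : (∫ ξ, ξ ^ 2 / (4 * κ ^ 2 + ξ ^ 2) * ‖ft g ξ‖ ^ 2)
      - (2 * π * L2sq g + 4 * π * κ * X) = -(4 * π * κ * (X + Y)) := by linarith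
  rw [e2, abs_neg, abs_mul, abs_of_pos (by positivity : 0 < 4 * π * κ)]
  calc 4 * π * κ * |X + Y| ≤ 4 * π * κ * (2 * W ^ 2 * L2sq g / (2 * κ)) := by gcongr
    _ = _ := by field_simp

end NLS

namespace NLS

open Filter Topology Set

/-- A conservation law `∂ₜ ρ = ∂ₓ j` with decaying density and flux makes `∫ ρ` constant. -/
lemma integral_eq_of_conservation {ρ ρ' j : ℝ → ℝ → ℂ}
    (hρ : ∀ x t, HasDerivAt (fun τ => ρ x τ) (ρ' x t) t)
    (hj : ∀ x t, HasDerivAt (fun y => j y t) (ρ' x t) x)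
    (hρm : ∀ t, Continuous fun x => ρ x t) (hρm' : ∀ t, Continuous fun x => ρ' x t)
    (hb : ∀ T, 0 < T → ∃ C, ∀ x t, |t| ≤ T → ‖ρ x t‖ ≤ C * (1 + x ^ 2)⁻¹ ∧
      ‖ρ' x t‖ ≤ C * (1 + x ^ 2)⁻¹ ∧ ‖j x t‖ ≤ C * (1 + x ^ 2)⁻¹) (t : ℝ) :
    ∫ x, ρ x t = ∫ x, ρ x 0 := by
  have hd : ∀ t, HasDerivAt (fun τ => ∫ x, ρ x τ) 0 t := by
    intro t
    obtain ⟨C, hC⟩ := hb (|t| + 1) (by positivity)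
    have hi : Integrable fun x : ℝ => C * (1 + x ^ 2)⁻¹ := integrable_inv_one_add_sq.const_mul C
    have ht : |t| ≤ |t| + 1 := by linarith
    have int0 : Integrable fun x => ρ x t :=
      hi.mono' (hρm t).aestronglyMeasurable (ae_of_all _ fun x => (hC x t ht).1)
    have int1 : Integrable fun x => ρ' x t :=
      hi.mono' (hρm' t).aestronglyMeasurable (ae_of_all _ fun x => (hC x t ht).2.1)
    have jc : Continuous fun x => j x t :=
      continuous_iff_continuousAt.2 fun x => (hj x t).continuousAt
    have int2 : Integrable fun x => j x t :=
      hi.mono' jc.aestronglyMeasurable (ae_of_all _ fun x => (hC x t ht).2.2)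
    have h1 := (hasDerivAt_integral_of_dominated_loc_of_deriv_le (μ := volume)
      (F := fun τ x => ρ x τ) (F' := fun τ x => ρ' x τ) (x₀ := t)
      (s := Metric.ball t 1) (bound := fun x => C * (1 + x ^ 2)⁻¹)
      (Metric.ball_mem_nhds t one_pos)
      (Eventually.of_forall fun τ => (hρm τ).aestronglyMeasurable) int0
      (hρm' t).aestronglyMeasurable
      (ae_of_all _ fun x τ hτ => (hC x τ (by
        rw [Metric.mem_ball, Real.dist_eq] at hτ
        have := abs_sub_abs_le_abs_sub τ t
        linarith)).2.1) hi
      (ae_of_all _ fun x τ _ => hρ x τ)).2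
    rwa [integral_eq_zero_of_hasDerivAt_of_integrable (fun x => hj x t) int1 int2] at h1
  exact is_const_of_deriv_eq_zero (fun t => (hd t).differentiableAt) (fun t => (hd t).deriv) t 0

variable {u : ℝ → ℝ → ℂ}

lemma contDiff_slice (h : IsSchwartzSolution u) (t : ℝ) :
    ContDiff ℝ (⊤ : ℕ∞) fun y => u y t :=
  h.smooth.comp (contDiff_id.prodMk contDiff_const)

/-- The time slice of a Schwartz solution as a Schwartz map. -/
def slice (h : IsSchwartzSolution u) (t : ℝ) : SchwartzMap ℝ ℂ where
  toFun x := u x t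
  smooth' := contDiff_slice h t
  decay' k n := by
    obtain ⟨C, hC⟩ := h.decay k n (|t| + 1) (by positivity)
    refine ⟨C, fun x => ?_⟩
    rw [norm_iteratedFDeriv_eq_norm_iteratedDeriv]
    exact hC x t (by linarith)

lemma coe_slice (h : IsSchwartzSolution u) (t : ℝ) : ⇑(slice h t) = fun x => u x t := rfl

lemma hasDerivAt_iteratedDeriv_slice (h : IsSchwartzSolution u) (n : ℕ) (x t : ℝ) :
    HasDerivAt (iteratedDeriv n fun y => u y t) (iteratedDeriv (n + 1) (fun y => u y t) x) x := by
  rw [iteratedDeriv_succ]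
  exact ((contDiff_slice h t).differentiable_iteratedDeriv n
    (by exact_mod_cast WithTop.coe_lt_top n) x).hasDerivAt

lemma hasDerivAt_slice (h : IsSchwartzSolution u) (x t : ℝ) :
    HasDerivAt (fun y => u y t) (iteratedDeriv 1 (fun y => u y t) x) x := by
  simpa using hasDerivAt_iteratedDeriv_slice h 0 x t

lemma hasDerivAt_time (h : IsSchwartzSolution u) (x t : ℝ) :
    HasDerivAt (fun τ => u x τ) (deriv (fun τ => u x τ) t) t := by
  have h1 : ContDiff ℝ (⊤ : ℕ∞) fun τ => u x τ := h.smooth.comp (contDiff_const.prodMk contDiff_id)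
  exact (h1.differentiable (by simp) t).hasDerivAt

lemma continuous_time_deriv (h : IsSchwartzSolution u) :
    Continuous fun p : ℝ × ℝ => deriv (fun τ => u p.1 τ) p.2 := by
  have h1 : (fun p : ℝ × ℝ => deriv (fun τ => u p.1 τ) p.2)
      = fun p : ℝ × ℝ => fderiv ℝ (fun p : ℝ × ℝ => u p.1 p.2) p (0, 1) := by
    ext ⟨x, t⟩
    have h2 := (h.smooth.differentiable (by simp) (x, t)).hasFDerivAt
    have h3 : HasDerivAt (fun τ : ℝ => (x, τ)) ((0 : ℝ), (1 : ℝ)) t :=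
      (hasDerivAt_const t x).prodMk (hasDerivAt_id t)
    exact (h2.comp_hasDerivAt t h3).deriv
  rw [h1]
  exact (h.smooth.continuous_fderiv (by simp)).clm_apply continuous_const

lemma time_deriv_eq (h : IsSchwartzSolution u) (x t : ℝ) :
    deriv (fun τ => u x τ) t = Complex.I *
      (iteratedDeriv 2 (fun y => u y t) x + (u x t * (starRingEnd ℂ) (u x t)) * u x t) := by
  have h1 := h.eqn x t
  rw [Complex.mul_conj, Complex.normSq_eq_norm_sq]
  push_cast
  linear_combination (-Complex.I) * h1 + (deriv (fun τ => u x τ) t) * Complex.I_mul_I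

lemma exists_decay (h : IsSchwartzSolution u) {T : ℝ} (hT : 0 < T) : ∃ C, 0 < C ∧
    ∀ x t, |t| ≤ T → ‖u x t‖ ≤ C * (1 + x ^ 2)⁻¹ ∧ ‖u x t‖ ≤ C ∧
      ‖iteratedDeriv 1 (fun y => u y t) x‖ ≤ C * (1 + x ^ 2)⁻¹ ∧
      ‖iteratedDeriv 1 (fun y => u y t) x‖ ≤ C ∧
      ‖deriv (fun τ => u x τ) t‖ ≤ C * (1 + x ^ 2)⁻¹ ∧ ‖deriv (fun τ => u x τ) t‖ ≤ C := by
  have key : ∀ n, ∃ C, 0 < C ∧ ∀ x t, |t| ≤ T →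
      ‖iteratedDeriv n (fun y => u y t) x‖ ≤ C * (1 + x ^ 2)⁻¹ := by
    intro n
    obtain ⟨C0, h0⟩ := h.decay 0 n T hT
    obtain ⟨C2, h2⟩ := h.decay 2 n T hT
    refine ⟨|C0| + |C2| + 1, by positivity, fun x t ht => ?_⟩
    rw [← div_eq_mul_inv, le_div_iff₀ (by positivity)]
    have e0 := h0 x t ht
    have e2 := h2 x t ht
    rw [sq_abs] at e2
    nlinarith [le_abs_self C0, le_abs_self C2]
  have hq : ∀ x : ℝ, (1 + x ^ 2)⁻¹ ≤ 1 := fun x => inv_le_one_of_one_le₀ (by nlinarith)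
  obtain ⟨C0, p0, h0⟩ := key 0
  obtain ⟨C1, p1, h1⟩ := key 1
  obtain ⟨C2, p2, h2⟩ := key 2
  simp only [iteratedDeriv_zero] at h0
  have h0' : ∀ x t, |t| ≤ T → ‖u x t‖ ≤ C0 := fun x t ht =>
    (h0 x t ht).trans (mul_le_of_le_one_right p0.le (hq x))
  have h3 : ∀ x t, |t| ≤ T → ‖deriv (fun τ => u x τ) t‖ ≤ (C2 + C0 ^ 3) * (1 + x ^ 2)⁻¹ := by
    intro x t ht
    rw [time_deriv_eq h, norm_mul, Complex.norm_I, one_mul]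
    refine (norm_add_le _ _).trans ?_
    rw [add_mul]
    refine add_le_add (h2 x t ht) ?_
    rw [norm_mul, norm_mul, RCLike.norm_conj]
    calc _ ≤ C0 * C0 * (C0 * (1 + x ^ 2)⁻¹) := by
          gcongr
          exacts [h0' x t ht, h0' x t ht, h0 x t ht]
      _ = _ := by ring
  have up : ∀ {a c : ℝ} (x : ℝ), a ≤ c * (1 + x ^ 2)⁻¹ → 0 < c → c ≤ C0 + C1 + C2 + C0 ^ 3 →
      a ≤ (C0 + C1 + C2 + C0 ^ 3) * (1 + x ^ 2)⁻¹ ∧ a ≤ C0 + C1 + C2 + C0 ^ 3 := by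
    intro a c x ha hc hle
    have h5 : a ≤ (C0 + C1 + C2 + C0 ^ 3) * (1 + x ^ 2)⁻¹ := ha.trans (by gcongr)
    exact ⟨h5, h5.trans (mul_le_of_le_one_right (hc.le.trans hle) (hq x))⟩
  have p3 : 0 < C0 ^ 3 := by positivity
  refine ⟨C0 + C1 + C2 + C0 ^ 3, by positivity, fun x t ht => ?_⟩
  obtain ⟨a1, a2⟩ := up x (h0 x t ht) p0 (by linarith)
  obtain ⟨b1, b2⟩ := up x (h1 x t ht) p1 (by linarith)
  obtain ⟨c1, c2⟩ := up x (h3 x t ht) (by positivity) (by linarith)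
  exact ⟨a1, a2, b1, b2, c1, c2⟩

/-- Time differentiability of a Schwartz solution, uniformly in space. -/
lemma uniform_time_differentiable (h : IsSchwartzSolution u) (t : ℝ) {ε : ℝ} (hε : 0 < ε) :
    ∃ δ > 0, ∀ τ, |τ - t| < δ → ∀ x,
      ‖u x τ - u x t - ((τ - t : ℝ) : ℂ) * deriv (fun τ => u x τ) t‖ ≤ ε * |τ - t| := by
  have hc := continuous_time_deriv h
  obtain ⟨C, hC0, hC⟩ := exists_decay h (T := |t| + 1) (by positivity)
  obtain ⟨R, hR0, hR⟩ : ∃ R : ℝ, 0 < R ∧ ∀ x, R ≤ |x| → C * (1 + x ^ 2)⁻¹ ≤ ε / 2 := by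
    refine ⟨max 1 (2 * C / ε), by positivity, fun x hx => ?_⟩
    have h1 : 1 ≤ |x| := (le_max_left _ _).trans hx
    have h2 : 2 * C / ε ≤ |x| := (le_max_right _ _).trans hx
    rw [← div_eq_mul_inv, div_le_iff₀ (by positivity)]
    rw [div_le_iff₀ hε] at h2
    have h3 : |x| ≤ x ^ 2 := by rw [← sq_abs]; nlinarith
    nlinarith
  have huc := (isCompact_Icc (a := -R) (b := R)).prod (isCompact_Icc (a := t - 1) (b := t + 1))
    |>.uniformContinuousOn_of_continuous hc.continuousOn
  rw [Metric.uniformContinuousOn_iff] at huc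
  obtain ⟨δ, hδ, hδ'⟩ := huc ε hε
  have hd : ∀ τ, |τ - t| < min δ 1 → ∀ x,
      ‖deriv (fun τ => u x τ) τ - deriv (fun τ => u x τ) t‖ ≤ ε := by
    intro τ hτ x
    have hτ1 : |τ - t| < 1 := hτ.trans_le (min_le_right _ _)
    have hτδ : |τ - t| < δ := hτ.trans_le (min_le_left _ _)
    rcases le_total R |x| with hx | hx
    · have e1 := (hC x τ (by linarith [abs_sub_abs_le_abs_sub τ t])).2.2.2.2.1
      have e2 := (hC x t (by linarith)).2.2.2.2.1
      have := norm_sub_le (deriv (fun τ => u x τ) τ) (deriv (fun τ => u x τ) t)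
      linarith [hR x hx]
    · have hx' := abs_le.1 hx
      have hτ' := abs_lt.1 hτ1
      have := hδ' (x, τ) ⟨hx', by constructor <;> simp only <;> linarith⟩ (x, t)
        ⟨hx', by constructor <;> simp only <;> linarith⟩ (by
          simpa [Prod.dist_eq, Real.dist_eq, hδ] using hτδ)
      rw [dist_eq_norm] at this
      exact this.le
  refine ⟨min δ 1, by positivity, fun τ hτ x => ?_⟩
  have hmv := (convex_ball t (min δ 1)).norm_image_sub_le_of_norm_hasDerivWithin_le
    (f := fun τ => u x τ - (τ : ℂ) * deriv (fun τ => u x τ) t)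
    (f' := fun τ => deriv (fun τ => u x τ) τ - deriv (fun τ => u x τ) t) (C := ε)
    (x := t) (y := τ)
    (fun z _ => by
      have h1 := (hasDerivAt_time h x z).sub
        ((hasDerivAt_id z).ofReal_comp.mul_const (deriv (fun τ => u x τ) t))
      simp only [id_eq, Complex.ofReal_one, one_mul] at h1
      exact h1.hasDerivWithinAt)
    (fun z hz => hd z (by simpa [Real.dist_eq] using hz) x)
    (Metric.mem_ball_self (by positivity)) (by simpa [Real.dist_eq] using hτ)
  rw [Real.norm_eq_abs] at hmv
  refine (le_of_eq ?_).trans hmv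
  congr 1
  push_cast
  ring

lemma norm_sub_time_le (h : IsSchwartzSolution u) {C T : ℝ}
    (hC : ∀ x t, |t| ≤ T → ‖deriv (fun τ => u x τ) t‖ ≤ C) {t τ : ℝ} (ht : |t| ≤ T)
    (hτ : |τ| ≤ T) (x : ℝ) : ‖u x τ - u x t‖ ≤ C * |τ - t| := by
  have := (convex_Icc (-T) T).norm_image_sub_le_of_norm_hasDerivWithin_le
    (f := fun τ => u x τ) (x := t) (y := τ)
    (fun z _ => (hasDerivAt_time h x z).hasDerivWithinAt)
    (fun z hz => hC x z (abs_le.2 hz)) (abs_le.1 ht) (abs_le.1 hτ)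
  rwa [Real.norm_eq_abs] at this

lemma hasDerivAt_conj {f : ℝ → ℂ} {f' : ℂ} {x : ℝ} (hf : HasDerivAt f f' x) :
    HasDerivAt (fun y => (starRingEnd ℂ) (f y)) ((starRingEnd ℂ) f') x := by
  simpa using hf.star

lemma continuous_iteratedDeriv_slice (h : IsSchwartzSolution u) (n : ℕ) (t : ℝ) :
    Continuous fun x => iteratedDeriv n (fun y => u y t) x :=
  continuous_iff_continuousAt.2 fun x => (hasDerivAt_iteratedDeriv_slice h n x t).continuousAt

lemma continuous_time_deriv_slice (h : IsSchwartzSolution u) (t : ℝ) :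
    Continuous fun x => deriv (fun τ => u x τ) t :=
  (continuous_time_deriv h).comp (continuous_id.prodMk continuous_const)

/-- Conservation of mass. -/
lemma L2sq_eq (h : IsSchwartzSolution u) (t : ℝ) :
    L2sq (fun x => u x t) = L2sq fun x => u x 0 := by
  have key := integral_eq_of_conservation
    (ρ := fun x t => u x t * (starRingEnd ℂ) (u x t))
    (ρ' := fun x t => deriv (fun τ => u x τ) t * (starRingEnd ℂ) (u x t)
      + u x t * (starRingEnd ℂ) (deriv (fun τ => u x τ) t))
    (j := fun x t => Complex.I * (iteratedDeriv 1 (fun y => u y t) x * (starRingEnd ℂ) (u x t)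
      - u x t * (starRingEnd ℂ) (iteratedDeriv 1 (fun y => u y t) x)))
    (fun x t => (hasDerivAt_time h x t).mul (hasDerivAt_conj (hasDerivAt_time h x t)))
    (fun x t => by
      have h0 := hasDerivAt_slice h x t
      have h1 := hasDerivAt_iteratedDeriv_slice h 1 x t
      have h2 := ((h1.mul (hasDerivAt_conj h0)).sub (h0.mul (hasDerivAt_conj h1))).const_mul
        Complex.I
      convert! h2 using 1
      rw [time_deriv_eq h]
      simp only [map_mul, map_add, Complex.conj_I, Complex.conj_conj]
      ring)
    (fun t => by
      have := continuous_iteratedDeriv_slice h 0 t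
      simp only [iteratedDeriv_zero] at this
      fun_prop)
    (fun t => by
      have := continuous_iteratedDeriv_slice h 0 t
      have := continuous_time_deriv_slice h t
      simp only [iteratedDeriv_zero] at *
      fun_prop)
    (fun T hT => by
      obtain ⟨C, hC0, hC⟩ := exists_decay h hT
      refine ⟨2 * C ^ 2, fun x t ht => ?_⟩
      obtain ⟨a1, a2, b1, b2, c1, c2⟩ := hC x t ht
      refine ⟨?_, ?_, ?_⟩
      · rw [norm_mul, RCLike.norm_conj]
        calc _ ≤ C * (C * (1 + x ^ 2)⁻¹) := by gcongr
          _ ≤ _ := by have : 0 ≤ C ^ 2 * (1 + x ^ 2)⁻¹ := by positivity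
                      linarith
      · refine (norm_add_le _ _).trans ?_
        simp only [norm_mul, RCLike.norm_conj]
        calc _ ≤ C * (C * (1 + x ^ 2)⁻¹) + C * (C * (1 + x ^ 2)⁻¹) := by gcongr
          _ = _ := by ring
      · rw [norm_mul, Complex.norm_I, one_mul]
        refine (norm_sub_le _ _).trans ?_
        simp only [norm_mul, RCLike.norm_conj]
        calc _ ≤ C * (C * (1 + x ^ 2)⁻¹) + C * (C * (1 + x ^ 2)⁻¹) := by gcongr
          _ = _ := by ring) t
  have e : ∀ t, ∫ x, u x t * (starRingEnd ℂ) (u x t) = (L2sq (fun x => u x t) : ℂ) := by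
    intro t
    rw [L2sq, ← integral_complex_ofReal]
    congr 1; ext x
    rw [Complex.mul_conj, Complex.normSq_eq_norm_sq]
  rw [e, e] at key
  exact_mod_cast key

end NLS

namespace NLS

open Filter Topology Set

variable {u : ℝ → ℝ → ℂ} {κ : ℝ} {r : ℝ → ℝ → ℂ}

/-- The time derivative of the solution of the Riccati equation along the flow. -/
def riccatiFlow (κ : ℝ) (u : ℝ → ℝ → ℂ) (r : ℝ → ℝ → ℂ) (x t : ℝ) : ℂ :=
  Complex.I * (starRingEnd ℂ) (iteratedDeriv 1 (fun y => u y t) x)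
    - 2 * Complex.I * κ * (starRingEnd ℂ) (u x t)
    - (4 * Complex.I * κ ^ 2 + Complex.I * (u x t * (starRingEnd ℂ) (u x t))) * r t x
    - 1 / 2 * (Complex.I * iteratedDeriv 1 (fun y => u y t) x + 2 * Complex.I * κ * u x t)
      * r t x ^ 2

lemma hasDerivAt_riccatiFlow (h : IsSchwartzSolution u)
    (hr : ∀ t, IsRiccati κ (fun x => u x t) (r t)) (x t : ℝ) :
    HasDerivAt (fun y => riccatiFlow κ u r y t)
      (-(starRingEnd ℂ) (deriv (fun τ => u x τ) t) - 2 * κ * riccatiFlow κ u r x t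
        - 1 / 2 * deriv (fun τ => u x τ) t * r t x ^ 2 - u x t * r t x * riccatiFlow κ u r x t)
      x := by
  have h0 := hasDerivAt_slice h x t
  have h1 := hasDerivAt_iteratedDeriv_slice h 1 x t
  have hR := (hr t).hasDerivAt x
  have key := ((((hasDerivAt_conj h1).const_mul Complex.I).sub
    ((hasDerivAt_conj h0).const_mul (2 * Complex.I * κ))).sub
    ((((h0.mul (hasDerivAt_conj h0)).const_mul Complex.I).const_add
      (4 * Complex.I * κ ^ 2)).mul hR)).sub
    ((((h1.const_mul Complex.I).add (h0.const_mul (2 * Complex.I * κ))).const_mul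
      (1 / 2)).mul (hR.pow 2))
  convert! key using 1
  rw [time_deriv_eq h]
  simp only [riccatiFlow, map_mul, map_add, Complex.conj_I, Complex.conj_conj, Pi.mul_apply,
    Pi.pow_apply, Pi.add_apply]
  push_cast
  generalize (starRingEnd ℂ) (u x t) = ub
  generalize (starRingEnd ℂ) (iteratedDeriv 1 (fun y => u y t) x) = uxb
  generalize (starRingEnd ℂ) (iteratedDeriv 2 (fun y => u y t) x) = uxxb
  ring

lemma hasDerivAt_riccati_flux (h : IsSchwartzSolution u)
    (hr : ∀ t, IsRiccati κ (fun x => u x t) (r t)) (x t : ℝ) :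
    HasDerivAt (fun y => Complex.I * (u y t * (starRingEnd ℂ) (u y t))
        + (Complex.I * iteratedDeriv 1 (fun y => u y t) y + 2 * Complex.I * κ * u y t) * r t y)
      (deriv (fun τ => u x τ) t * r t x + u x t * riccatiFlow κ u r x t) x := by
  have h0 := hasDerivAt_slice h x t
  have h1 := hasDerivAt_iteratedDeriv_slice h 1 x t
  have hR := (hr t).hasDerivAt x
  have key := ((h0.mul (hasDerivAt_conj h0)).const_mul Complex.I).add
    (((h1.const_mul Complex.I).add (h0.const_mul (2 * Complex.I * κ))).mul hR)
  convert! key using 1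
  rw [time_deriv_eq h]
  simp only [riccatiFlow, Pi.add_apply]
  ring

lemma continuous_riccatiFlow (h : IsSchwartzSolution u)
    (hr : ∀ t, IsRiccati κ (fun x => u x t) (r t)) (t : ℝ) :
    Continuous fun x => riccatiFlow κ u r x t :=
  continuous_iff_continuousAt.2 fun x => (hasDerivAt_riccatiFlow h hr x t).continuousAt

lemma norm_riccatiFlow_le (hκ : 0 < κ) (hr : ∀ t, IsRiccati κ (fun x => u x t) (r t))
    {C x t : ℝ} (h0 : ‖u x t‖ ≤ C) (h1 : ‖iteratedDeriv 1 (fun y => u y t) x‖ ≤ C) :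
    ‖riccatiFlow κ u r x t‖ ≤ 2 * C + 3 * κ * C + 4 * κ ^ 2 + C ^ 2 := by
  have hr1 := (hr t).norm_le_one x
  have hC : 0 ≤ C := (norm_nonneg _).trans h0
  have t1 : ‖Complex.I * (starRingEnd ℂ) (iteratedDeriv 1 (fun y => u y t) x)‖ ≤ C := by
    simpa using h1
  have t2 : ‖2 * Complex.I * κ * (starRingEnd ℂ) (u x t)‖ ≤ 2 * κ * C := by
    simp only [norm_mul, Complex.norm_I, RCLike.norm_conj, Complex.norm_real, Complex.norm_ofNat,
      Real.norm_eq_abs, abs_of_pos hκ, mul_one]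
    gcongr
  have t3 : ‖(4 * Complex.I * κ ^ 2 + Complex.I * (u x t * (starRingEnd ℂ) (u x t))) * r t x‖
      ≤ (4 * κ ^ 2 + C * C) * 1 := by
    rw [norm_mul]
    gcongr
    refine (norm_add_le _ _).trans ?_
    simp only [norm_mul, norm_pow, Complex.norm_I, RCLike.norm_conj, Complex.norm_real,
      Complex.norm_ofNat, Real.norm_eq_abs, abs_of_pos hκ, mul_one, one_mul]
    gcongr
  have t4 : ‖1 / 2 * (Complex.I * iteratedDeriv 1 (fun y => u y t) x + 2 * Complex.I * κ * u x t)
      * r t x ^ 2‖ ≤ 1 / 2 * (C + 2 * κ * C) * 1 := by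
    rw [norm_mul, norm_mul, norm_pow]
    have : ‖r t x‖ ^ 2 ≤ 1 := pow_le_one₀ (norm_nonneg _) hr1
    have e : ‖(1 / 2 : ℂ)‖ = 1 / 2 := by simp
    rw [e]
    gcongr
    refine (norm_add_le _ _).trans ?_
    simp only [norm_mul, Complex.norm_I, Complex.norm_real, Complex.norm_ofNat,
      Real.norm_eq_abs, abs_of_pos hκ, mul_one, one_mul]
    gcongr
  have hle : ‖riccatiFlow κ u r x t‖ ≤ C + 2 * κ * C + (4 * κ ^ 2 + C * C) * 1
      + 1 / 2 * (C + 2 * κ * C) * 1 := by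
    unfold riccatiFlow
    refine (norm_sub_le _ _).trans (add_le_add ((norm_sub_le _ _).trans (add_le_add
      ((norm_sub_le _ _).trans (add_le_add t1 t2)) t3)) t4)
  nlinarith

lemma norm_riccati_sub_le (hκ : 0 < κ) (h : IsSchwartzSolution u)
    (hL : L2sq (fun x => u x 0) ≤ κ)
    (hr : ∀ t, IsRiccati κ (fun x => u x t) (r t)) {C T : ℝ}
    (hC : ∀ x t, |t| ≤ T → ‖u x t‖ ≤ C ∧ ‖deriv (fun τ => u x τ) t‖ ≤ C) {t τ : ℝ} (ht : |t| ≤ T)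
    (hτ : |τ| ≤ T) (x : ℝ) : ‖r τ x - r t x‖ ≤ 3 / 2 * C * |τ - t| / κ := by
  have hc : ∀ t, Continuous fun x => u x t := fun t => (slice h t).continuous
  have hrc : ∀ t, Continuous (r t) := fun t => (hr t).continuous
  have h1 : ∀ x, ‖r τ x‖ ≤ 1 := (hr τ).norm_le_one
  have h2 : ∀ x, ‖r t x‖ ≤ 1 := (hr t).norm_le_one
  have hU := norm_sub_time_le h (fun x t ht => (hC x t ht).2) ht hτ
  refine norm_le_of_perturbed (V := 2) (F := C) hκ (f := fun x => u x t)
    (h := fun x => -((starRingEnd ℂ) (u x τ) - (starRingEnd ℂ) (u x t))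
      - 1 / 2 * (u x τ - u x t) * r τ x ^ 2)
    (c := fun x => -(1 / 2) * u x t * (r τ x + r t x))
    (v := fun x => r τ x - r t x)
    (integrable_norm_sq (slice h t)) ((L2sq_eq h t).trans_le hL) (fun x => (hC x t ht).1)
    ?_ ?_ ?_ ?_ ?_ ?_ x
  · have := hc τ; have := hc t; have := hrc τ; have := hrc t
    fun_prop
  · have := hc t; have := hrc τ; have := hrc t
    fun_prop
  · intro x
    refine (norm_sub_le _ _).trans ?_
    rw [← map_sub, norm_neg, RCLike.norm_conj, norm_mul, norm_mul, norm_pow]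
    have e : ‖(1 / 2 : ℂ)‖ = 1 / 2 := by simp
    have : ‖r τ x‖ ^ 2 ≤ 1 := pow_le_one₀ (norm_nonneg _) (h1 x)
    have h3 := hU x
    rw [e]
    calc _ ≤ C * |τ - t| + 1 / 2 * (C * |τ - t|) * 1 := by gcongr; exact mul_nonneg (by norm_num) ((norm_nonneg _).trans h3)
      _ = _ := by ring
  · intro x
    have h3 : ‖r τ x + r t x‖ ≤ 2 := (norm_add_le _ _).trans (by linarith [h1 x, h2 x])
    have e : ‖(-(1 / 2) : ℂ)‖ = 1 / 2 := by simp
    rw [norm_mul, norm_mul, e]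
    nlinarith [norm_nonneg (u x t)]
  · intro x
    exact (norm_sub_le _ _).trans (by linarith [h1 x, h2 x])
  · intro x
    convert! ((hr τ).hasDerivAt x).sub ((hr t).hasDerivAt x) using 1
    ring

lemma hasDerivAt_riccati_time (hκ : 0 < κ) (h : IsSchwartzSolution u)
    (hL : L2sq (fun x => u x 0) ≤ κ)
    (hr : ∀ t, IsRiccati κ (fun x => u x t) (r t)) (x t : ℝ) :
    HasDerivAt (fun τ => r τ x) (riccatiFlow κ u r x t) t := by
  obtain ⟨C, hC0, hC⟩ := exists_decay h (T := |t| + 1) (by positivity)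
  have hT : |t| ≤ |t| + 1 := by linarith
  set G := 2 * C + 3 * κ * C + 4 * κ ^ 2 + C ^ 2 with hG
  have hG0 : 0 < G := by positivity
  have hg : ∀ x, ‖riccatiFlow κ u r x t‖ ≤ G := fun x =>
    norm_riccatiFlow_le hκ hr (hC x t hT).2.1 (hC x t hT).2.2.2.1
  set K := 3 / 2 * C / κ with hK
  have hK0 : 0 < K := by positivity
  have hcu : ∀ t, Continuous fun x => u x t := fun t => (slice h t).continuous
  have hct := continuous_time_deriv_slice h t
  have hrc : ∀ t, Continuous (r t) := fun t => (hr t).continuous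
  have hgc := continuous_riccatiFlow h hr t
  rw [hasDerivAt_iff_isLittleO, Asymptotics.isLittleO_iff]
  intro ε hε
  obtain ⟨δ, hδ0, hδ⟩ := uniform_time_differentiable h t (ε := κ * ε / 3) (by positivity)
  have hδ2 : 0 < κ * ε / (2 * (C * K + C * K * G)) := by positivity
  filter_upwards [Metric.ball_mem_nhds t (lt_min (lt_min hδ0 one_pos) hδ2)] with τ hτ
  rw [Metric.mem_ball, Real.dist_eq] at hτ
  have hτδ := hτ.trans_le ((min_le_left _ _).trans (min_le_left _ _))
  have hτ1 := hτ.trans_le ((min_le_left _ _).trans (min_le_right _ _))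
  have hτ2 := hτ.trans_le (min_le_right _ _)
  have hτT : |τ| ≤ |t| + 1 := by linarith [abs_sub_abs_le_abs_sub τ t]
  have hR : ∀ x, ‖r τ x - r t x‖ ≤ K * |τ - t| := fun x =>
    (norm_riccati_sub_le hκ h hL hr (fun x t ht => ⟨(hC x t ht).2.1, (hC x t ht).2.2.2.2.2⟩)
      hT hτT x).trans_eq (by rw [hK]; ring)
  have h1 : ∀ x, ‖r τ x‖ ≤ 1 := (hr τ).norm_le_one
  have h2 : ∀ x, ‖r t x‖ ≤ 1 := (hr t).norm_le_one
  have e2 : ‖(1 / 2 : ℂ)‖ = 1 / 2 := by simp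
  set η := |τ - t| with hη
  have hη0 : 0 ≤ η := abs_nonneg _
  have hsum : ∀ x, ‖r τ x + r t x‖ ≤ 2 := fun x =>
    (norm_add_le _ _).trans (by linarith [h1 x, h2 x])
  have key := norm_le_of_perturbed (V := 2 + η * G) (F := C)
    (N := κ * ε / 3 * η + (1 / 2 * (κ * ε / 3 * η) * 1 + 1 / 2 * η * C * (K * η) * 2)
      + 1 / 2 * η * C * (K * η) * G) hκ (f := fun x => u x t)
    (h := fun x => -(starRingEnd ℂ) (u x τ - u x t - ((τ - t : ℝ) : ℂ) * deriv (fun τ => u x τ) t)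
      - (1 / 2 * (u x τ - u x t - ((τ - t : ℝ) : ℂ) * deriv (fun τ => u x τ) t) * r τ x ^ 2
        + 1 / 2 * ((τ - t : ℝ) : ℂ) * deriv (fun τ => u x τ) t * (r τ x - r t x)
          * (r τ x + r t x))
      - 1 / 2 * ((τ - t : ℝ) : ℂ) * u x t * (r τ x - r t x) * riccatiFlow κ u r x t)
    (c := fun x => -(1 / 2) * u x t * (r τ x + r t x))
    (v := fun x => r τ x - r t x - ((τ - t : ℝ) : ℂ) * riccatiFlow κ u r x t)
    (integrable_norm_sq (slice h t)) ((L2sq_eq h t).trans_le hL) (fun x => (hC x t hT).2.1)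
    (by have := hcu τ; have := hcu t; have := hrc τ; have := hrc t
        fun_prop)
    (by have := hcu t; have := hrc τ; have := hrc t
        fun_prop)
    (fun x => by
      have a1 := hδ τ hτδ x
      have a2 : ‖r τ x‖ ^ 2 ≤ 1 := pow_le_one₀ (norm_nonneg _) (h1 x)
      have a3 := hR x
      have a4 := (hC x t hT).2.2.2.2.2
      have a5 := (hC x t hT).2.1
      have a6 := hg x
      have a7 := hsum x
      refine (norm_sub_le _ _).trans (add_le_add ((norm_sub_le _ _).trans (add_le_add ?_
        ((norm_add_le _ _).trans (add_le_add ?_ ?_)))) ?_)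
      · rwa [norm_neg, RCLike.norm_conj]
      · rw [norm_mul, norm_mul, norm_pow, e2]; gcongr
      · simp only [norm_mul, e2, Complex.norm_real, Real.norm_eq_abs]
        rw [← hη]; gcongr
      · simp only [norm_mul, e2, Complex.norm_real, Real.norm_eq_abs]
        rw [← hη]; gcongr)
    (fun x => by
      have h3 := hsum x
      have e : ‖(-(1 / 2) : ℂ)‖ = 1 / 2 := by simp
      rw [norm_mul, norm_mul, e]
      nlinarith [norm_nonneg (u x t)])
    (fun x => by
      refine (norm_sub_le _ _).trans (add_le_add ((norm_sub_le _ _).trans ?_) ?_)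
      · linarith [h1 x, h2 x]
      · rw [norm_mul, Complex.norm_real, Real.norm_eq_abs, ← hη]
        gcongr
        exact hg x)
    (fun x => by
      convert! (((hr τ).hasDerivAt x).sub ((hr t).hasDerivAt x)).sub
        ((hasDerivAt_riccatiFlow h hr x t).const_mul ((τ - t : ℝ) : ℂ)) using 1
      simp only [map_sub, map_mul, Complex.conj_ofReal]
      ring) x
  rw [Complex.real_smul, Real.norm_eq_abs, ← hη]
  refine key.trans ?_
  rw [div_le_iff₀ hκ]
  rw [lt_div_iff₀ (by positivity)] at hτ2
  have q1 := mul_le_mul_of_nonneg_left hτ2.le hη0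
  have q2 : 0 ≤ C * K * G * η ^ 2 := by positivity
  nlinarith

/-- The integral `∫ u r` is conserved. -/
lemma integral_mul_riccati_eq (hκ : 0 < κ) (h : IsSchwartzSolution u)
    (hL : L2sq (fun x => u x 0) ≤ κ)
    (hr : ∀ t, IsRiccati κ (fun x => u x t) (r t)) (t : ℝ) :
    ∫ x, u x t * r t x = ∫ x, u x 0 * r 0 x := by
  have hcu : ∀ t, Continuous fun x => u x t := fun t => (slice h t).continuous
  have hrc : ∀ t, Continuous (r t) := fun t => (hr t).continuous
  refine integral_eq_of_conservation (ρ := fun x t => u x t * r t x)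
    (fun x t => (hasDerivAt_time h x t).mul (hasDerivAt_riccati_time hκ h hL hr x t))
    (hasDerivAt_riccati_flux h hr) (fun t => (hcu t).mul (hrc t))
    (fun t => ((continuous_time_deriv_slice h t).mul (hrc t)).add
      ((hcu t).mul (continuous_riccatiFlow h hr t))) (fun T hT => ?_) t
  obtain ⟨C, hC0, hC⟩ := exists_decay h hT
  set G := 2 * C + 3 * κ * C + 4 * κ ^ 2 + C ^ 2 with hG
  have hG0 : 0 < G := by positivity
  refine ⟨C * (1 + G + C + 2 * κ), fun x t ht => ?_⟩
  obtain ⟨a1, a2, b1, b2, c1, c2⟩ := hC x t ht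
  have hr1 := (hr t).norm_le_one x
  have hg := norm_riccatiFlow_le hκ hr a2 b2
  have hq : 0 ≤ (1 + x ^ 2)⁻¹ := by positivity
  have up : ∀ {a b : ℝ}, a ≤ C * (1 + x ^ 2)⁻¹ * b → b ≤ 1 + G + C + 2 * κ →
      a ≤ C * (1 + G + C + 2 * κ) * (1 + x ^ 2)⁻¹ := fun {a b} ha hb => by
    refine ha.trans ?_
    calc _ ≤ C * (1 + x ^ 2)⁻¹ * (1 + G + C + 2 * κ) := by gcongr
      _ = _ := by ring
  refine ⟨up (b := 1) ?_ (by linarith), up (b := 1 + G) ?_ (by linarith),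
    up (b := C + (1 + 2 * κ)) ?_ (by linarith)⟩
  · rw [norm_mul]; gcongr
  · refine (norm_add_le _ _).trans ?_
    rw [norm_mul, norm_mul, mul_add]
    gcongr
  · refine (norm_add_le _ _).trans ?_
    rw [mul_add]
    refine add_le_add ?_ ?_
    · simp only [norm_mul, Complex.norm_I, RCLike.norm_conj, one_mul]
      gcongr
    · rw [norm_mul]
      have : ‖Complex.I * iteratedDeriv 1 (fun y => u y t) x + 2 * Complex.I * κ * u x t‖
          ≤ C * (1 + x ^ 2)⁻¹ + 2 * κ * (C * (1 + x ^ 2)⁻¹) := by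
        refine (norm_add_le _ _).trans ?_
        simp only [norm_mul, Complex.norm_I, Complex.norm_real, Complex.norm_ofNat,
          Real.norm_eq_abs, abs_of_pos hκ, mul_one, one_mul]
        gcongr
      calc _ ≤ (C * (1 + x ^ 2)⁻¹ + 2 * κ * (C * (1 + x ^ 2)⁻¹)) * 1 := by gcongr
        _ = _ := by ring

end NLS

namespace NLS

open Filter Topology Set
open scoped ENNReal

variable {s κ₀ : ℝ}

/-- The average over spectral parameters of the high-frequency weights. -/
def avgWeight (s κ₀ ξ : ℝ) : ℝ≥0∞ :=
  ∫⁻ κ in Ioi κ₀, ENNReal.ofReal (κ ^ (2 * s - 1) * (ξ ^ 2 / (4 * κ ^ 2 + ξ ^ 2)))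

lemma lintegral_avgWeight_mul (hκ₀ : 0 < κ₀) {H : ℝ → ℝ} (hH : Measurable H) :
    ∫⁻ κ in Ioi κ₀, ENNReal.ofReal (κ ^ (2 * s - 1))
        * ∫⁻ ξ, ENNReal.ofReal (ξ ^ 2 / (4 * κ ^ 2 + ξ ^ 2) * H ξ)
      = ∫⁻ ξ, avgWeight s κ₀ ξ * ENNReal.ofReal (H ξ) := by
  have e1 : ∀ κ ∈ Ioi κ₀, ENNReal.ofReal (κ ^ (2 * s - 1))
        * ∫⁻ ξ, ENNReal.ofReal (ξ ^ 2 / (4 * κ ^ 2 + ξ ^ 2) * H ξ)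
      = ∫⁻ ξ, ENNReal.ofReal (κ ^ (2 * s - 1) * (ξ ^ 2 / (4 * κ ^ 2 + ξ ^ 2)))
        * ENNReal.ofReal (H ξ) := by
    intro κ hκ
    have hκ0 : 0 < κ := hκ₀.trans hκ
    rw [← lintegral_const_mul _ (by fun_prop)]
    congr 1; ext ξ
    rw [ENNReal.ofReal_mul (by positivity), ENNReal.ofReal_mul (by positivity), mul_assoc]
  rw [setLIntegral_congr_fun measurableSet_Ioi e1, lintegral_lintegral_swap
    (by apply Measurable.aemeasurable; fun_prop)]
  congr 1; ext ξ
  rw [lintegral_mul_const _ (by fun_prop), avgWeight]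

lemma le_avgWeight (hs : 0 < s) (hκ₀ : 0 < κ₀) {ξ : ℝ} (hξ : κ₀ ≤ |ξ|) :
    ENNReal.ofReal (|ξ| ^ (2 * s)) ≤ 34 * avgWeight s κ₀ ξ := by
  set X := |ξ| with hX
  have hX0 : 0 < X := hκ₀.trans_le hξ
  have h1 : ∫⁻ _ in Ioc X (2 * X), ENNReal.ofReal (X ^ (2 * s) / (34 * X)) ≤ avgWeight s κ₀ ξ := by
    refine (setLIntegral_mono' measurableSet_Ioc fun κ hκ => ?_).trans
      (lintegral_mono_set fun κ hκ => hξ.trans_lt hκ.1)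
    have hκ0 : 0 < κ := hX0.trans hκ.1
    refine ENNReal.ofReal_le_ofReal ?_
    have h2 : X ^ (2 * s) / (2 * X) ≤ κ ^ (2 * s - 1) := by
      rw [Real.rpow_sub hκ0, Real.rpow_one]
      have := hκ.1.le
      have := hκ.2
      gcongr
    have h3 : 1 / 17 ≤ ξ ^ 2 / (4 * κ ^ 2 + ξ ^ 2) := by
      rw [← sq_abs, ← hX, div_le_div_iff₀ (by positivity) (by positivity)]
      nlinarith [hκ.1, hκ.2]
    calc X ^ (2 * s) / (34 * X) = X ^ (2 * s) / (2 * X) * (1 / 17) := by field_simp; norm_num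
      _ ≤ _ := by gcongr
  rw [setLIntegral_const, Real.volume_Ioc, ← ENNReal.ofReal_mul (by positivity)] at h1
  calc ENNReal.ofReal (X ^ (2 * s))
      = 34 * ENNReal.ofReal (X ^ (2 * s) / (34 * X) * (2 * X - X)) := by
        rw [← ENNReal.ofReal_ofNat, ← ENNReal.ofReal_mul (by positivity)]
        congr 1
        field_simp; ring
    _ ≤ _ := by gcongr

lemma avgWeight_le (hs : 0 < s) (hs1 : s < 1) (hκ₀ : 0 < κ₀) (ξ : ℝ) :
    avgWeight s κ₀ ξ ≤ ENNReal.ofReal ((1 / (2 * s) + 1 / (2 - 2 * s)) * |ξ| ^ (2 * s)) := by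
  set X := |ξ| with hX
  rcases (abs_nonneg ξ).eq_or_lt with h0 | hX0
  · have : ξ = 0 := abs_eq_zero.1 h0.symm
    simp [avgWeight, this]
  rw [← hX] at hX0
  have hsub : Ioi κ₀ ⊆ Ioc 0 X ∪ Ioi X := fun κ hκ => by
    rcases le_or_gt κ X with h | h
    · exact Or.inl ⟨hκ₀.trans hκ, h⟩
    · exact Or.inr h
  have i1 : IntegrableOn (fun κ : ℝ => κ ^ (2 * s - 1)) (Ioc 0 X) :=
    (intervalIntegrable_iff_integrableOn_Ioc_of_le hX0.le).1
      (intervalIntegral.intervalIntegrable_rpow' (by linarith))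
  have v1 : ∫ κ in Ioc 0 X, κ ^ (2 * s - 1) = X ^ (2 * s) / (2 * s) := by
    rw [← intervalIntegral.integral_of_le hX0.le, integral_rpow (Or.inl (by linarith))]
    rw [sub_add_cancel, Real.zero_rpow (by linarith), sub_zero]
  have i2 : IntegrableOn (fun κ : ℝ => κ ^ (2 * s - 3) * X ^ 2) (Ioi X) :=
    (integrableOn_Ioi_rpow_of_lt (by linarith) hX0).mul_const _
  have v2 : ∫ κ in Ioi X, κ ^ (2 * s - 3) * X ^ 2 = X ^ (2 * s) / (2 - 2 * s) := by
    rw [integral_mul_const, integral_Ioi_rpow_of_lt (by linarith) hX0]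
    have e : X ^ (2 * s) = X ^ (2 * s - 3 + 1) * X ^ 2 := by
      rw [← Real.rpow_natCast X 2, ← Real.rpow_add hX0]
      congr 1; push_cast; ring
    rw [e, show 2 * s - 3 + 1 = -(2 - 2 * s) by ring]
    have : 2 - 2 * s ≠ 0 := by linarith
    field_simp
  calc avgWeight s κ₀ ξ
      ≤ ∫⁻ κ in Ioc 0 X ∪ Ioi X, ENNReal.ofReal (κ ^ (2 * s - 1) * (ξ ^ 2 / (4 * κ ^ 2 + ξ ^ 2))) :=
        lintegral_mono_set hsub
    _ ≤ _ := lintegral_union_le _ _ _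
    _ ≤ (∫⁻ κ in Ioc 0 X, ENNReal.ofReal (κ ^ (2 * s - 1)))
        + ∫⁻ κ in Ioi X, ENNReal.ofReal (κ ^ (2 * s - 3) * X ^ 2) := by
        refine add_le_add (setLIntegral_mono' measurableSet_Ioc fun κ hκ => ?_)
          (setLIntegral_mono' measurableSet_Ioi fun κ hκ => ?_)
        · have := hκ.1
          refine ENNReal.ofReal_le_ofReal (mul_le_of_le_one_right (by positivity) ?_)
          rw [div_le_one (by positivity)]
          nlinarith
        · have hκ0 : 0 < κ := hX0.trans hκ
          refine ENNReal.ofReal_le_ofReal ?_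
          have e : κ ^ (2 * s - 1) = κ ^ (2 * s - 3) * κ ^ 2 := by
            rw [← Real.rpow_natCast κ 2, ← Real.rpow_add hκ0]
            congr 1; push_cast; ring
          rw [e, mul_assoc, hX, sq_abs]
          gcongr
          rw [mul_div_assoc', div_le_iff₀ (by positivity)]
          nlinarith [sq_nonneg (κ * ξ), sq_nonneg (ξ ^ 2)]
    _ = ENNReal.ofReal ((1 / (2 * s) + 1 / (2 - 2 * s)) * X ^ (2 * s)) := by
        rw [← ofReal_integral_eq_lintegral_ofReal i1 ((ae_restrict_iff' measurableSet_Ioc).2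
            (ae_of_all _ fun κ hκ => Real.rpow_nonneg hκ.1.le _)),
          ← ofReal_integral_eq_lintegral_ofReal i2 ((ae_restrict_iff' measurableSet_Ioi).2
            (ae_of_all _ fun κ hκ => mul_nonneg (Real.rpow_nonneg (hX0.trans hκ).le _)
              (sq_nonneg _))), v1, v2, ← ENNReal.ofReal_add]
        · congr 1; ring
        · positivity
        · have : 0 < 2 - 2 * s := by linarith
          positivity

/-- Bounds on the high-frequency mass at all large frequencies give a Sobolev bound. -/
lemma integral_jap_rpow_mul_le (hs : 0 < s) (hs1 : s < 1) (hκ₀ : 0 < κ₀) {a D M A : ℝ}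
    (ha : 2 * s < a) (hD : 0 ≤ D) {H₀ H₁ : ℝ → ℝ} (hH₀ : Continuous H₀) (hH₁ : Continuous H₁)
    (h₀ : ∀ ξ, 0 ≤ H₀ ξ) (h₁ : ∀ ξ, 0 ≤ H₁ ξ)
    (i₀ : Integrable H₀) (i₁ : Integrable H₁)
    (j₀ : Integrable fun ξ => jap ξ ^ (2 * s) * H₀ ξ)
    (j₁ : Integrable fun ξ => jap ξ ^ (2 * s) * H₁ ξ)
    (hM : ∫ ξ, H₁ ξ ≤ M) (hA : ∫ ξ, jap ξ ^ (2 * s) * H₀ ξ ≤ A)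
    (hle : ∀ κ, κ₀ < κ → ∫ ξ, ξ ^ 2 / (4 * κ ^ 2 + ξ ^ 2) * H₁ ξ
      ≤ (∫ ξ, ξ ^ 2 / (4 * κ ^ 2 + ξ ^ 2) * H₀ ξ) + D * κ ^ (-a)) :
    ∫ ξ, jap ξ ^ (2 * s) * H₁ ξ ≤ (1 + κ₀) ^ (2 * s) * M
      + (1 + κ₀⁻¹) ^ (2 * s) * 34 * ((1 / (2 * s) + 1 / (2 - 2 * s)) * A
        + D * (κ₀ ^ (2 * s - a) / (a - 2 * s))) := by
  have hw : ∀ κ ξ : ℝ, κ₀ < κ → 0 < 4 * κ ^ 2 + ξ ^ 2 := fun κ ξ hκ => by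
    have := hκ₀.trans hκ; positivity
  have hjp : ∀ ξ, 0 < jap ξ := fun ξ => by unfold jap; positivity
  have hA0 : 0 ≤ A := (integral_nonneg fun ξ => mul_nonneg (Real.rpow_nonneg (hjp ξ).le _)
    (h₀ ξ)).trans hA
  have hM0 : 0 ≤ M := (integral_nonneg h₁).trans hM
  have hs2 : 0 < 2 - 2 * s := by linarith
  have hds : 0 < a - 2 * s := by linarith
  have iw : ∀ {H : ℝ → ℝ}, Continuous H → Integrable H → ∀ κ, κ₀ < κ →
      Integrable fun ξ => ξ ^ 2 / (4 * κ ^ 2 + ξ ^ 2) * H ξ := by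
    intro H hc hi κ hκ
    refine hi.norm.mono' (Continuous.aestronglyMeasurable ?_) (ae_of_all _ fun ξ => ?_)
    · exact ((by fun_prop : Continuous fun ξ : ℝ => ξ ^ 2).div (by fun_prop)
        fun ξ => (hw κ ξ hκ).ne').mul hc
    · rw [norm_mul]
      refine mul_le_of_le_one_left (norm_nonneg _) ?_
      rw [Real.norm_of_nonneg (div_nonneg (sq_nonneg _) (hw κ ξ hκ).le), div_le_one (hw κ ξ hκ)]
      nlinarith
  have hwn : ∀ κ ξ, κ₀ < κ → ∀ {y : ℝ}, 0 ≤ y → 0 ≤ ξ ^ 2 / (4 * κ ^ 2 + ξ ^ 2) * y :=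
    fun κ ξ hκ y hy => mul_nonneg (div_nonneg (sq_nonneg _) (hw κ ξ hκ).le) hy
  have L1 : ∀ κ, κ₀ < κ → ∫⁻ ξ, ENNReal.ofReal (ξ ^ 2 / (4 * κ ^ 2 + ξ ^ 2) * H₁ ξ)
      ≤ (∫⁻ ξ, ENNReal.ofReal (ξ ^ 2 / (4 * κ ^ 2 + ξ ^ 2) * H₀ ξ))
        + ENNReal.ofReal (D * κ ^ (-a)) := by
    intro κ hκ
    have hκ0 := hκ₀.trans hκ
    rw [← ofReal_integral_eq_lintegral_ofReal (iw hH₁ i₁ κ hκ) (ae_of_all _ fun ξ =>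
        hwn κ ξ hκ (h₁ ξ)),
      ← ofReal_integral_eq_lintegral_ofReal (iw hH₀ i₀ κ hκ) (ae_of_all _ fun ξ =>
        hwn κ ξ hκ (h₀ ξ)), ← ENNReal.ofReal_add (integral_nonneg fun ξ => hwn κ ξ hκ (h₀ ξ))
        (by positivity)]
    exact ENNReal.ofReal_le_ofReal (hle κ hκ)
  have vD : ∫⁻ κ in Ioi κ₀, ENNReal.ofReal (κ ^ (2 * s - 1)) * ENNReal.ofReal (D * κ ^ (-a))
      = ENNReal.ofReal (D * (κ₀ ^ (2 * s - a) / (a - 2 * s))) := by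
    have e : ∀ κ ∈ Ioi κ₀, ENNReal.ofReal (κ ^ (2 * s - 1)) * ENNReal.ofReal (D * κ ^ (-a))
        = ENNReal.ofReal (D * κ ^ (2 * s - 1 - a)) := by
      intro κ hκ
      have hκ0 : 0 < κ := hκ₀.trans hκ
      rw [← ENNReal.ofReal_mul (by positivity)]
      congr 1
      rw [sub_eq_add_neg (2 * s - 1) a, Real.rpow_add hκ0]; ring
    rw [setLIntegral_congr_fun measurableSet_Ioi e, ← ofReal_integral_eq_lintegral_ofReal
      ((integrableOn_Ioi_rpow_of_lt (by linarith) hκ₀).const_mul _)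
      ((ae_restrict_iff' measurableSet_Ioi).2 (ae_of_all _ fun κ hκ =>
        mul_nonneg hD (Real.rpow_nonneg (hκ₀.trans hκ).le _))), integral_const_mul,
      integral_Ioi_rpow_of_lt (by linarith) hκ₀]
    congr 2
    rw [show 2 * s - 1 - a + 1 = 2 * s - a by ring, show 2 * s - a = -(a - 2 * s) by ring]
    field_simp
  have L2 : ∫⁻ ξ, avgWeight s κ₀ ξ * ENNReal.ofReal (H₁ ξ)
      ≤ ENNReal.ofReal ((1 / (2 * s) + 1 / (2 - 2 * s)) * A
        + D * (κ₀ ^ (2 * s - a) / (a - 2 * s))) := by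
    rw [ENNReal.ofReal_add (by positivity) (by positivity), ← vD,
      ← lintegral_avgWeight_mul hκ₀ hH₁.measurable]
    calc _ ≤ ∫⁻ κ in Ioi κ₀, (ENNReal.ofReal (κ ^ (2 * s - 1))
          * (∫⁻ ξ, ENNReal.ofReal (ξ ^ 2 / (4 * κ ^ 2 + ξ ^ 2) * H₀ ξ))
          + ENNReal.ofReal (κ ^ (2 * s - 1)) * ENNReal.ofReal (D * κ ^ (-a))) := by
          refine setLIntegral_mono' measurableSet_Ioi fun κ hκ => ?_
          rw [← mul_add]
          gcongr
          exact L1 κ hκ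
      _ = (∫⁻ κ in Ioi κ₀, ENNReal.ofReal (κ ^ (2 * s - 1))
          * (∫⁻ ξ, ENNReal.ofReal (ξ ^ 2 / (4 * κ ^ 2 + ξ ^ 2) * H₀ ξ)))
          + ∫⁻ κ in Ioi κ₀, ENNReal.ofReal (κ ^ (2 * s - 1)) * ENNReal.ofReal (D * κ ^ (-a)) :=
          lintegral_add_right _ (by fun_prop)
      _ ≤ _ := by
          gcongr
          rw [lintegral_avgWeight_mul hκ₀ hH₀.measurable]
          calc _ ≤ ∫⁻ ξ, ENNReal.ofReal ((1 / (2 * s) + 1 / (2 - 2 * s))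
                * (jap ξ ^ (2 * s) * H₀ ξ)) := by
                refine lintegral_mono fun ξ => ?_
                rw [← mul_assoc, ENNReal.ofReal_mul (mul_nonneg (by positivity)
                  (Real.rpow_nonneg (hjp ξ).le _))]
                gcongr
                refine (avgWeight_le hs hs1 hκ₀ ξ).trans (ENNReal.ofReal_le_ofReal ?_)
                gcongr
                unfold jap
                linarith
            _ ≤ _ := by
                rw [← ofReal_integral_eq_lintegral_ofReal (j₀.const_mul _)
                  (ae_of_all _ fun ξ => mul_nonneg (by positivity)
                    (mul_nonneg (Real.rpow_nonneg (hjp ξ).le _) (h₀ ξ))), integral_const_mul]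
                refine ENNReal.ofReal_le_ofReal ?_
                gcongr
  have L3 : ∀ ξ, ENNReal.ofReal (jap ξ ^ (2 * s) * H₁ ξ)
      ≤ ENNReal.ofReal ((1 + κ₀) ^ (2 * s) * H₁ ξ)
        + ENNReal.ofReal ((1 + κ₀⁻¹) ^ (2 * s)) * 34
          * (avgWeight s κ₀ ξ * ENNReal.ofReal (H₁ ξ)) := by
    intro ξ
    rcases le_total κ₀ |ξ| with hξ | hξ
    · refine le_add_left ?_
      rw [ENNReal.ofReal_mul (Real.rpow_nonneg (hjp ξ).le _), ← mul_assoc]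
      gcongr
      have e : jap ξ ^ (2 * s) ≤ (1 + κ₀⁻¹) ^ (2 * s) * |ξ| ^ (2 * s) := by
        rw [← Real.mul_rpow (by positivity) (by positivity)]
        refine Real.rpow_le_rpow (hjp ξ).le ?_ (by positivity)
        have : 1 ≤ κ₀⁻¹ * |ξ| := by rw [inv_mul_eq_div, one_le_div hκ₀]; exact hξ
        unfold jap
        linarith
      refine (ENNReal.ofReal_le_ofReal e).trans ?_
      rw [ENNReal.ofReal_mul (by positivity), mul_assoc]
      gcongr
      exact le_avgWeight hs hκ₀ hξ
    · refine le_add_right (ENNReal.ofReal_le_ofReal ?_)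
      have := h₁ ξ
      have := (hjp ξ).le
      gcongr
      unfold jap
      linarith
  rw [← ENNReal.ofReal_le_ofReal_iff (by positivity),
    ofReal_integral_eq_lintegral_ofReal j₁ (ae_of_all _ fun ξ =>
      mul_nonneg (Real.rpow_nonneg (hjp ξ).le _) (h₁ ξ)),
    ENNReal.ofReal_add (by positivity) (by positivity)]
  refine (lintegral_mono L3).trans ?_
  rw [lintegral_add_left (by fun_prop), lintegral_const_mul' _ _
    (ENNReal.mul_ne_top ENNReal.ofReal_ne_top (by norm_num)),
    ← ofReal_integral_eq_lintegral_ofReal (i₁.const_mul _) (ae_of_all _ fun ξ =>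
      mul_nonneg (by positivity) (h₁ ξ)), integral_const_mul,
    ENNReal.ofReal_mul (p := (1 + κ₀⁻¹) ^ (2 * s) * 34) (by positivity),
    ENNReal.ofReal_mul (p := (1 + κ₀⁻¹) ^ (2 * s)) (by positivity), ENNReal.ofReal_ofNat]
  gcongr

end NLS

namespace NLS

open Filter Topology Set SchwartzMap

variable {u : ℝ → ℝ → ℂ} {κ : ℝ}

lemma one_le_jap (ξ : ℝ) : 1 ≤ jap ξ := by unfold jap; linarith [abs_nonneg ξ]

lemma weighted_mass_le (hκ : 0 < κ) (h : IsSchwartzSolution u)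
    (hL : L2sq (fun x => u x 0) ≤ κ) {W : ℝ}
    (hW : ∀ t, (2 * π)⁻¹ * ∫ ξ, ‖ft (fun x => u x t) ξ‖ / √(4 * κ ^ 2 + ξ ^ 2) ≤ W) (t : ℝ) :
    ∫ ξ, ξ ^ 2 / (4 * κ ^ 2 + ξ ^ 2) * ‖ft (fun x => u x t) ξ‖ ^ 2
      ≤ (∫ ξ, ξ ^ 2 / (4 * κ ^ 2 + ξ ^ 2) * ‖ft (fun x => u x 0) ξ‖ ^ 2)
        + 8 * π * L2sq (fun x => u x 0) * W ^ 2 := by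
  have hr : ∀ t, ∃ r, IsRiccati κ (fun x => u x t) r := fun t => by
    obtain ⟨C, -, hC⟩ := exists_decay h (T := |t| + 1) (by positivity)
    exact exists_isRiccati hκ (integrable_norm_sq (slice h t)) (slice h t).continuous
      ((L2sq_eq h t).trans_le hL) fun x => (hC x t (by linarith)).2.1
  choose r hr using hr
  have e1 := abs_le.1 (abs_weighted_mass_sub_le hκ (slice h t) (hr t) ((L2sq_eq h t).trans_le hL)
    (hW t))
  have e0 := abs_le.1 (abs_weighted_mass_sub_le hκ (slice h 0) (hr 0) hL (hW 0))
  simp only [coe_slice] at e0 e1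
  rw [L2sq_eq h t, integral_mul_riccati_eq hκ h hL hr t] at e1
  linarith [e0.1, e1.2]

lemma integral_ft_div_sqrt_le (hκ : 1 ≤ κ) (g : 𝓢(ℝ, ℂ)) {σ a A : ℝ} (hσ : σ ≤ 1) (ha0 : 0 ≤ a)
    (ha2 : a ≤ 2) (hp : 1 < 2 * σ + 2 - a) (hA : ∫ ξ, jap ξ ^ (2 * σ) * ‖ft g ξ‖ ^ 2 ≤ A) :
    ∫ ξ, ‖ft g ξ‖ / √(4 * κ ^ 2 + ξ ^ 2)
      ≤ κ ^ (-a / 2) * (A + ∫ ξ, jap ξ ^ (-(2 * σ + 2 - a))) := by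
  have hκ0 : 0 < κ := by linarith
  have i1 := integrable_jap_rpow_mul_ft g (p := 2 * σ) (by linarith)
  have i2 : Integrable fun ξ => jap ξ ^ (-(2 * σ + 2 - a)) := by
    simpa [jap] using integrable_one_add_norm (E := ℝ) (μ := volume) (r := 2 * σ + 2 - a)
      (by simpa using hp)
  have hpt : ∀ ξ, ‖ft g ξ‖ / √(4 * κ ^ 2 + ξ ^ 2) ≤ κ ^ (-a / 2) *
      (jap ξ ^ (2 * σ) * ‖ft g ξ‖ ^ 2 + jap ξ ^ (-(2 * σ + 2 - a))) := by
    intro ξ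
    set Y := 4 * κ ^ 2 + ξ ^ 2 with hY
    have hY0 : 0 < Y := by positivity
    have hj : 0 < jap ξ := by linarith [one_le_jap ξ]
    have s1 : κ ≤ √(2 * Y) := Real.le_sqrt_of_sq_le (by nlinarith)
    have s2 : jap ξ ≤ √(2 * Y) := Real.le_sqrt_of_sq_le (by
      unfold jap
      nlinarith [sq_nonneg (1 - |ξ|), sq_abs ξ])
    have s3 : κ ^ a * jap ξ ^ (2 - a) ≤ 2 * Y := by
      calc κ ^ a * jap ξ ^ (2 - a) ≤ √(2 * Y) ^ a * √(2 * Y) ^ (2 - a) := by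
            have : 0 ≤ 2 - a := by linarith
            gcongr
        _ = 2 * Y := by
            rw [← Real.rpow_add (by positivity), add_sub_cancel, Real.rpow_two,
              Real.sq_sqrt (by positivity)]
    set k := κ ^ (-a / 2) with hk
    have hk0 : 0 < k := by positivity
    set p := jap ξ ^ (-(2 * σ + 2 - a)) with hpdef
    have hp0 : 0 < p := by positivity
    set w := jap ξ ^ (2 * σ) with hw
    have hw0 : 0 < w := by positivity
    have s4 : 1 ≤ 2 * Y * (k ^ 2 * (p * w)) := by
      have e1 : k ^ 2 * κ ^ a = 1 := by
        rw [hk, ← Real.rpow_natCast, ← Real.rpow_mul hκ0.le, ← Real.rpow_add hκ0]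
        rw [show -a / 2 * ((2 : ℕ) : ℝ) + a = 0 by push_cast; ring, Real.rpow_zero]
      have e2 : p * w * jap ξ ^ (2 - a) = 1 := by
        rw [hpdef, hw, ← Real.rpow_add hj, ← Real.rpow_add hj]
        rw [show -(2 * σ + 2 - a) + 2 * σ + (2 - a) = 0 by ring, Real.rpow_zero]
      calc (1 : ℝ) = (k ^ 2 * κ ^ a) * (p * w * jap ξ ^ (2 - a)) := by rw [e1, e2, one_mul]
        _ = κ ^ a * jap ξ ^ (2 - a) * (k ^ 2 * (p * w)) := by ring
        _ ≤ _ := by gcongr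
    set n := ‖ft g ξ‖ with hn
    have hn0 : 0 ≤ n := norm_nonneg _
    rw [div_le_iff₀ (by positivity)]
    refine le_of_sq_le_sq ?_ (by positivity)
    rw [mul_pow, Real.sq_sqrt hY0.le, mul_pow]
    have s5 : 4 * (w * n ^ 2 * p) ≤ (w * n ^ 2 + p) ^ 2 := by nlinarith [sq_nonneg (w * n ^ 2 - p)]
    calc n ^ 2 = n ^ 2 * 1 := (mul_one _).symm
      _ ≤ n ^ 2 * (2 * Y * (k ^ 2 * (p * w))) := by gcongr
      _ = k ^ 2 * (2 * (w * n ^ 2 * p)) * Y := by ring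
      _ ≤ k ^ 2 * (w * n ^ 2 + p) ^ 2 * Y := by
          gcongr
          have : 0 ≤ w * n ^ 2 * p := by positivity
          linarith
  have hr : Integrable fun ξ => κ ^ (-a / 2) *
      (jap ξ ^ (2 * σ) * ‖ft g ξ‖ ^ 2 + jap ξ ^ (-(2 * σ + 2 - a))) := (i1.add i2).const_mul _
  refine (integral_mono_of_nonneg (ae_of_all _ fun ξ => by positivity) hr
    (ae_of_all _ hpt)).trans ?_
  rw [integral_const_mul, integral_add i1 i2]
  gcongr

/-- A uniform bound on a Sobolev norm improves to a uniform bound on a stronger one. -/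
lemma exists_uniform_bound {s σ a : ℝ} (hs : 0 < s) (hs1 : s < 1) (hσ : σ ≤ 1) (ha : 2 * s < a)
    (ha2 : a ≤ 2) (hp : 1 < 2 * σ + 2 - a) (m A B : ℝ) :
    ∃ C, ∀ u : ℝ → ℝ → ℂ, IsSchwartzSolution u → L2sq (fun x => u x 0) ≤ m →
      (∀ t, ∫ ξ, jap ξ ^ (2 * σ) * ‖ft (fun x => u x t) ξ‖ ^ 2 ≤ A) →
      ∫ ξ, jap ξ ^ (2 * s) * ‖ft (fun x => u x 0) ξ‖ ^ 2 ≤ B →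
      ∀ t, ∫ ξ, jap ξ ^ (2 * s) * ‖ft (fun x => u x t) ξ‖ ^ 2 ≤ C := by
  set J := ∫ ξ, jap ξ ^ (-(2 * σ + 2 - a)) with hJ
  set κ₀ := max 1 m with hκ₀
  have hκ₀1 : 1 ≤ κ₀ := le_max_left _ _
  refine ⟨(1 + κ₀) ^ (2 * s) * (2 * π * m) + (1 + κ₀⁻¹) ^ (2 * s) * 34
    * ((1 / (2 * s) + 1 / (2 - 2 * s)) * B
      + 8 * π * m * (A + J) ^ 2 * (κ₀ ^ (2 * s - a) / (a - 2 * s))), ?_⟩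
  intro u h hm hA hB t
  have hm0 : 0 ≤ m := (integral_nonneg fun x => sq_nonneg ‖u x 0‖).trans hm
  have hjn : ∀ ξ (p : ℝ), 0 ≤ jap ξ ^ p := fun ξ p =>
    Real.rpow_nonneg (by linarith [one_le_jap ξ]) p
  have hA0 : 0 ≤ A := (integral_nonneg fun ξ => mul_nonneg (hjn ξ _) (sq_nonneg _)).trans (hA 0)
  have hJ0 : 0 ≤ J := integral_nonneg fun ξ => hjn ξ _
  refine integral_jap_rpow_mul_le hs hs1 (by linarith) ha (by positivity)
    (H₀ := fun ξ => ‖ft (slice h 0) ξ‖ ^ 2) (H₁ := fun ξ => ‖ft (slice h t) ξ‖ ^ 2)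
    ((continuous_ft _).norm.pow 2) ((continuous_ft _).norm.pow 2)
    (fun ξ => sq_nonneg _) (fun ξ => sq_nonneg _)
    (integrable_norm_sq_ft _) (integrable_norm_sq_ft _)
    (integrable_jap_rpow_mul_ft _ (by linarith)) (integrable_jap_rpow_mul_ft _ (by linarith))
    ?_ hB fun κ hκ => ?_
  · rw [integral_norm_sq_ft, coe_slice, L2sq_eq h t]
    gcongr
  · have hκ1 : 1 ≤ κ := by linarith
    have hκ0 : 0 < κ := by linarith
    have hLκ : L2sq (fun x => u x 0) ≤ κ := hm.trans ((le_max_right _ _).trans hκ.le)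
    have hW : ∀ t, (2 * π)⁻¹ * ∫ ξ, ‖ft (fun x => u x t) ξ‖ / √(4 * κ ^ 2 + ξ ^ 2)
        ≤ κ ^ (-a / 2) * (A + J) := by
      intro t
      have h1 := integral_ft_div_sqrt_le hκ1 (slice h t) hσ (by linarith) ha2 hp (hA t)
      refine (mul_le_of_le_one_left (integral_nonneg fun ξ => by positivity) ?_).trans h1
      exact inv_le_one_of_one_le₀ (by linarith [Real.pi_gt_three])
    refine (weighted_mass_le hκ0 h hLκ hW t).trans ?_
    simp only [coe_slice]
    refine add_le_add le_rfl ?_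
    have e : (κ ^ (-a / 2)) ^ 2 = κ ^ (-a) := by
      rw [← Real.rpow_natCast, ← Real.rpow_mul hκ0.le]
      congr 1; push_cast; ring
    rw [mul_pow, e]
    calc 8 * π * L2sq (fun x => u x 0) * (κ ^ (-a) * (A + J) ^ 2)
        ≤ 8 * π * m * (κ ^ (-a) * (A + J) ^ 2) := by gcongr
      _ = _ := by ring

/-- Every Sobolev norm of index in `(0, 1)` is bounded uniformly in time. -/
lemma exists_uniform_Hs_bound {s : ℝ} (hs : 0 < s) (hs1 : s < 1) (B : ℝ) :
    ∃ C, ∀ u : ℝ → ℝ → ℂ, IsSchwartzSolution u →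
      ∫ ξ, jap ξ ^ (2 * s) * ‖ft (fun x => u x 0) ξ‖ ^ 2 ≤ B →
      ∀ t, ∫ ξ, jap ξ ^ (2 * s) * ‖ft (fun x => u x t) ξ‖ ^ 2 ≤ C := by
  obtain ⟨C₁, hC₁⟩ := exists_uniform_bound (s := s / 2) (σ := 0) (a := (s + 1) / 2) (by linarith)
    (by linarith) (by linarith) (by linarith) (by linarith) (by linarith) B B B
  obtain ⟨C₂, hC₂⟩ := exists_uniform_bound (s := s) (σ := s / 2) (a := (3 * s + 1) / 2) hs hs1
    (by linarith) (by linarith) (by linarith) (by linarith) B C₁ B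
  refine ⟨C₂, fun u h hB => ?_⟩
  have mono : ∀ p : ℝ, p ≤ 2 * s → ∫ ξ, jap ξ ^ p * ‖ft (fun x => u x 0) ξ‖ ^ 2 ≤ B := by
    intro p hp
    refine le_trans ?_ hB
    refine integral_mono (integrable_jap_rpow_mul_ft (slice h 0) (by linarith))
      (integrable_jap_rpow_mul_ft (slice h 0) (by linarith)) fun ξ => ?_
    have := one_le_jap ξ
    simp only
    gcongr
  have h0 := mono 0 (by linarith)
  simp only [Real.rpow_zero, one_mul] at h0
  have hpl := integral_norm_sq_ft (slice h 0)
  simp only [coe_slice] at hpl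
  have hn : 0 ≤ L2sq (fun x => u x 0) := integral_nonneg fun x => sq_nonneg _
  have hm : L2sq (fun x => u x 0) ≤ B := by nlinarith [Real.pi_gt_three]
  refine hC₂ u h hm (hC₁ u h hm (fun t => ?_) (mono _ (by linarith))) hB
  have hpl' := integral_norm_sq_ft (slice h t)
  simp only [coe_slice] at hpl'
  simp only [mul_zero, Real.rpow_zero, one_mul]
  rw [hpl', L2sq_eq h t, ← hpl]
  exact h0

end NLS

/-- polynomial growth of the `H^s` norm for the focusing cubic NLS. -/
theorem polynomial_growth_Hs
    (s ε B : ℝ) (hs0 : 0 < s) (hs1 : s < 1) (hε : 0 < ε) (hB : 0 < B) :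
    ∃ C : ℝ, 0 < C ∧ ∀ u : ℝ → ℝ → ℂ, IsSchwartzSolution u →
      HsNorm s (fun x => u x 0) ≤ B →
      ∀ t : ℝ, HsNorm s (fun x => u x t) ≤ C * (1 + |t|) ^ (2 * s + ε) := by
  obtain ⟨C, hC⟩ := NLS.exists_uniform_Hs_bound hs0 hs1 (B ^ 2)
  refine ⟨√C + 1, by positivity, fun u h hu t => ?_⟩
  rw [HsNorm, ← Real.sqrt_eq_rpow] at hu ⊢
  have h0 := hC u h ((Real.sqrt_le_left hB.le).1 hu) t
  have h1 : 1 ≤ (1 + |t|) ^ (2 * s + ε) :=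
    Real.one_le_rpow (by linarith [abs_nonneg t]) (by linarith)
  calc _ ≤ √C := Real.sqrt_le_sqrt h0
    _ ≤ (√C + 1) * 1 := by linarith
    _ ≤ _ := by gcongr
end
end

section
/- Let 0 < s < 1 and 0 < ε ≤ 1/100. There exists C > 0 depending only on s and ε such that: for every N ≥ 2, every admissible high symbol θ (with parameters N, s) with associated multiplier D, and all Schwartz functions u₁, u₂, u₃ : ℝ×ℝ→ℂ, one has ‖D(u₁ \overline{u₂} u₃)‖_{X^{0,−1/2+2ε}} ≤ C ‖D u₁‖_{X^{0,1/2+ε}} ‖D u₂‖_{X^{0,1/2+ε}} ‖D u₃‖_{X^{0,1/2+ε}}. -/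
open MeasureTheory Real

noncomputable section

open scoped ENNReal

theorem sq_lintegral_mul_le {α : Type*} [MeasurableSpace α] {μ : Measure α} {f g : α → ℝ≥0∞}
    (hf : Measurable f) (hg : Measurable g) :
    (∫⁻ a, f a * g a ∂μ) ^ 2 ≤ (∫⁻ a, f a ^ 2 ∂μ) * ∫⁻ a, g a ^ 2 ∂μ := by
  have h := ENNReal.lintegral_mul_le_Lp_mul_Lq μ (p := 2) (q := 2)
    (by constructor <;> norm_num) hf.aemeasurable hg.aemeasurable
  simp only [Pi.mul_apply, ENNReal.rpow_ofNat] at h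
  have h2 := pow_le_pow_left' h 2
  rw [mul_pow, ← ENNReal.rpow_mul_natCast, ← ENNReal.rpow_mul_natCast] at h2
  simpa using h2

/-- Weighted `L²` bound for a convolution of nonnegative functions, given a uniform bound for
the convolution square of the reciprocal weight. -/
theorem lintegral_sq_conv_le {v F G : ℝ × ℝ → ℝ≥0∞} {K : ℝ≥0∞} (hv : Measurable v)
    (hF : Measurable F) (hG : Measurable G) (hv0 : ∀ p, v p ≠ 0) (hvt : ∀ p, v p ≠ ∞)
    (hK : ∀ q, ∫⁻ p, (v p)⁻¹ ^ 2 * (v (q - p))⁻¹ ^ 2 ≤ K) :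
    ∫⁻ q, (∫⁻ p, F p * G (q - p)) ^ 2
      ≤ K * ((∫⁻ p, v p ^ 2 * F p ^ 2) * ∫⁻ p, v p ^ 2 * G p ^ 2) := by
  have key : ∀ q, (∫⁻ p, F p * G (q - p)) ^ 2
      ≤ K * ∫⁻ p, (v p ^ 2 * F p ^ 2) * (v (q - p) ^ 2 * G (q - p) ^ 2) := by
    intro q
    have h := sq_lintegral_mul_le (μ := volume)
      (f := fun p => (v p)⁻¹ * (v (q - p))⁻¹) (g := fun p => (v p * F p) * (v (q - p) * G (q - p)))
      (by fun_prop) (by fun_prop)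
    have e : ∀ p, (v p)⁻¹ * (v (q - p))⁻¹ * ((v p * F p) * (v (q - p) * G (q - p)))
        = F p * G (q - p) := by
      intro p
      calc _ = ((v p)⁻¹ * v p) * ((v (q - p))⁻¹ * v (q - p)) * (F p * G (q - p)) := by ring
        _ = _ := by
          rw [ENNReal.inv_mul_cancel (hv0 _) (hvt _), ENNReal.inv_mul_cancel (hv0 _) (hvt _)]
          simp
    simp only [e] at h
    refine h.trans ?_
    gcongr
    · simpa only [mul_pow] using hK q
    · apply le_of_eq; ring
  calc _ ≤ ∫⁻ q, K * ∫⁻ p, (v p ^ 2 * F p ^ 2) * (v (q - p) ^ 2 * G (q - p) ^ 2) :=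
        lintegral_mono key
    _ = K * ∫⁻ q, ∫⁻ p, (v p ^ 2 * F p ^ 2) * (v (q - p) ^ 2 * G (q - p) ^ 2) := by
        rw [lintegral_const_mul]
        apply Measurable.lintegral_prod_right'
          (f := fun z : (ℝ × ℝ) × (ℝ × ℝ) =>
            (v z.2 ^ 2 * F z.2 ^ 2) * (v (z.1 - z.2) ^ 2 * G (z.1 - z.2) ^ 2))
        fun_prop
    _ = K * ∫⁻ p, ∫⁻ q, (v p ^ 2 * F p ^ 2) * (v (q - p) ^ 2 * G (q - p) ^ 2) := by
        rw [lintegral_lintegral_swap]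
        apply Measurable.aemeasurable
        fun_prop
    _ = K * ((∫⁻ p, v p ^ 2 * F p ^ 2) * ∫⁻ p, v p ^ 2 * G p ^ 2) := by
        congr 1
        rw [← lintegral_mul_const _ (by fun_prop)]
        congr 1; ext p
        rw [lintegral_const_mul _ (by fun_prop),
          lintegral_sub_right_eq_self (fun q => v q ^ 2 * G q ^ 2) p]

/-- The dual form of the trilinear estimate on the Fourier side: pairing the two bilinear
interactions `(F₁, F₃)` and `(h, F₂)`. -/
theorem sq_lintegral_quadrilinear_le {v h F₁ F₂ F₃ : ℝ × ℝ → ℝ≥0∞} {K : ℝ≥0∞} (hv : Measurable v)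
    (hh : Measurable h) (hF₁ : Measurable F₁) (hF₂ : Measurable F₂) (hF₃ : Measurable F₃)
    (hv0 : ∀ p, v p ≠ 0) (hvt : ∀ p, v p ≠ ∞)
    (hK : ∀ q, ∫⁻ p, (v p)⁻¹ ^ 2 * (v (q - p))⁻¹ ^ 2 ≤ K) :
    (∫⁻ q, h q * ∫⁻ p, (∫⁻ r, F₁ r * F₃ (p - r)) * F₂ (p - q)) ^ 2
      ≤ K ^ 2 * ((∫⁻ p, v p ^ 2 * h p ^ 2) * ((∫⁻ p, v p ^ 2 * F₁ p ^ 2)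
        * (∫⁻ p, v p ^ 2 * F₂ p ^ 2) * ∫⁻ p, v p ^ 2 * F₃ p ^ 2)) := by
  have m1 : Measurable fun p => ∫⁻ r, F₁ r * F₃ (p - r) := by
    apply Measurable.lintegral_prod_right'
      (f := fun z : (ℝ × ℝ) × (ℝ × ℝ) => F₁ z.2 * F₃ (z.1 - z.2))
    fun_prop
  have m2 : Measurable fun p => ∫⁻ q, h q * F₂ (p - q) := by
    apply Measurable.lintegral_prod_right'
      (f := fun z : (ℝ × ℝ) × (ℝ × ℝ) => h z.2 * F₂ (z.1 - z.2))
    fun_prop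
  have e : ∫⁻ q, h q * ∫⁻ p, (∫⁻ r, F₁ r * F₃ (p - r)) * F₂ (p - q)
      = ∫⁻ p, (∫⁻ r, F₁ r * F₃ (p - r)) * ∫⁻ q, h q * F₂ (p - q) := by
    have : ∀ q, h q * ∫⁻ p, (∫⁻ r, F₁ r * F₃ (p - r)) * F₂ (p - q)
        = ∫⁻ p, (∫⁻ r, F₁ r * F₃ (p - r)) * (h q * F₂ (p - q)) := by
      intro q
      rw [← lintegral_const_mul _ (by fun_prop)]
      congr 1; ext p; ring
    simp only [this]
    rw [lintegral_lintegral_swap]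
    · congr 1; ext p
      rw [lintegral_const_mul _ (by fun_prop)]
    · apply Measurable.aemeasurable
      have : Measurable fun z : (ℝ × ℝ) × (ℝ × ℝ) => ∫⁻ r, F₁ r * F₃ (z.2 - r) :=
        m1.comp measurable_snd
      simp only [Function.uncurry_def]
      fun_prop
  rw [e]
  refine (sq_lintegral_mul_le m1 m2).trans ?_
  refine (mul_le_mul' (lintegral_sq_conv_le hv hF₁ hF₃ hv0 hvt hK)
    (lintegral_sq_conv_le hv hh hF₂ hv0 hvt hK)).trans (le_of_eq ?_)
  ring

/-- The dispersive weight `⟨τ - ξ²⟩ ^ (7/16)`. -/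
def dispWeight (p : ℝ × ℝ) : ℝ≥0∞ := ENNReal.ofReal (jap (p.2 - p.1 ^ 2) ^ (7 / 16 : ℝ))

theorem jap_pos (x : ℝ) : 0 < jap x := by unfold jap; positivity

theorem one_le_jap (x : ℝ) : 1 ≤ jap x := by unfold jap; linarith [abs_nonneg x]

theorem continuous_jap : Continuous jap := by unfold jap; fun_prop

@[fun_prop]
theorem continuous_jap_rpow (a : ℝ) : Continuous fun x => jap x ^ a :=
  continuous_jap.rpow_const fun x => Or.inl (jap_pos x).ne'

@[fun_prop]
theorem measurable_jap : Measurable jap := continuous_jap.measurable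

theorem measurable_dispWeight : Measurable dispWeight := by
  unfold dispWeight
  fun_prop

theorem dispWeight_ne_zero (p : ℝ × ℝ) : dispWeight p ≠ 0 := by
  have := Real.rpow_pos_of_pos (jap_pos (p.2 - p.1 ^ 2)) (7 / 16)
  simp [dispWeight, this]

theorem dispWeight_ne_top (p : ℝ × ℝ) : dispWeight p ≠ ∞ := ENNReal.ofReal_ne_top

theorem dispWeight_sq (p : ℝ × ℝ) :
    dispWeight p ^ 2 = ENNReal.ofReal (jap (p.2 - p.1 ^ 2) ^ (7 / 8 : ℝ)) := by
  rw [dispWeight, ← ENNReal.ofReal_pow (Real.rpow_nonneg (jap_pos _).le _),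
    ← Real.rpow_mul_natCast (jap_pos _).le]
  norm_num

theorem dispWeight_inv_sq (p : ℝ × ℝ) :
    (dispWeight p)⁻¹ ^ 2 = ENNReal.ofReal (jap (p.2 - p.1 ^ 2) ^ (-(7 / 8) : ℝ)) := by
  rw [Real.rpow_neg (jap_pos _).le, ENNReal.ofReal_inv_of_pos (Real.rpow_pos_of_pos (jap_pos _) _),
    ← dispWeight_sq, ENNReal.inv_pow]

theorem jap_rpow_mul_le (a b : ℝ) :
    jap a ^ (-(7 / 8) : ℝ) * jap b ^ (-(7 / 8) : ℝ)
      ≤ 2 * jap (a + b) ^ (-(5 / 8) : ℝ)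
        * (jap a ^ (-(9 / 8) : ℝ) + jap b ^ (-(9 / 8) : ℝ)) := by
  have main : ∀ a b, jap a ≤ jap b → jap a ^ (-(7 / 8) : ℝ) * jap b ^ (-(7 / 8) : ℝ)
      ≤ 2 * jap (a + b) ^ (-(5 / 8) : ℝ) * jap a ^ (-(9 / 8) : ℝ) := by
    intro a b hab
    have ha := jap_pos a
    have hb := jap_pos b
    have hs : jap (a + b) ≤ 2 * jap b := by
      have := abs_add_le a b
      unfold jap at *
      linarith
    have h1 : jap b ^ (-(5 / 8) : ℝ) ≤ 2 * jap (a + b) ^ (-(5 / 8) : ℝ) := by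
      have h2 : (2 * jap b) ^ (-(5 / 8) : ℝ) ≤ jap (a + b) ^ (-(5 / 8) : ℝ) :=
        Real.rpow_le_rpow_of_nonpos (jap_pos _) hs (by norm_num)
      rw [Real.mul_rpow (by norm_num) hb.le] at h2
      have h3 : (1 / 2 : ℝ) ≤ 2 ^ (-(5 / 8) : ℝ) := by
        rw [one_div, ← Real.rpow_neg_one]
        exact Real.rpow_le_rpow_of_exponent_le (by norm_num) (by norm_num)
      nlinarith [Real.rpow_pos_of_pos hb (-(5 / 8))]
    have h4 : jap b ^ (-(1 / 4) : ℝ) ≤ jap a ^ (-(1 / 4) : ℝ) :=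
      Real.rpow_le_rpow_of_nonpos ha hab (by norm_num)
    calc _ = jap a ^ (-(7 / 8) : ℝ) * (jap b ^ (-(5 / 8) : ℝ) * jap b ^ (-(1 / 4) : ℝ)) := by
          rw [← Real.rpow_add hb]; norm_num
      _ ≤ jap a ^ (-(7 / 8) : ℝ) * ((2 * jap (a + b) ^ (-(5 / 8) : ℝ)) * jap a ^ (-(1 / 4) : ℝ)) := by
          have := jap_pos (a + b)
          gcongr
      _ = 2 * jap (a + b) ^ (-(5 / 8) : ℝ) * (jap a ^ (-(7 / 8) : ℝ) * jap a ^ (-(1 / 4) : ℝ)) := by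
          ring
      _ = _ := by rw [← Real.rpow_add ha]; norm_num
  have hab := jap_pos (a + b)
  have ha := Real.rpow_pos_of_pos (jap_pos a) (-(9 / 8))
  have hb := Real.rpow_pos_of_pos (jap_pos b) (-(9 / 8))
  rcases le_total (jap a) (jap b) with h | h
  · refine (main a b h).trans ?_
    gcongr
    linarith
  · rw [mul_comm (jap a ^ _)]
    refine (main b a h).trans ?_
    rw [add_comm b a]
    gcongr
    linarith

theorem exists_jap_sub_rpow_le (A : ℝ) : ∃ r : ℝ, ∀ y : ℝ,
    jap (A - 2 * y ^ 2) ^ (-(5 / 8) : ℝ)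
      ≤ (1 + (y - r) ^ 2) ^ (-(5 / 8) : ℝ) + (1 + (y + r) ^ 2) ^ (-(5 / 8) : ℝ) := by
  refine ⟨√(A / 2), fun y => ?_⟩
  set r := √(A / 2) with hr
  have hr0 : 0 ≤ r := Real.sqrt_nonneg _
  have h0 : 2 * |y ^ 2 - r ^ 2| ≤ |A - 2 * y ^ 2| := by
    rcases le_total 0 A with h | h
    · have : r ^ 2 = A / 2 := Real.sq_sqrt (by linarith)
      rw [this, ← abs_two, ← abs_mul, abs_two, abs_sub_comm]
      apply le_of_eq; ring_nf
    · have : r = 0 := Real.sqrt_eq_zero_of_nonpos (by linarith)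
      rw [this, abs_sub_comm A, abs_of_nonneg (by nlinarith), abs_of_nonneg (by nlinarith)]
      nlinarith
  have p1 : 0 < (1 + (y - r) ^ 2) ^ (-(5 / 8) : ℝ) := by positivity
  have p2 : 0 < (1 + (y + r) ^ 2) ^ (-(5 / 8) : ℝ) := by positivity
  rcases le_total 0 y with h | h
  · have : 1 + (y - r) ^ 2 ≤ jap (A - 2 * y ^ 2) := by
      unfold jap
      have : (y - r) ^ 2 ≤ |y ^ 2 - r ^ 2| := by
        rw [show y ^ 2 - r ^ 2 = (y - r) * (y + r) by ring, abs_mul, ← sq_abs, sq]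
        refine mul_le_mul_of_nonneg_left (abs_le.2 ?_) (abs_nonneg _)
        constructor <;> linarith [le_abs_self (y + r)]
      linarith [abs_nonneg (y ^ 2 - r ^ 2)]
    have := Real.rpow_le_rpow_of_nonpos (z := -(5 / 8)) (by positivity) this (by norm_num)
    linarith
  · have : 1 + (y + r) ^ 2 ≤ jap (A - 2 * y ^ 2) := by
      unfold jap
      have : (y + r) ^ 2 ≤ |y ^ 2 - r ^ 2| := by
        rw [show y ^ 2 - r ^ 2 = (y + r) * (y - r) by ring, abs_mul, ← sq_abs, sq]
        refine mul_le_mul_of_nonneg_left (abs_le.2 ?_) (abs_nonneg _)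
        constructor <;> linarith [neg_abs_le (y - r)]
      linarith [abs_nonneg (y ^ 2 - r ^ 2)]
    have := Real.rpow_le_rpow_of_nonpos (z := -(5 / 8)) (by positivity) this (by norm_num)
    linarith

theorem lintegral_jap_rpow_lt_top :
    ∫⁻ x : ℝ, ENNReal.ofReal (jap x ^ (-(9 / 8) : ℝ)) < ∞ := by
  simpa [jap] using finite_integral_one_add_norm (E := ℝ) (μ := volume) (r := 9 / 8)
    (by norm_num [Module.finrank_self])

theorem lintegral_one_add_sq_rpow_lt_top :
    ∫⁻ x : ℝ, ENNReal.ofReal ((1 + x ^ 2) ^ (-(5 / 8) : ℝ)) < ∞ := by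
  have h := (integrable_rpow_neg_one_add_norm_sq (E := ℝ) (μ := volume) (r := 5 / 4)
    (by norm_num [Module.finrank_self])).lintegral_lt_top
  have e : (-(5 / 4) / 2 : ℝ) = -(5 / 8) := by norm_num
  simpa [e] using h

/-- The constant bounding the convolution square of the reciprocal dispersive weight. -/
def dispConst : ℝ≥0∞ :=
  2 * (2 * ∫⁻ x : ℝ, ENNReal.ofReal (jap x ^ (-(9 / 8) : ℝ)))
    * (2 * ∫⁻ x : ℝ, ENNReal.ofReal ((1 + x ^ 2) ^ (-(5 / 8) : ℝ)))

theorem dispConst_ne_top : dispConst ≠ ∞ := by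
  have h1 := lintegral_jap_rpow_lt_top.ne
  have h2 := lintegral_one_add_sq_rpow_lt_top.ne
  unfold dispConst
  exact ENNReal.mul_ne_top (ENNReal.mul_ne_top (by simp) (ENNReal.mul_ne_top (by simp) h1))
    (ENNReal.mul_ne_top (by simp) h2)

theorem lintegral_jap_quadratic_le (A B : ℝ) :
    ∫⁻ x : ℝ, ENNReal.ofReal (jap (A - 2 * (x - B) ^ 2) ^ (-(5 / 8) : ℝ))
      ≤ 2 * ∫⁻ x : ℝ, ENNReal.ofReal ((1 + x ^ 2) ^ (-(5 / 8) : ℝ)) := by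
  obtain ⟨r, hr⟩ := exists_jap_sub_rpow_le A
  rw [lintegral_sub_right_eq_self
    (fun x => ENNReal.ofReal (jap (A - 2 * x ^ 2) ^ (-(5 / 8) : ℝ))) B]
  calc _ ≤ ∫⁻ y : ℝ, (ENNReal.ofReal ((1 + (y - r) ^ 2) ^ (-(5 / 8) : ℝ))
          + ENNReal.ofReal ((1 + (y + r) ^ 2) ^ (-(5 / 8) : ℝ))) := by
        refine lintegral_mono fun y => ?_
        rw [← ENNReal.ofReal_add (by positivity) (by positivity)]
        exact ENNReal.ofReal_le_ofReal (hr y)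
    _ = _ := by
        rw [lintegral_add_left (by fun_prop),
          lintegral_sub_right_eq_self (fun y => ENNReal.ofReal ((1 + y ^ 2) ^ (-(5 / 8) : ℝ))) r,
          lintegral_add_right_eq_self (fun y => ENNReal.ofReal ((1 + y ^ 2) ^ (-(5 / 8) : ℝ))) r,
          two_mul]

theorem lintegral_dispWeight_inv_le (q : ℝ × ℝ) :
    ∫⁻ p, (dispWeight p)⁻¹ ^ 2 * (dispWeight (q - p))⁻¹ ^ 2 ≤ dispConst := by
  obtain ⟨ξ, τ⟩ := q
  simp only [dispWeight_inv_sq]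
  set I := ∫⁻ x : ℝ, ENNReal.ofReal (jap x ^ (-(9 / 8) : ℝ)) with hI
  have meas : Measurable fun p : ℝ × ℝ => ENNReal.ofReal (jap (p.2 - p.1 ^ 2) ^ (-(7 / 8) : ℝ))
      * ENNReal.ofReal (jap (((ξ, τ) - p).2 - ((ξ, τ) - p).1 ^ 2) ^ (-(7 / 8) : ℝ)) := by
    fun_prop
  rw [Measure.volume_eq_prod, lintegral_prod _ meas.aemeasurable]
  calc _ ≤ ∫⁻ x : ℝ, 2 * (2 * I)
          * ENNReal.ofReal (jap ((τ - ξ ^ 2 / 2) - 2 * (x - ξ / 2) ^ 2) ^ (-(5 / 8) : ℝ)) := by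
        refine lintegral_mono fun x => ?_
        set c := ENNReal.ofReal (jap ((τ - ξ ^ 2 / 2) - 2 * (x - ξ / 2) ^ 2) ^ (-(5 / 8) : ℝ))
          with hc
        calc _ ≤ ∫⁻ t : ℝ, 2 * c * (ENNReal.ofReal (jap (t - x ^ 2) ^ (-(9 / 8) : ℝ))
                + ENNReal.ofReal (jap ((τ - (ξ - x) ^ 2) - t) ^ (-(9 / 8) : ℝ))) := by
              refine lintegral_mono fun t => ?_
              have h := jap_rpow_mul_le (t - x ^ 2) ((τ - t) - (ξ - x) ^ 2)
              have e1 : (t - x ^ 2) + ((τ - t) - (ξ - x) ^ 2)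
                  = (τ - ξ ^ 2 / 2) - 2 * (x - ξ / 2) ^ 2 := by ring
              have e2 : (τ - t) - (ξ - x) ^ 2 = (τ - (ξ - x) ^ 2) - t := by ring
              have n := fun a b => Real.rpow_nonneg (jap_pos a).le b
              rw [e1, e2] at h
              rw [hc, ← ENNReal.ofReal_add (n _ _) (n _ _), show (2 : ℝ≥0∞) = ENNReal.ofReal 2 by simp,
                ← ENNReal.ofReal_mul (p := 2) (by norm_num),
                ← ENNReal.ofReal_mul (p := 2 * _) (mul_nonneg (by norm_num) (n _ _)),
                ← ENNReal.ofReal_mul (n _ _)]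
              refine ENNReal.ofReal_le_ofReal ?_
              simpa only [Prod.mk_sub_mk, Prod.fst_sub, Prod.snd_sub, e2] using h
          _ = 2 * c * (I + I) := by
              rw [lintegral_const_mul _ (by fun_prop), lintegral_add_left (by fun_prop),
                lintegral_sub_right_eq_self
                  (fun t => ENNReal.ofReal (jap t ^ (-(9 / 8) : ℝ))) (x ^ 2),
                lintegral_sub_left_eq_self (fun t => ENNReal.ofReal (jap t ^ (-(9 / 8) : ℝ)))]
          _ = _ := by ring
    _ ≤ _ := by
        rw [lintegral_const_mul _ (by fun_prop),
          dispConst]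
        gcongr
        exact lintegral_jap_quadratic_le _ _

namespace AdmissibleHigh

variable {N s : ℝ} {θ : ℝ → ℝ}

theorem one_le (h : AdmissibleHigh N s θ) (hN : 2 ≤ N) (ξ : ℝ) : 1 ≤ θ ξ := by
  have h0 : θ 0 = 1 := h.eq_one 0 (by simp; linarith)
  rw [← h0]
  exact h.mono 0 ξ (by simp)

theorem eq_high_mul (h : AdmissibleHigh N s θ) (hN : 2 ≤ N) {c : ℝ} (hc : 2 ≤ c) :
    θ (c * N) = c ^ s := by
  rw [h.eq_high (c * N) (by rw [abs_of_nonneg (by positivity)]; gcongr),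
    abs_of_nonneg (by positivity), Real.mul_rpow (by positivity) (by positivity), mul_assoc,
    ← Real.rpow_add (by positivity), add_neg_cancel, Real.rpow_zero, mul_one]

theorem le_two_mul_jap (h : AdmissibleHigh N s θ) (hN : 2 ≤ N) (hs0 : 0 < s) (hs1 : s < 1)
    (ξ : ℝ) : θ ξ ≤ 2 * jap ξ := by
  rcases le_total |ξ| (2 * N) with hξ | hξ
  · have h1 : θ ξ ≤ θ (2 * N) := h.mono _ _ (hξ.trans (le_abs_self _))
    rw [h.eq_high_mul hN le_rfl] at h1
    have h2 : (2 : ℝ) ^ s ≤ 2 ^ (1 : ℝ) :=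
      Real.rpow_le_rpow_of_exponent_le (by norm_num) hs1.le
    rw [Real.rpow_one] at h2
    linarith [one_le_jap ξ]
  · rw [h.eq_high ξ hξ]
    have h1 : |ξ| ^ s ≤ |ξ| ^ (1 : ℝ) :=
      Real.rpow_le_rpow_of_exponent_le (by linarith) hs1.le
    have h2 : N ^ (-s) ≤ 1 := Real.rpow_le_one_of_one_le_of_nonpos (by linarith) (by linarith)
    rw [Real.rpow_one] at h1
    have h3 : |ξ| ^ s * N ^ (-s) ≤ |ξ| * 1 := by gcongr
    unfold jap
    linarith [abs_nonneg ξ]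

theorem comp_two_mul_le (h : AdmissibleHigh N s θ) (hN : 2 ≤ N) (hs0 : 0 < s) (hs1 : s < 1)
    (ξ : ℝ) : θ (2 * ξ) ≤ 4 * θ ξ := by
  have h1 := h.one_le hN ξ
  rcases le_total |ξ| (2 * N) with hξ | hξ
  · have h2 : θ (2 * ξ) ≤ θ (4 * N) := h.mono _ _ (by
      rw [abs_mul, abs_two, abs_of_nonneg (by positivity : (0 : ℝ) ≤ 4 * N)]; linarith)
    rw [h.eq_high_mul hN (by norm_num)] at h2
    have h3 : (4 : ℝ) ^ s ≤ 4 ^ (1 : ℝ) :=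
      Real.rpow_le_rpow_of_exponent_le (by norm_num) hs1.le
    rw [Real.rpow_one] at h3
    linarith
  · have h2 : (2 : ℝ) ^ s ≤ 2 ^ (1 : ℝ) :=
      Real.rpow_le_rpow_of_exponent_le (by norm_num) hs1.le
    rw [Real.rpow_one] at h2
    have h3 : θ (2 * ξ) = 2 ^ s * θ ξ := by
      rw [h.eq_high ξ hξ, h.eq_high (2 * ξ) (by rw [abs_mul, abs_two]; linarith), abs_mul, abs_two,
        Real.mul_rpow (by norm_num) (abs_nonneg _), mul_assoc]
    rw [h3]
    gcongr
    linarith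

theorem add_le (h : AdmissibleHigh N s θ) (hN : 2 ≤ N) (hs0 : 0 < s) (hs1 : s < 1)
    (a b : ℝ) : θ (a + b) ≤ 4 * (θ a * θ b) := by
  have ha := h.one_le hN a
  have hb := h.one_le hN b
  have hab := abs_add_le a b
  rcases le_total |a| |b| with hle | hle
  · have h1 : θ (a + b) ≤ θ (2 * b) := h.mono _ _ (by rw [abs_mul, abs_two]; linarith)
    have h2 := h.comp_two_mul_le hN hs0 hs1 b
    nlinarith
  · have h1 : θ (a + b) ≤ θ (2 * a) := h.mono _ _ (by rw [abs_mul, abs_two]; linarith)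
    have h2 := h.comp_two_mul_le hN hs0 hs1 a
    nlinarith

theorem hasDerivAt (h : AdmissibleHigh N s θ) (ξ : ℝ) : HasDerivAt θ (deriv θ ξ) ξ :=
  (h.smooth.differentiable (by simp)).differentiableAt.hasDerivAt

theorem contDiff_deriv (h : AdmissibleHigh N s θ) : ContDiff ℝ (⊤ : ℕ∞) (deriv θ) :=
  (contDiff_infty_iff_deriv.1 h.smooth).2

theorem abs_deriv_le (h : AdmissibleHigh N s θ) (hN : 2 ≤ N) (ξ : ℝ) :
    |deriv θ ξ| ≤ 5 * θ ξ := by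
  have h1 := h.deriv1 ξ
  have h2 : deriv (fun ζ => θ ζ ^ 2) ξ = 2 * θ ξ * deriv θ ξ := by
    simpa using ((h.hasDerivAt ξ).fun_pow 2).deriv
  have h3 := h.one_le hN ξ
  have h4 : 10 * θ ξ ^ 2 / jap ξ ≤ 10 * θ ξ ^ 2 := div_le_self (by positivity) (one_le_jap ξ)
  rw [h2, abs_mul, abs_of_nonneg (by positivity)] at h1
  have h5 : 2 * θ ξ * |deriv θ ξ| ≤ 2 * θ ξ * (5 * θ ξ) := by linarith
  exact le_of_mul_le_mul_left h5 (by positivity)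

theorem abs_deriv_deriv_le (h : AdmissibleHigh N s θ) (hN : 2 ≤ N) (ξ : ℝ) :
    |deriv (deriv θ) ξ| ≤ 30 * θ ξ := by
  have h1 := h.deriv2 ξ
  have h2 : deriv (fun ζ => θ ζ ^ 2) = fun ζ => 2 * (θ ζ * deriv θ ζ) := by
    ext ζ
    rw [← mul_assoc]
    simpa using ((h.hasDerivAt ζ).fun_pow 2).deriv
  have h0 : HasDerivAt (deriv θ) (deriv (deriv θ) ξ) ξ :=
    (h.contDiff_deriv.differentiable (by simp)).differentiableAt.hasDerivAt
  rw [iteratedDeriv_succ, iteratedDeriv_one, h2, 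
    (((h.hasDerivAt ξ).fun_mul h0).const_mul 2).deriv] at h1
  have h3 := h.one_le hN ξ
  have h4 : 10 * θ ξ ^ 2 / jap ξ ^ 2 ≤ 10 * θ ξ ^ 2 :=
    div_le_self (by positivity) (one_le_pow₀ (one_le_jap ξ))
  have h5 := h.abs_deriv_le hN ξ
  have h6 : deriv θ ξ * deriv θ ξ ≤ 25 * θ ξ ^ 2 := by
    have := mul_le_mul h5 h5 (abs_nonneg _) (by positivity)
    rw [abs_mul_abs_self] at this
    linarith
  have h7 := abs_le.1 (h1.trans h4)
  have h8 : |θ ξ * deriv (deriv θ) ξ| ≤ θ ξ * (30 * θ ξ) := by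
    rw [abs_le]
    constructor <;> nlinarith [mul_self_nonneg (deriv θ ξ)]
  rw [abs_mul, abs_of_nonneg (by positivity)] at h8
  exact le_of_mul_le_mul_left h8 (by positivity)

end AdmissibleHigh

open FourierTransform SchwartzMap

theorem ft_eq_fourier (f : ℝ → ℂ) (ξ : ℝ) : ft f ξ = 𝓕 f (ξ / (2 * π)) := by
  rw [ft, Real.fourier_real_eq_integral_exp_smul]
  congr 1; ext x
  rw [smul_eq_mul]
  congr 2
  push_cast
  field_simp

/-- A twice differentiable function with integrable derivatives has integrable Fourier transform. -/
theorem integrable_fourier_of_contDiff {g : ℝ → ℂ} (hg : ContDiff ℝ 2 g) (h0 : Integrable g)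
    (h1 : Integrable (deriv g)) (h2 : Integrable (deriv (deriv g))) : Integrable (𝓕 g) := by
  have hd : ∀ n : ℕ, (n : ℕ∞) ≤ 2 → Integrable (iteratedDeriv n g) := by
    intro n hn
    have hn' : n ≤ 2 := by exact_mod_cast hn
    interval_cases n
    · simpa using h0
    · simpa using h1
    · simpa [iteratedDeriv_succ] using h2
  have hF := Real.fourier_iteratedDeriv (N := 2) (n := 2) hg hd le_rfl
  have hb : ∀ (f : ℝ → ℂ) (x : ℝ), ‖𝓕 f x‖ ≤ ∫ v, ‖f v‖ := fun f x =>
    VectorFourier.norm_fourierIntegral_le_integral_norm _ _ _ f x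
  have hbound : ∀ x, ‖𝓕 g x‖ ≤ ((∫ v, ‖g v‖) + ∫ v, ‖iteratedDeriv 2 g v‖) * (1 + x ^ 2)⁻¹ := by
    intro x
    rw [← div_eq_mul_inv, le_div_iff₀ (by positivity)]
    have e := hb (iteratedDeriv 2 g) x
    have e0 := hb g x
    rw [hF] at e
    simp only [smul_eq_mul, norm_mul, norm_pow, Complex.norm_real, Complex.norm_I,
      Complex.norm_ofNat, Real.norm_eq_abs, mul_pow, sq_abs] at e
    have hpi : 1 ≤ 2 ^ 2 * π ^ 2 := by nlinarith [Real.pi_gt_three]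
    have : x ^ 2 * ‖𝓕 g x‖ ≤ 2 ^ 2 * π ^ 2 * x ^ 2 * ‖𝓕 g x‖ := by
      have : 0 ≤ x ^ 2 * ‖𝓕 g x‖ := by positivity
      nlinarith
    linarith
  refine (integrable_inv_one_add_sq.const_mul _).mono' ?_ (Filter.Eventually.of_forall hbound)
  exact (VectorFourier.fourierIntegral_continuous Real.continuous_fourierChar
    (by exact continuous_inner) h0).aestronglyMeasurable

theorem integrable_mul_schwartz {φ : ℝ → ℝ} (hφ : Continuous φ) {C : ℝ}
    (hC : ∀ x, |φ x| ≤ C * (1 + |x|)) (h : 𝓢(ℝ, ℂ)) : Integrable fun x => (φ x : ℂ) * h x := by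
  have hi : Integrable fun x => C * (‖h x‖ + ‖x‖ ^ 1 * ‖h x‖) :=
    ((h.integrable (μ := volume)).norm.add (h.integrable_pow_mul volume 1)).const_mul C
  refine hi.mono' (by fun_prop) (Filter.Eventually.of_forall fun x => ?_)
  rw [norm_mul, Complex.norm_real, Real.norm_eq_abs, pow_one, Real.norm_eq_abs]
  have := mul_le_mul_of_nonneg_right (hC x) (norm_nonneg (h x))
  linarith

theorem integrable_fourier_mul_schwartz {φ : ℝ → ℝ} (hφ : ContDiff ℝ 2 φ) {C : ℝ}
    (h0 : ∀ x, |φ x| ≤ C * (1 + |x|)) (h1 : ∀ x, |deriv φ x| ≤ C * (1 + |x|))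
    (h2 : ∀ x, |deriv (deriv φ) x| ≤ C * (1 + |x|)) (h : 𝓢(ℝ, ℂ)) :
    Integrable (𝓕 fun x => (φ x : ℂ) * h x) := by
  have hφ1 : ContDiff ℝ 1 (deriv φ) := by
    have := (contDiff_succ_iff_deriv (n := 1)).1 (by simpa [one_add_one_eq_two] using hφ)
    exact this.2.2
  have hφ2 : Continuous (deriv (deriv φ)) := hφ1.continuous_deriv_one
  have dφ : ∀ x, HasDerivAt (fun x => (φ x : ℂ)) ((deriv φ x : ℝ) : ℂ) x := fun x =>
    ((hφ.differentiable (by simp)).differentiableAt.hasDerivAt).ofReal_comp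
  have dφ1 : ∀ x, HasDerivAt (fun x => ((deriv φ x : ℝ) : ℂ))
      ((deriv (deriv φ) x : ℝ) : ℂ) x := fun x =>
    ((hφ1.differentiable (by simp)).differentiableAt.hasDerivAt).ofReal_comp
  have dS : ∀ (k : 𝓢(ℝ, ℂ)) x, HasDerivAt k (derivCLM ℝ ℂ k x) x := fun k x => by
    simpa using k.differentiableAt.hasDerivAt
  set h' := derivCLM ℝ ℂ h
  set h'' := derivCLM ℝ ℂ h'
  have e1 : deriv (fun x => (φ x : ℂ) * h x) = fun x =>
      ((deriv φ x : ℝ) : ℂ) * h x + φ x * h' x := by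
    ext x
    exact ((dφ x).mul (dS h x)).deriv
  have e2 : deriv (deriv (fun x => (φ x : ℂ) * h x)) = fun x =>
      (((deriv (deriv φ) x : ℝ) : ℂ) * h x + ((deriv φ x : ℝ) : ℂ) * h' x) +
        (((deriv φ x : ℝ) : ℂ) * h' x + φ x * h'' x) := by
    rw [e1]
    ext x
    exact (((dφ1 x).mul (dS h x)).add ((dφ x).mul (dS h' x))).deriv
  have c0 := hφ.continuous
  have c1 := hφ1.continuous
  refine integrable_fourier_of_contDiff ?_ (integrable_mul_schwartz c0 h0 h) ?_ ?_
  · exact (Complex.ofRealCLM.contDiff.comp hφ).mul (h.smooth 2)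
  · rw [e1]
    exact (integrable_mul_schwartz c1 h1 h).add (integrable_mul_schwartz c0 h0 h')
  · rw [e2]
    exact ((integrable_mul_schwartz hφ2 h2 h).add (integrable_mul_schwartz c1 h1 h')).add
      ((integrable_mul_schwartz c1 h1 h').add (integrable_mul_schwartz c0 h0 h''))

theorem AdmissibleHigh.ft_mult {N s : ℝ} {θ : ℝ → ℝ} (h : AdmissibleHigh N s θ) (hN : 2 ≤ N)
    (hs0 : 0 < s) (hs1 : s < 1) (f : 𝓢(ℝ, ℂ)) (ξ : ℝ) :
    ft (mult θ f) ξ = θ ξ * ft f ξ := by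
  have hpi : 0 < 2 * π := by positivity
  set φ : ℝ → ℝ := fun x => θ (2 * π * x) with hφ
  have hb : ∀ x, θ (2 * π * x) ≤ 4 * π * (1 + |x|) := fun x => by
    refine (h.le_two_mul_jap hN hs0 hs1 _).trans ?_
    rw [jap, abs_mul, abs_of_pos hpi]
    nlinarith [Real.pi_gt_three, abs_nonneg x]
  have hpos : ∀ x, 0 ≤ θ x := fun x => by linarith [h.one_le hN x]
  have d1 : deriv φ = fun x => 2 * π * deriv θ (2 * π * x) := by
    ext x
    simpa [hφ] using deriv_comp_mul_left (2 * π) θ x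
  have d2 : deriv (deriv φ) = fun x => 2 * π * (2 * π * deriv (deriv θ) (2 * π * x)) := by
    rw [d1]
    ext x
    rw [deriv_const_mul_field, deriv_comp_mul_left (2 * π) (deriv θ) x, smul_eq_mul]
  set C : ℝ := 2 * π * (2 * π * (30 * (4 * π))) with hC
  have hC0 : 4 * π ≤ C := by
    have := Real.pi_gt_three
    have : 1 ≤ π * π := by nlinarith
    rw [hC]
    nlinarith
  have hC1 : 2 * π * (5 * (4 * π)) ≤ C := by
    have := Real.pi_gt_three
    have : 0 ≤ π * π := by positivity
    rw [hC]
    nlinarith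
  have b0 : ∀ x, |φ x| ≤ C * (1 + |x|) := fun x => by
    rw [abs_of_nonneg (hpos _)]
    exact (hb x).trans (by gcongr)
  have b1 : ∀ x, |deriv φ x| ≤ C * (1 + |x|) := fun x => by
    rw [d1, abs_mul, abs_of_pos hpi]
    calc _ ≤ 2 * π * (5 * (4 * π * (1 + |x|))) := by
          gcongr
          exact (h.abs_deriv_le hN _).trans (by linarith [hb x])
      _ = 2 * π * (5 * (4 * π)) * (1 + |x|) := by ring
      _ ≤ _ := by gcongr
  have b2 : ∀ x, |deriv (deriv φ) x| ≤ C * (1 + |x|) := fun x => by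
    rw [d2, abs_mul (2 * π), abs_mul (2 * π), abs_of_pos hpi]
    calc _ ≤ 2 * π * (2 * π * (30 * (4 * π * (1 + |x|)))) := by
          gcongr
          exact (h.abs_deriv_deriv_le hN _).trans (by linarith [hb x])
      _ = _ := by rw [hC]; ring
  have cφ : ContDiff ℝ 2 φ :=
    (contDiff_infty.1 h.smooth 2).comp (contDiff_const.mul contDiff_id)
  set g : ℝ → ℂ := fun x => (φ x : ℂ) * (𝓕 f) x with hg
  have gi : Integrable g := integrable_mul_schwartz cφ.continuous b0 _
  have gF : Integrable (𝓕 g) := integrable_fourier_mul_schwartz cφ b0 b1 b2 _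
  have gc : Continuous g := by
    have := cφ.continuous
    fun_prop
  have e : mult θ f = 𝓕⁻ g := by
    ext x
    rw [mult, Real.fourierInv_eq']
    have := Measure.integral_comp_mul_left
      (fun ξ => Complex.exp (Complex.I * x * ξ) * (θ ξ : ℂ) * ft f ξ) (2 * π)
    rw [abs_of_pos (by positivity)] at this
    rw [← this]
    congr 1; ext y
    rw [ft_eq_fourier, hg, smul_eq_mul, fourier_coe, mul_div_cancel_left₀ _ hpi.ne', hφ]
    simp only [mul_assoc]
    congr 2
    simp
    ring
  rw [ft_eq_fourier, ft_eq_fourier, e, gc.fourier_fourierInv_eq gi gF, hg, hφ, fourier_coe]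
  simp only
  rw [mul_div_cancel₀ _ hpi.ne']

/-- The slice of a spacetime Schwartz function at a fixed time. -/
def timeSlice (g : 𝓢(ℝ × ℝ, ℂ)) (t : ℝ) : 𝓢(ℝ, ℂ) :=
  SchwartzMap.compCLM ℂ (g := ⇑(ContinuousLinearMap.inl ℝ ℝ ℝ) + fun _ : ℝ => ((0 : ℝ), t))
    ((ContinuousLinearMap.inl ℝ ℝ ℝ).hasTemperateGrowth.add (.const (0, t)))
    ⟨1, 1, fun x => by
      have : ‖x‖ ≤ ‖(x, t)‖ := norm_fst_le (x, t)
      simp only [Pi.add_apply, ContinuousLinearMap.inl_apply, Prod.mk_add_mk, add_zero, zero_add]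
      linarith⟩ g

@[simp]
theorem timeSlice_apply (g : 𝓢(ℝ × ℝ, ℂ)) (t x : ℝ) : timeSlice g t x = g (x, t) := by
  simp [timeSlice]

theorem stft_eq_integral_ft (u : ℝ → ℝ → ℂ) (ξ τ : ℝ) :
    stft u ξ τ = ∫ t : ℝ, Complex.exp (-Complex.I * (t * τ)) * ft (fun x => u x t) ξ := by
  rw [stft]
  congr 1; ext t
  rw [ft, ← integral_const_mul]
  congr 1; ext x
  rw [← mul_assoc, ← Complex.exp_add]
  congr 2
  ring

theorem AdmissibleHigh.stft_multX {N s : ℝ} {θ : ℝ → ℝ} (h : AdmissibleHigh N s θ) (hN : 2 ≤ N)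
    (hs0 : 0 < s) (hs1 : s < 1) (g : 𝓢(ℝ × ℝ, ℂ)) (ξ τ : ℝ) :
    stft (multX θ fun x t => g (x, t)) ξ τ = θ ξ * stft (fun x t => g (x, t)) ξ τ := by
  rw [stft_eq_integral_ft, stft_eq_integral_ft, ← integral_const_mul]
  congr 1; ext t
  have := h.ft_mult hN hs0 hs1 (timeSlice g t) ξ
  rw [show ⇑(timeSlice g t) = fun x => g (x, t) from funext (timeSlice_apply g t)] at this
  change _ * ft (mult θ fun y => g (y, t)) ξ = _
  rw [this]
  ring

/-- A Schwartz function on `ℝ × ℝ` transported to the Euclidean plane. -/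
def euclideanLift (g : 𝓢(ℝ × ℝ, ℂ)) : 𝓢(WithLp 2 (ℝ × ℝ), ℂ) :=
  SchwartzMap.compCLMOfContinuousLinearEquiv ℂ (WithLp.prodContinuousLinearEquiv 2 ℝ ℝ ℝ) g

@[simp]
theorem euclideanLift_apply (g : 𝓢(ℝ × ℝ, ℂ)) (p : WithLp 2 (ℝ × ℝ)) :
    euclideanLift g p = g p.ofLp := rfl

theorem stft_eq_fourier (g : 𝓢(ℝ × ℝ, ℂ)) (p : ℝ × ℝ) :
    stft (fun x t => g (x, t)) p.1 p.2 =
      𝓕 (euclideanLift g) (WithLp.toLp 2 ((2 * π)⁻¹ • p)) := by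
  have hi : Integrable fun z : ℝ × ℝ =>
      Complex.exp (-Complex.I * (z.1 * p.1 + z.2 * p.2)) * g z := by
    refine (g.integrable (μ := volume)).bdd_mul (c := 1) (by fun_prop) ?_
    refine Filter.Eventually.of_forall fun z => ?_
    rw [Complex.norm_exp]
    simp
  rw [fourier_coe, Real.fourier_eq', stft,
    ← (WithLp.volume_preserving_toLp ℝ ℝ).integral_comp
      (WithLp.prodContinuousLinearEquiv 2 ℝ ℝ ℝ).symm.toHomeomorph.measurableEmbedding,
    Measure.volume_eq_prod, integral_prod_symm]
  · congr 1; ext t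
    congr 1; ext x
    rw [smul_eq_mul, WithLp.prod_inner_apply]
    congr 2
    simp
    field_simp
  · rw [← Measure.volume_eq_prod]
    refine hi.congr (Filter.Eventually.of_forall fun z => ?_)
    simp only
    rw [smul_eq_mul, WithLp.prod_inner_apply]
    congr 2
    simp
    field_simp

theorem exists_schwartzMap_eq_stft (g : 𝓢(ℝ × ℝ, ℂ)) :
    ∃ Φ : 𝓢(ℝ × ℝ, ℂ), ∀ p : ℝ × ℝ, stft (fun x t => g (x, t)) p.1 p.2 = Φ p := by
  have hpi : (2 * π)⁻¹ ≠ 0 := by positivity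
  refine ⟨SchwartzMap.compCLMOfContinuousLinearEquiv ℂ
    ((ContinuousLinearEquiv.smulLeft (Units.mk0 _ hpi)).trans
      (WithLp.prodContinuousLinearEquiv 2 ℝ ℝ ℝ).symm) (𝓕 (euclideanLift g)), fun p => ?_⟩
  rw [stft_eq_fourier]
  rfl

theorem fourier_mul_eq_integral {E : Type*} [NormedAddCommGroup E] [InnerProductSpace ℝ E]
    [FiniteDimensional ℝ E] [MeasurableSpace E] [BorelSpace E] (a b : 𝓢(E, ℂ)) (x : E) :
    𝓕 (pairing (ContinuousLinearMap.mul ℂ ℂ) a b) x = ∫ t, 𝓕 a t * 𝓕 b (x - t) := by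
  have h := SchwartzMap.convolution_apply (ContinuousLinearMap.mul ℂ ℂ) (𝓕⁻ a) (𝓕⁻ b) (-x)
  have h2 := SchwartzMap.fourier_convolution (ContinuousLinearMap.mul ℂ ℂ) (𝓕⁻ a) (𝓕⁻ b)
  rw [fourier_fourierInv_eq, fourier_fourierInv_eq] at h2
  have hneg : ∀ (f : 𝓢(E, ℂ)) (y : E), (𝓕⁻ f) y = 𝓕 f (-y) := fun f y => by
    rw [fourierInv_coe, fourier_coe, Real.fourierInv_eq_fourier_neg]
  have h3 : 𝓕⁻ (pairing (ContinuousLinearMap.mul ℂ ℂ) a b) (-x) =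
      𝓕 (pairing (ContinuousLinearMap.mul ℂ ℂ) a b) x := by rw [hneg, neg_neg]
  rw [← h3, ← h2, fourierInv_fourier_eq, h, MeasureTheory.convolution,
    ← integral_neg_eq_self]
  congr 1; ext t
  simp only [ContinuousLinearMap.mul_apply', hneg]
  congr 2 <;> abel_nf

theorem enorm_stft_mul_le (a b : 𝓢(ℝ × ℝ, ℂ)) (q : ℝ × ℝ) :
    ‖stft (fun x t => a (x, t) * b (x, t)) q.1 q.2‖ₑ ≤
      ∫⁻ p : ℝ × ℝ, ‖stft (fun x t => a (x, t)) p.1 p.2‖ₑ *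
        ‖stft (fun x t => b (x, t)) (q - p).1 (q - p).2‖ₑ := by
  have hpi := Real.pi_gt_three
  have e : stft (fun x t => a (x, t) * b (x, t)) q.1 q.2 =
      |((2 * π) ^ 2)⁻¹| • ∫ p : ℝ × ℝ, stft (fun x t => a (x, t)) p.1 p.2 *
        stft (fun x t => b (x, t)) (q - p).1 (q - p).2 := by
    have e0 := stft_eq_fourier (pairing (ContinuousLinearMap.mul ℂ ℂ) a b) q
    have e1 : euclideanLift (pairing (ContinuousLinearMap.mul ℂ ℂ) a b) =
      pairing (ContinuousLinearMap.mul ℂ ℂ) (euclideanLift a) (euclideanLift b) := by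
      ext z; rfl
    rw [e1, fourier_mul_eq_integral, ← (WithLp.volume_preserving_toLp ℝ ℝ).integral_comp
      (WithLp.prodContinuousLinearEquiv 2 ℝ ℝ ℝ).symm.toHomeomorph.measurableEmbedding] at e0
    have e2 := Measure.integral_comp_smul (volume : Measure (ℝ × ℝ)) (fun p =>
      stft (fun x t => a (x, t)) p.1 p.2 * stft (fun x t => b (x, t)) (q - p).1 (q - p).2) (2 * π)
    rw [Module.finrank_prod, Module.finrank_self] at e2
    refine e0.trans (Eq.trans ?_ e2)
    congr 1; ext p
    rw [stft_eq_fourier, stft_eq_fourier, smul_sub, smul_smul,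
      inv_mul_cancel₀ (by positivity), one_smul, WithLp.toLp_sub]
  rw [e]
  refine (enorm_smul_le).trans ?_
  refine (mul_le_of_le_one_left' ?_).trans ((enorm_integral_le_lintegral_enorm _).trans_eq ?_)
  · rw [← ofReal_norm, norm_abs_eq_norm, Real.norm_of_nonneg (by positivity)]
    refine ENNReal.ofReal_le_one.2 (inv_le_one_of_one_le₀ ?_)
    nlinarith
  · simp only [enorm_mul]

/-- The complex conjugate of a spacetime Schwartz function. -/
def conjSchwartz (g : 𝓢(ℝ × ℝ, ℂ)) : 𝓢(ℝ × ℝ, ℂ) :=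
  SchwartzMap.postcompCLM (𝕜 := ℝ) (Complex.conjCLE : ℂ →L[ℝ] ℂ) g

theorem conjSchwartz_apply (g : 𝓢(ℝ × ℝ, ℂ)) (p : ℝ × ℝ) :
    conjSchwartz g p = (starRingEnd ℂ) (g p) := rfl

theorem enorm_stft_conj (u : ℝ → ℝ → ℂ) (ξ τ : ℝ) :
    ‖stft (fun x t => (starRingEnd ℂ) (u x t)) ξ τ‖ₑ = ‖stft u (-ξ) (-τ)‖ₑ := by
  have : stft (fun x t => (starRingEnd ℂ) (u x t)) ξ τ = (starRingEnd ℂ) (stft u (-ξ) (-τ)) := by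
    simp only [stft, ← integral_conj, map_mul, ← Complex.exp_conj]
    congr 1; ext t
    congr 1; ext x
    congr 2
    simp
    ring
  rw [this, RCLike.enorm_conj]

/-- The size of the spacetime Fourier transform of `u`, weighted by the symbol `θ`. -/
def symbolSpectrum (θ : ℝ → ℝ) (u : ℝ → ℝ → ℂ) (p : ℝ × ℝ) : ℝ≥0∞ :=
  ENNReal.ofReal (θ p.1) * ‖stft u p.1 p.2‖ₑ

/-- The square of the `X^{0,b}` norm of a function whose spacetime Fourier transform has size
`F`, as an extended nonnegative real. -/
def dispEnergy (b : ℝ) (F : ℝ × ℝ → ℝ≥0∞) : ℝ≥0∞ :=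
  ∫⁻ p : ℝ × ℝ, ENNReal.ofReal (jap (p.2 - p.1 ^ 2) ^ (2 * b)) * F p ^ 2

theorem jap_sub_sq_le (p : ℝ × ℝ) : jap (p.2 - p.1 ^ 2) ≤ (1 + ‖p‖) ^ 2 := by
  have h1 : |p.1| ≤ ‖p‖ := norm_fst_le p
  have h2 : |p.2| ≤ ‖p‖ := norm_snd_le p
  have h3 := abs_sub p.2 (p.1 ^ 2)
  rw [abs_pow] at h3
  unfold jap
  nlinarith [abs_nonneg p.1]

namespace AdmissibleHigh

variable {N s : ℝ} {θ : ℝ → ℝ}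

theorem integrable_dispEnergy (h : AdmissibleHigh N s θ) (hN : 2 ≤ N) (hs0 : 0 < s) (hs1 : s < 1)
    {b : ℝ} (hb : b ≤ 1) (Φ : 𝓢(ℝ × ℝ, ℂ)) :
    Integrable fun p : ℝ × ℝ => jap (p.2 - p.1 ^ 2) ^ (2 * b) * (θ p.1 * ‖Φ p‖) ^ 2 := by
  obtain ⟨C, hC⟩ : ∃ C : ℝ, ∀ p, (1 + ‖p‖) ^ 6 * ‖Φ p‖ ≤ C :=
    ⟨_, fun p => by
      simpa using SchwartzMap.one_add_le_sup_seminorm_apply (𝕜 := ℂ) (m := (6, 0)) le_rfl le_rfl Φ p⟩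
  have hθ := h.smooth.continuous
  have hj : Continuous fun p : ℝ × ℝ => jap (p.2 - p.1 ^ 2) ^ (2 * b) :=
    (continuous_jap_rpow (2 * b)).comp (by fun_prop)
  refine ((Φ.integrable (μ := volume)).norm.const_mul (4 * C)).mono' (by fun_prop)
    (Filter.Eventually.of_forall fun p => ?_)
  have h1 : jap (p.2 - p.1 ^ 2) ^ (2 * b) ≤ ((1 + ‖p‖) ^ 2) ^ 2 := by
    refine (Real.rpow_le_rpow_of_exponent_le (one_le_jap _) (by linarith : 2 * b ≤ 2)).trans ?_
    rw [Real.rpow_two]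
    have := jap_pos (p.2 - p.1 ^ 2)
    gcongr
    exact jap_sub_sq_le p
  have h2 : θ p.1 ≤ 2 * (1 + ‖p‖) := by
    refine (h.le_two_mul_jap hN hs0 hs1 _).trans ?_
    unfold jap
    gcongr
    exact norm_fst_le p
  have h3 : 0 ≤ θ p.1 := by linarith [h.one_le hN p.1]
  have h4 : 0 ≤ jap (p.2 - p.1 ^ 2) ^ (2 * b) := Real.rpow_nonneg (jap_pos _).le _
  rw [Real.norm_of_nonneg (by positivity)]
  calc _ ≤ ((1 + ‖p‖) ^ 2) ^ 2 * (2 * (1 + ‖p‖) * ‖Φ p‖) ^ 2 := by gcongr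
    _ = 4 * ((1 + ‖p‖) ^ 6 * ‖Φ p‖) * ‖Φ p‖ := by ring
    _ ≤ 4 * C * ‖Φ p‖ := by
      gcongr
      exact hC p

theorem dispEnergy_ne_top_and_XsbNorm_eq (h : AdmissibleHigh N s θ) (hN : 2 ≤ N) (hs0 : 0 < s)
    (hs1 : s < 1) {b : ℝ} (hb : b ≤ 1) {u : ℝ → ℝ → ℂ} (hu : IsSchwartz2 u) :
    dispEnergy b (symbolSpectrum θ u) ≠ ∞ ∧
      XsbNorm 0 b (multX θ u) =
        (dispEnergy b (symbolSpectrum θ u)).toReal ^ ((1 : ℝ) / 2) := by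
  obtain ⟨g, hg⟩ := hu
  obtain rfl : u = fun x t => g (x, t) := by ext x t; exact hg x t
  obtain ⟨Φ, hΦ⟩ := exists_schwartzMap_eq_stft g
  have hi := h.integrable_dispEnergy hN hs0 hs1 hb Φ
  have hpos : ∀ ξ, 0 ≤ θ ξ := fun ξ => by linarith [h.one_le hN ξ]
  have hj : ∀ p : ℝ × ℝ, 0 ≤ jap (p.2 - p.1 ^ 2) ^ (2 * b) := fun p =>
    Real.rpow_nonneg (jap_pos _).le _
  have e1 : dispEnergy b (symbolSpectrum θ fun x t => g (x, t)) =
      ENNReal.ofReal (∫ p : ℝ × ℝ, jap (p.2 - p.1 ^ 2) ^ (2 * b) * (θ p.1 * ‖Φ p‖) ^ 2) := by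
    rw [ofReal_integral_eq_lintegral_ofReal hi
      (Filter.Eventually.of_forall fun p => mul_nonneg (hj p) (sq_nonneg _))]
    refine lintegral_congr fun p => ?_
    rw [symbolSpectrum, hΦ p, ENNReal.ofReal_mul (hj p),
      ENNReal.ofReal_pow (mul_nonneg (hpos _) (norm_nonneg _)), ENNReal.ofReal_mul (hpos _),
      ofReal_norm]
  refine ⟨by rw [e1]; exact ENNReal.ofReal_ne_top, ?_⟩
  rw [e1, ENNReal.toReal_ofReal
    (integral_nonneg fun p => mul_nonneg (hj p) (sq_nonneg _)), XsbNorm,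
    Measure.volume_eq_prod, integral_prod _ (by simpa [Measure.volume_eq_prod] using hi)]
  congr 2; ext ξ
  congr 1; ext τ
  rw [h.stft_multX hN hs0 hs1, hΦ (ξ, τ), norm_mul, Complex.norm_real,
    Real.norm_of_nonneg (hpos ξ), mul_zero, Real.rpow_zero, one_mul]

theorem measurable_symbolSpectrum (h : AdmissibleHigh N s θ) {u : ℝ → ℝ → ℂ}
    (hu : IsSchwartz2 u) : Measurable (symbolSpectrum θ u) := by
  obtain ⟨g, hg⟩ := hu
  obtain rfl : u = fun x t => g (x, t) := by ext x t; exact hg x t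
  obtain ⟨Φ, hΦ⟩ := exists_schwartzMap_eq_stft g
  have hθ := h.smooth.continuous.measurable
  have hc : Measurable Φ := Φ.continuous.measurable
  unfold symbolSpectrum
  simp only [hΦ]
  fun_prop

theorem symbolSpectrum_trilinear_le (h : AdmissibleHigh N s θ) (hN : 2 ≤ N) (hs0 : 0 < s)
    (hs1 : s < 1) {u₁ u₂ u₃ : ℝ → ℝ → ℂ} (hu₁ : IsSchwartz2 u₁) (hu₂ : IsSchwartz2 u₂)
    (hu₃ : IsSchwartz2 u₃) (q : ℝ × ℝ) :
    symbolSpectrum θ (fun x t => u₁ x t * (starRingEnd ℂ) (u₂ x t) * u₃ x t) q ≤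
      16 * ∫⁻ p, (∫⁻ r, symbolSpectrum θ u₁ r * symbolSpectrum θ u₃ (p - r)) *
        symbolSpectrum θ u₂ (p - q) := by
  obtain ⟨g₁, hg₁⟩ := hu₁
  obtain ⟨g₂, hg₂⟩ := hu₂
  obtain ⟨g₃, hg₃⟩ := hu₃
  obtain rfl : u₁ = fun x t => g₁ (x, t) := by ext x t; exact hg₁ x t
  obtain rfl : u₂ = fun x t => g₂ (x, t) := by ext x t; exact hg₂ x t
  obtain rfl : u₃ = fun x t => g₃ (x, t) := by ext x t; exact hg₃ x t
  have hpos : ∀ ξ, 0 ≤ θ ξ := fun ξ => by linarith [h.one_le hN ξ]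
  have e1 := enorm_stft_mul_le (pairing (ContinuousLinearMap.mul ℂ ℂ) g₁ g₃) (conjSchwartz g₂) q
  have e2 := enorm_stft_mul_le g₁ g₃
  have hadd : ∀ a b, ENNReal.ofReal (θ (a + b)) ≤
      4 * (ENNReal.ofReal (θ a) * ENNReal.ofReal (θ b)) := fun a b => by
    rw [← ENNReal.ofReal_mul (hpos a), ← ENNReal.ofReal_ofNat 4,
      ← ENNReal.ofReal_mul (by norm_num)]
    exact ENNReal.ofReal_le_ofReal (h.add_le hN hs0 hs1 a b)
  have hsub : ∀ a b, ENNReal.ofReal (θ (a - b)) ≤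
      4 * (ENNReal.ofReal (θ a) * ENNReal.ofReal (θ b)) := fun a b => by
    rw [sub_eq_add_neg, ← h.even b]
    exact hadd a (-b)
  have e3 : ∀ p : ℝ × ℝ, ENNReal.ofReal (θ p.1) *
      ‖stft (fun x t => g₁ (x, t) * g₃ (x, t)) p.1 p.2‖ₑ ≤
      4 * ∫⁻ r, symbolSpectrum θ (fun x t => g₁ (x, t)) r *
        symbolSpectrum θ (fun x t => g₃ (x, t)) (p - r) := fun p => by
    refine (mul_le_mul_right (e2 p) _).trans ?_
    rw [← lintegral_const_mul' _ _ ENNReal.ofReal_ne_top,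
      ← lintegral_const_mul' _ _ (by norm_num)]
    refine lintegral_mono fun r => ?_
    have := hadd r.1 (p - r).1
    rw [Prod.fst_sub, add_sub_cancel] at this
    refine (mul_le_mul_left this _).trans_eq ?_
    simp only [symbolSpectrum, Prod.fst_sub]
    ring
  have e4 : (fun x t => g₁ (x, t) * (starRingEnd ℂ) (g₂ (x, t)) * g₃ (x, t)) = fun x t =>
      pairing (ContinuousLinearMap.mul ℂ ℂ) g₁ g₃ (x, t) * conjSchwartz g₂ (x, t) := by
    ext x t
    rw [conjSchwartz_apply, mul_right_comm]
    rfl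
  rw [e4, symbolSpectrum]
  refine (mul_le_mul_right e1 _).trans ?_
  rw [← lintegral_const_mul' _ _ ENNReal.ofReal_ne_top,
    ← lintegral_const_mul' _ _ (by norm_num)]
  refine lintegral_mono fun p => ?_
  have h5 : ‖stft (fun x t => conjSchwartz g₂ (x, t)) (q - p).1 (q - p).2‖ₑ =
      ‖stft (fun x t => g₂ (x, t)) (p - q).1 (p - q).2‖ₑ := by
    simp only [conjSchwartz_apply]
    rw [enorm_stft_conj, ← Prod.fst_neg, ← Prod.snd_neg, neg_sub]
  have h6 := hsub p.1 (p - q).1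
  rw [Prod.fst_sub, sub_sub_cancel] at h6
  rw [h5]
  calc _ ≤ 4 * (ENNReal.ofReal (θ p.1) * ENNReal.ofReal (θ (p.1 - q.1))) * _ :=
        mul_le_mul_left h6 _
    _ = 4 * (ENNReal.ofReal (θ p.1) * ‖stft (fun x t => g₁ (x, t) * g₃ (x, t)) p.1 p.2‖ₑ) *
          symbolSpectrum θ (fun x t => g₂ (x, t)) (p - q) := by
        rw [symbolSpectrum, Prod.fst_sub]
        simp only [SchwartzMap.pairing_apply_apply, ContinuousLinearMap.mul_apply']
        ring
    _ ≤ 4 * (4 * ∫⁻ r, symbolSpectrum θ (fun x t => g₁ (x, t)) r *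
          symbolSpectrum θ (fun x t => g₃ (x, t)) (p - r)) *
          symbolSpectrum θ (fun x t => g₂ (x, t)) (p - q) :=
        mul_le_mul_left (mul_le_mul_right (e3 p) _) _
    _ = _ := by ring

end AdmissibleHigh

theorem IsSchwartz2.mul_conj_mul {u₁ u₂ u₃ : ℝ → ℝ → ℂ} (hu₁ : IsSchwartz2 u₁)
    (hu₂ : IsSchwartz2 u₂) (hu₃ : IsSchwartz2 u₃) :
    IsSchwartz2 fun x t => u₁ x t * (starRingEnd ℂ) (u₂ x t) * u₃ x t := by
  obtain ⟨g₁, hg₁⟩ := hu₁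
  obtain ⟨g₂, hg₂⟩ := hu₂
  obtain ⟨g₃, hg₃⟩ := hu₃
  refine ⟨pairing (ContinuousLinearMap.mul ℂ ℂ)
    (pairing (ContinuousLinearMap.mul ℂ ℂ) g₁ (conjSchwartz g₂)) g₃, fun x t => ?_⟩
  simp only [hg₁, hg₂, hg₃, ← conjSchwartz_apply]
  rfl

theorem lintegral_dispWeight_sq_le_dispEnergy {b : ℝ} (hb : 7 / 16 ≤ b) (F : ℝ × ℝ → ℝ≥0∞) :
    ∫⁻ p, dispWeight p ^ 2 * F p ^ 2 ≤ dispEnergy b F := by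
  refine lintegral_mono fun p => ?_
  simp only [dispWeight_sq]
  gcongr
  · exact one_le_jap _
  · linarith

theorem dispWeight_sq_mul_sq_le {b : ℝ} (hb : b ≤ -(7 / 16)) (F : ℝ × ℝ → ℝ≥0∞) (p : ℝ × ℝ) :
    dispWeight p ^ 2 * (ENNReal.ofReal (jap (p.2 - p.1 ^ 2) ^ (2 * b)) * F p) ^ 2 ≤
      ENNReal.ofReal (jap (p.2 - p.1 ^ 2) ^ (2 * b)) * F p ^ 2 := by
  have h1 : dispWeight p ^ 2 * ENNReal.ofReal (jap (p.2 - p.1 ^ 2) ^ (2 * b)) ≤ 1 := by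
    rw [dispWeight_sq, ← ENNReal.ofReal_mul (Real.rpow_nonneg (jap_pos _).le _),
      ← Real.rpow_add (jap_pos _)]
    exact ENNReal.ofReal_le_one.2
      (Real.rpow_le_one_of_one_le_of_nonpos (one_le_jap _) (by linarith))
  calc _ = dispWeight p ^ 2 * ENNReal.ofReal (jap (p.2 - p.1 ^ 2) ^ (2 * b)) *
        (ENNReal.ofReal (jap (p.2 - p.1 ^ 2) ^ (2 * b)) * F p ^ 2) := by ring
    _ ≤ _ := mul_le_of_le_one_left' h1

theorem AdmissibleHigh.dispEnergy_trilinear_le {N s : ℝ} {θ : ℝ → ℝ} (h : AdmissibleHigh N s θ)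
    (hN : 2 ≤ N) (hs0 : 0 < s) (hs1 : s < 1) {b b' : ℝ} (hb : b ≤ -(7 / 16)) (hb' : 7 / 16 ≤ b')
    {u₁ u₂ u₃ : ℝ → ℝ → ℂ} (hu₁ : IsSchwartz2 u₁) (hu₂ : IsSchwartz2 u₂) (hu₃ : IsSchwartz2 u₃) :
    dispEnergy b (symbolSpectrum θ fun x t => u₁ x t * (starRingEnd ℂ) (u₂ x t) * u₃ x t) ≤
      (16 * dispConst) ^ 2 * (dispEnergy b' (symbolSpectrum θ u₁) *
        dispEnergy b' (symbolSpectrum θ u₂) * dispEnergy b' (symbolSpectrum θ u₃)) := by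
  have hu := hu₁.mul_conj_mul hu₂ hu₃
  set G := symbolSpectrum θ fun x t => u₁ x t * (starRingEnd ℂ) (u₂ x t) * u₃ x t with hG
  set w : ℝ × ℝ → ℝ≥0∞ := fun p => ENNReal.ofReal (jap (p.2 - p.1 ^ 2) ^ (2 * b)) with hw
  have hwm : Measurable w := by fun_prop
  have hGm : Measurable G := h.measurable_symbolSpectrum hu
  have hfin : dispEnergy b G ≠ ∞ :=
    (h.dispEnergy_ne_top_and_XsbNorm_eq hN hs0 hs1 (by linarith) hu).1
  have hle : dispEnergy b G ≤ 16 * ∫⁻ q, (w q * G q) *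
      ∫⁻ p, (∫⁻ r, symbolSpectrum θ u₁ r * symbolSpectrum θ u₃ (p - r)) *
        symbolSpectrum θ u₂ (p - q) := by
    rw [← lintegral_const_mul' _ _ (by norm_num)]
    refine lintegral_mono fun q => ?_
    calc w q * G q ^ 2 = (w q * G q) * G q := by ring
      _ ≤ _ := mul_le_mul_right (h.symbolSpectrum_trilinear_le hN hs0 hs1 hu₁ hu₂ hu₃ q) _
      _ = _ := by ring
  have hsq := sq_lintegral_quadrilinear_le measurable_dispWeight (hwm.mul hGm)
    (h.measurable_symbolSpectrum hu₁) (h.measurable_symbolSpectrum hu₂)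
    (h.measurable_symbolSpectrum hu₃) dispWeight_ne_zero dispWeight_ne_top
    lintegral_dispWeight_inv_le
  have hmain : dispEnergy b G * dispEnergy b G ≤ dispEnergy b G * ((16 * dispConst) ^ 2 *
      (dispEnergy b' (symbolSpectrum θ u₁) * dispEnergy b' (symbolSpectrum θ u₂) *
        dispEnergy b' (symbolSpectrum θ u₃))) := by
    calc _ = dispEnergy b G ^ 2 := (sq _).symm
      _ ≤ _ := pow_le_pow_left' hle 2
      _ = _ := mul_pow _ _ 2
      _ ≤ _ := mul_le_mul_right hsq _
      _ ≤ 16 ^ 2 * (dispConst ^ 2 * (dispEnergy b G * (dispEnergy b' (symbolSpectrum θ u₁) *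
          dispEnergy b' (symbolSpectrum θ u₂) * dispEnergy b' (symbolSpectrum θ u₃)))) := by
        gcongr
        · exact lintegral_mono fun p => dispWeight_sq_mul_sq_le hb G p
        all_goals exact lintegral_dispWeight_sq_le_dispEnergy hb' _
      _ = _ := by ring
  rcases eq_or_ne (dispEnergy b G) 0 with h0 | h0
  · rw [h0]; exact zero_le
  · exact (ENNReal.mul_le_mul_iff_right h0 hfin).1 hmain

/-- trilinear `X^{s,b}` estimate for the upside-down multiplier `D`. -/
theorem trilinear_high
    (s ε : ℝ) (hs0 : 0 < s) (hs1 : s < 1) (hε0 : 0 < ε) (hε1 : ε ≤ 1 / 100) :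
    ∃ C : ℝ, 0 < C ∧ ∀ N : ℝ, 2 ≤ N → ∀ θ : ℝ → ℝ, AdmissibleHigh N s θ →
      ∀ u₁ u₂ u₃ : ℝ → ℝ → ℂ, IsSchwartz2 u₁ → IsSchwartz2 u₂ → IsSchwartz2 u₃ →
      XsbNorm 0 (-(1 / 2) + 2 * ε)
          (multX θ (fun x t => u₁ x t * (starRingEnd ℂ) (u₂ x t) * u₃ x t))
        ≤ C * XsbNorm 0 (1 / 2 + ε) (multX θ u₁) * XsbNorm 0 (1 / 2 + ε) (multX θ u₂)
          * XsbNorm 0 (1 / 2 + ε) (multX θ u₃) := by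
  refine ⟨16 * dispConst.toReal + 1, by positivity, ?_⟩
  intro N hN θ h u₁ u₂ u₃ hu₁ hu₂ hu₃
  have hle := h.dispEnergy_trilinear_le hN hs0 hs1 (b := -(1 / 2) + 2 * ε) (b' := 1 / 2 + ε)
    (by linarith) (by linarith) hu₁ hu₂ hu₃
  obtain ⟨f₁, e₁⟩ :=
    h.dispEnergy_ne_top_and_XsbNorm_eq hN hs0 hs1 (b := 1 / 2 + ε) (by linarith) hu₁
  obtain ⟨f₂, e₂⟩ :=
    h.dispEnergy_ne_top_and_XsbNorm_eq hN hs0 hs1 (b := 1 / 2 + ε) (by linarith) hu₂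
  obtain ⟨f₃, e₃⟩ :=
    h.dispEnergy_ne_top_and_XsbNorm_eq hN hs0 hs1 (b := 1 / 2 + ε) (by linarith) hu₃
  have hD := dispConst_ne_top
  replace hle := ENNReal.toReal_mono (by finiteness) hle
  simp only [ENNReal.toReal_mul, ENNReal.toReal_pow, ENNReal.toReal_ofNat] at hle
  rw [(h.dispEnergy_ne_top_and_XsbNorm_eq hN hs0 hs1 (by linarith)
    (hu₁.mul_conj_mul hu₂ hu₃)).2, e₁, e₂, e₃]
  simp only [← Real.sqrt_eq_rpow]
  refine (Real.sqrt_le_sqrt hle).trans ?_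
  rw [Real.sqrt_mul (by positivity), Real.sqrt_sq (by positivity), Real.sqrt_mul (by positivity),
    Real.sqrt_mul (by positivity), ← mul_assoc, ← mul_assoc]
  gcongr
  linarith
end
end
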